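/- For every (x,y) ∈ D₊ and every α > 0: θ_{x,y}(b(x,y);α) ≤ θ_{1/2,√3/2}(b(1/2,√3/2);α) and θ̂_{x,y}(b(x,y);α) ≤ θ̂_{1/2,√3/2}(b(1/2,√3/2);α), with equality (in either inequality) if and only if (x,y) = (1/2, √3/2). -/

import Mathlib

/-- The shifted lattice theta function `θ_{x,y}(z;α)`. -/
noncomputable def latticeTheta (x y : ℝ) (z : ℝ × ℝ) (α : ℝ) : ℝ :=
  ∑' p : ℤ × ℤ,
    Real.exp (-(Real.pi * α / y) *
      (((p.1 : ℝ) + z.1) ^ 2 + 2 * x * ((p.1 : ℝ) + z.1) * ((p.2 : ℝ) + z.2) +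
        (x ^ 2 + y ^ 2) * ((p.2 : ℝ) + z.2) ^ 2))

/-- The charged (dual) lattice theta function `θ̂_{x,y}(z;α)`. -/
noncomputable def latticeThetaHat (x y : ℝ) (z : ℝ × ℝ) (α : ℝ) : ℝ :=
  ∑' p : ℤ × ℤ,
    Real.exp (-(Real.pi * α / y) *
      ((p.1 : ℝ) ^ 2 + 2 * x * (p.1 : ℝ) * (p.2 : ℝ) + (x ^ 2 + y ^ 2) * (p.2 : ℝ) ^ 2)) *
    Real.cos (2 * Real.pi * ((p.1 : ℝ) * z.2 - (p.2 : ℝ) * z.1))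

/-- The special shift `b(x,y)`. -/
noncomputable def bPoint (x y : ℝ) : ℝ × ℝ :=
  ((x + (1 - x) * 4 * y ^ 2) / (8 * y ^ 2), (4 * y ^ 2 - 1) / (8 * y ^ 2))

/-- The right half of the fundamental domain of the modular group. -/
def Dplus : Set (ℝ × ℝ) :=
  {p | 0 ≤ p.1 ∧ p.1 ≤ 1 / 2 ∧ 0 < p.2 ∧ 1 ≤ p.1 ^ 2 + p.2 ^ 2}

lemma summable_exp_neg_mul_abs {c : ℝ} (hc : 0 < c) :
    Summable fun l : ℤ => Real.exp (-c * |(l : ℝ)|) := by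
  have h : Summable fun n : ℕ => Real.exp (-c * n) := by
    have := summable_geometric_of_lt_one (Real.exp_pos (-c)).le
      (by rw [Real.exp_lt_one_iff]; linarith)
    refine this.congr fun n => ?_
    rw [← Real.exp_nat_mul]; ring_nf
  refine Summable.of_nat_of_neg ?_ ?_
  · simpa using h
  · simpa using h

lemma summable_exp_neg_mul_sq {c : ℝ} (hc : 0 < c) (b : ℝ) :
    Summable fun l : ℤ => Real.exp (-c * ((l : ℝ) + b) ^ 2) := by
  refine Summable.of_nonneg_of_le (fun _ => (Real.exp_pos _).le) (fun l => ?_)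
    ((summable_exp_neg_mul_abs hc).mul_left (Real.exp (c * (|b| + 1))))
  rw [← Real.exp_add]
  refine Real.exp_le_exp.2 ?_
  have h1 : |(l : ℝ)| ≤ |(l : ℝ) + b| + |b| := by
    have := abs_sub ((l : ℝ) + b) b
    simpa using this
  have h2 : |(l : ℝ) + b| ≤ ((l : ℝ) + b) ^ 2 + 1 := by
    rw [← sq_abs]; nlinarith [sq_nonneg (|(l : ℝ) + b| - 1), abs_nonneg ((l : ℝ) + b)]
  nlinarith

lemma summable_exp_neg_mul_sq_zero {c : ℝ} (hc : 0 < c) :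
    Summable fun l : ℤ => Real.exp (-c * (l : ℝ) ^ 2) := by
  simpa using summable_exp_neg_mul_sq hc 0

/-- Gaussians times a quadratic factor are summable over `ℤ × ℤ`. -/
lemma summable_quadratic_mul_exp {δ : ℝ} (hδ : 0 < δ) :
    Summable fun q : ℤ × ℤ => (1 + (q.1 : ℝ) ^ 2 + (q.2 : ℝ) ^ 2) *
      Real.exp (-δ * ((q.1 : ℝ) ^ 2 + (q.2 : ℝ) ^ 2)) := by
  have h := (summable_exp_neg_mul_sq_zero (half_pos hδ)).mul_of_nonneg
    (summable_exp_neg_mul_sq_zero (half_pos hδ))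
    (fun _ => (Real.exp_pos _).le) (fun _ => (Real.exp_pos _).le)
  refine Summable.of_nonneg_of_le (fun q => by positivity) (fun q => ?_) (h.mul_left (1 + 2 / δ))
  rw [← Real.exp_add]
  set u : ℝ := (q.1 : ℝ) ^ 2 + (q.2 : ℝ) ^ 2 with hu
  have hu0 : 0 ≤ u := by positivity
  have h1 : 1 + (q.1 : ℝ) ^ 2 + (q.2 : ℝ) ^ 2 = 1 + u := by rw [hu]; ring
  have h2 : -(δ / 2) * (q.1 : ℝ) ^ 2 + -(δ / 2) * (q.2 : ℝ) ^ 2 = -(δ / 2) * u := by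
    rw [hu]; ring
  rw [h1, h2]
  have h3 : -δ * u = -(δ / 2) * u + -(δ / 2 * u) := by ring
  rw [h3, Real.exp_add, mul_comm (Real.exp _), ← mul_assoc]
  refine mul_le_mul_of_nonneg_right ?_ (Real.exp_pos _).le
  rw [Real.exp_neg, ← div_eq_mul_inv, div_le_iff₀ (Real.exp_pos _)]
  have h4 := Real.add_one_le_exp (δ / 2 * u)
  have h5 : (1 + 2 / δ) * (δ / 2 * u + 1) = 1 + u + (δ / 2 * u + 2 / δ) := by
    field_simp; ring
  have h6 : 0 ≤ δ / 2 * u + 2 / δ := by positivity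
  have h7 : 0 ≤ 1 + 2 / δ := by positivity
  nlinarith [mul_le_mul_of_nonneg_left h4 h7]

lemma re_cexp_ofReal_add (u v : ℝ) :
    (Complex.exp ((u : ℂ) + (v : ℂ) * Complex.I)).re = Real.exp u * Real.cos v := by
  simp [Complex.exp_re]

lemma norm_cexp_ofReal_add (u v : ℝ) :
    ‖Complex.exp ((u : ℂ) + (v : ℂ) * Complex.I)‖ = Real.exp u := by
  simp [Complex.norm_exp]

/-- Poisson summation for a shifted and modulated real Gaussian. -/
lemma tsum_gaussian_mul_cos {r : ℝ} (hr : 0 < r) (a t : ℝ) :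
    ∑' n : ℤ, Real.exp (-(Real.pi * r) * ((n : ℝ) + a) ^ 2) * Real.cos (2 * Real.pi * n * t) =
      (√r)⁻¹ * ∑' k : ℤ, Real.exp (-(Real.pi / r) * ((k : ℝ) + t) ^ 2) *
        Real.cos (2 * Real.pi * a * (k + t)) := by
  have key := Complex.tsum_exp_neg_quadratic (a := (r : ℂ)) (by simpa using hr)
    (-(r : ℂ) * a + t * Complex.I)
  have hrc : (r : ℂ) ≠ 0 := by exact_mod_cast hr.ne'
  have e1 : ∀ n : ℤ, Complex.exp (-Real.pi * r * n ^ 2 +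
      2 * Real.pi * (-(r : ℂ) * a + t * Complex.I) * n) =
      Complex.exp ((Real.pi * r * a ^ 2 : ℝ)) *
      Complex.exp (((-(Real.pi * r) * ((n : ℝ) + a) ^ 2 : ℝ) : ℂ) +
        ((2 * Real.pi * n * t : ℝ) : ℂ) * Complex.I) := by
    intro n
    rw [← Complex.exp_add]; congr 1; push_cast; ring
  have e2 : ∀ n : ℤ, Complex.exp (-Real.pi / r *
      (n + Complex.I * (-(r : ℂ) * a + t * Complex.I)) ^ 2) =
      Complex.exp ((Real.pi * r * a ^ 2 : ℝ)) *
      Complex.exp (((-(Real.pi / r) * (((-n : ℤ) : ℝ) + t) ^ 2 : ℝ) : ℂ) +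
        ((-(2 * Real.pi * a * (((-n : ℤ) : ℝ) + t)) : ℝ) : ℂ) * Complex.I) := by
    intro n
    rw [← Complex.exp_add]; congr 1; push_cast
    have hI : Complex.I ^ 2 = -1 := Complex.I_sq
    have : Complex.I * (-(r : ℂ) * a + t * Complex.I) = -(r * a * Complex.I) - t := by
      linear_combination (t : ℂ) * hI
    rw [this]
    field_simp
    linear_combination (-(r ^ 2 * a ^ 2) : ℂ) * hI
  simp_rw [e1, e2] at key
  rw [tsum_mul_left, tsum_mul_left, mul_left_comm] at key
  have key := mul_left_cancel₀ (Complex.exp_ne_zero _) key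
  have s1 : Summable fun n : ℤ => Complex.exp (((-(Real.pi * r) * ((n : ℝ) + a) ^ 2 : ℝ) : ℂ) +
        ((2 * Real.pi * n * t : ℝ) : ℂ) * Complex.I) := by
    refine Summable.of_norm ?_
    refine (summable_exp_neg_mul_sq (c := Real.pi * r) (by positivity) a).congr fun n => ?_
    rw [norm_cexp_ofReal_add]
  have s2 : Summable fun n : ℤ => Complex.exp (((-(Real.pi / r) * ((n : ℝ) + t) ^ 2 : ℝ) : ℂ) +
        ((-(2 * Real.pi * a * ((n : ℝ) + t)) : ℝ) : ℂ) * Complex.I) := by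
    refine Summable.of_norm ?_
    refine (summable_exp_neg_mul_sq (c := Real.pi / r) (by positivity) t).congr fun n => ?_
    rw [norm_cexp_ofReal_add]
  have s3 : ∑' n : ℤ, Complex.exp (((-(Real.pi / r) * (((-n : ℤ) : ℝ) + t) ^ 2 : ℝ) : ℂ) +
        ((-(2 * Real.pi * a * (((-n : ℤ) : ℝ) + t)) : ℝ) : ℂ) * Complex.I) =
      ∑' n : ℤ, Complex.exp (((-(Real.pi / r) * ((n : ℝ) + t) ^ 2 : ℝ) : ℂ) +
        ((-(2 * Real.pi * a * ((n : ℝ) + t)) : ℝ) : ℂ) * Complex.I) :=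
    (Equiv.neg ℤ).tsum_eq (fun n : ℤ => Complex.exp
      (((-(Real.pi / r) * ((n : ℝ) + t) ^ 2 : ℝ) : ℂ) +
        ((-(2 * Real.pi * a * ((n : ℝ) + t)) : ℝ) : ℂ) * Complex.I))
  rw [s3] at key
  have hroot : (1 / (r : ℂ) ^ (1 / 2 : ℂ)) = (((√r)⁻¹ : ℝ) : ℂ) := by
    rw [Real.sqrt_eq_rpow, one_div]
    push_cast [Complex.ofReal_cpow hr.le]
    norm_num
  rw [hroot] at key
  have key := congrArg Complex.re key
  rw [Complex.re_ofReal_mul, Complex.re_tsum s1, Complex.re_tsum s2] at key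
  simpa only [re_cexp_ofReal_add, Real.cos_neg] using key

lemma summable_exp_neg_shifted_form {c y : ℝ} (hc : 0 < c) (hy : 0 < y) (x u v : ℝ) :
    Summable fun q : ℤ × ℤ =>
      Real.exp (-c * (((q.1 : ℝ) + u + x * q.2) ^ 2 + y ^ 2 * ((q.2 : ℝ) + v) ^ 2)) := by
  set lam : ℝ := y ^ 2 / (y ^ 2 + 8 * x ^ 2) with hlam
  have hd : 0 < y ^ 2 + 8 * x ^ 2 := by positivity
  have hl0 : 0 < lam := by positivity
  have hl1 : lam ≤ 1 := by rw [hlam, div_le_one hd]; nlinarith [sq_nonneg x]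
  have hl2 : lam * (8 * x ^ 2) ≤ y ^ 2 := by
    have : lam * (y ^ 2 + 8 * x ^ 2) = y ^ 2 := by rw [hlam]; field_simp
    nlinarith [mul_nonneg hl0.le (sq_nonneg y)]
  have h := (summable_exp_neg_mul_sq_zero (c := c * (lam / 2)) (by positivity)).mul_of_nonneg
    (summable_exp_neg_mul_sq_zero (c := c * (y ^ 2 / 4)) (by positivity))
    (fun _ => (Real.exp_pos _).le) (fun _ => (Real.exp_pos _).le)
  refine Summable.of_nonneg_of_le (fun q => (Real.exp_pos _).le) (fun q => ?_)
    (h.mul_left (Real.exp (c * (2 * u ^ 2 + y ^ 2 * v ^ 2))))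
  rw [← Real.exp_add, ← Real.exp_add]
  refine Real.exp_le_exp.2 ?_
  set k : ℝ := (q.1 : ℝ)
  set l : ℝ := (q.2 : ℝ)
  have h1 : lam * (k ^ 2 / 2 - (2 * u ^ 2 + 2 * x ^ 2 * l ^ 2)) ≤ (k + u + x * l) ^ 2 := by
    have e1 : k ^ 2 / 2 - (2 * u ^ 2 + 2 * x ^ 2 * l ^ 2) ≤ (k + u + x * l) ^ 2 := by
      nlinarith [sq_nonneg (k + 2 * (u + x * l)), sq_nonneg (u - x * l)]
    have e2 := mul_le_mul_of_nonneg_left e1 hl0.le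
    nlinarith [sq_nonneg (k + u + x * l)]
  have h2 : y ^ 2 * (l ^ 2 / 2 - v ^ 2) ≤ y ^ 2 * (l + v) ^ 2 :=
    mul_le_mul_of_nonneg_left (by nlinarith [sq_nonneg (l + 2 * v)]) (sq_nonneg y)
  have h3 : lam * (2 * u ^ 2) ≤ 2 * u ^ 2 := by nlinarith [sq_nonneg u]
  have h4 : lam * (2 * x ^ 2 * l ^ 2) ≤ y ^ 2 / 4 * l ^ 2 := by nlinarith [sq_nonneg l]
  have h5 : lam / 2 * k ^ 2 + y ^ 2 / 4 * l ^ 2 - (2 * u ^ 2 + y ^ 2 * v ^ 2) ≤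
      (k + u + x * l) ^ 2 + y ^ 2 * (l + v) ^ 2 := by nlinarith
  nlinarith

/-- The second coordinate of the special shift. -/
noncomputable def shiftHeight (y : ℝ) : ℝ := 1 / 2 - 1 / (8 * y ^ 2)

lemma bPoint_snd {y : ℝ} (hy : 0 < y) (x : ℝ) : (bPoint x y).2 = shiftHeight y := by
  simp only [bPoint, shiftHeight]; field_simp; ring

lemma bPoint_fst {y : ℝ} (hy : 0 < y) (x : ℝ) :
    (bPoint x y).1 = 1 / 2 - x * shiftHeight y := by
  simp only [bPoint, shiftHeight]; field_simp; ring

lemma latticeTheta_bPoint {y : ℝ} (hy : 0 < y) (x α : ℝ) :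
    latticeTheta x y (bPoint x y) α = ∑' q : ℤ × ℤ,
      Real.exp (-(Real.pi * α / y) * (((q.1 : ℝ) + 1 / 2 + x * q.2) ^ 2 +
        y ^ 2 * ((q.2 : ℝ) + shiftHeight y) ^ 2)) := by
  rw [latticeTheta]
  refine tsum_congr fun q => ?_
  rw [bPoint_fst hy, bPoint_snd hy]
  congr 2; ring

lemma latticeThetaHat_bPoint {y : ℝ} (hy : 0 < y) (x s : ℝ) :
    latticeThetaHat x y (bPoint x y) s = ∑' q : ℤ × ℤ,
      Real.exp (-(Real.pi * s / y) * (((q.1 : ℝ) + x * q.2) ^ 2 + y ^ 2 * (q.2 : ℝ) ^ 2)) *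
        Real.cos (2 * Real.pi * shiftHeight y * (q.1 + x * q.2) - q.2 * Real.pi) := by
  rw [latticeThetaHat]
  refine tsum_congr fun q => ?_
  rw [bPoint_fst hy, bPoint_snd hy]
  congr 2
  · ring
  · ring

/-- The double series obtained from the shifted theta function by Poisson summation in one
variable. -/
noncomputable def mixedTheta (x r τ β : ℝ) : ℝ :=
  ∑' q : ℤ × ℤ, Real.exp (-(Real.pi * r) * ((q.1 : ℝ) + β) ^ 2) *
    (Real.exp (-(Real.pi * τ) * (q.2 : ℝ) ^ 2) *
      Real.cos (2 * Real.pi * q.2 * (1 / 2 + x * q.1)))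

lemma summable_exp_mul_exp {r τ : ℝ} (hr : 0 < r) (hτ : 0 < τ) (β : ℝ) :
    Summable fun q : ℤ × ℤ => Real.exp (-(Real.pi * r) * ((q.1 : ℝ) + β) ^ 2) *
      Real.exp (-(Real.pi * τ) * (q.2 : ℝ) ^ 2) :=
  (summable_exp_neg_mul_sq (c := Real.pi * r) (by positivity) β).mul_of_nonneg
    (summable_exp_neg_mul_sq_zero (c := Real.pi * τ) (by positivity))
    (fun _ => (Real.exp_pos _).le) (fun _ => (Real.exp_pos _).le)

lemma summable_mixedTheta {r τ : ℝ} (hr : 0 < r) (hτ : 0 < τ) (x β : ℝ) :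
    Summable fun q : ℤ × ℤ => Real.exp (-(Real.pi * r) * ((q.1 : ℝ) + β) ^ 2) *
    (Real.exp (-(Real.pi * τ) * (q.2 : ℝ) ^ 2) *
      Real.cos (2 * Real.pi * q.2 * (1 / 2 + x * q.1))) := by
  refine Summable.of_norm_bounded (summable_exp_mul_exp hr hτ β) fun q => ?_
  rw [norm_mul, norm_mul, Real.norm_eq_abs, Real.norm_eq_abs, Real.norm_eq_abs, Real.abs_exp,
    Real.abs_exp]
  refine mul_le_mul_of_nonneg_left ?_ (Real.exp_pos _).le
  exact mul_le_of_le_one_right (Real.exp_pos _).le (Real.abs_cos_le_one _)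

lemma latticeTheta_eq_mixedTheta {y α : ℝ} (hy : 0 < y) (hα : 0 < α) (x : ℝ) :
    latticeTheta x y (bPoint x y) α =
      √(y / α) * mixedTheta x (y * α) (y / α) (shiftHeight y) := by
  rw [latticeTheta_bPoint hy, mixedTheta, ← (Equiv.prodComm ℤ ℤ).tsum_eq,
    (summable_mixedTheta (by positivity) (by positivity) _ _).tsum_prod, ← tsum_mul_left,
    Summable.tsum_prod]
  · refine tsum_congr fun l => ?_
    have hp := tsum_gaussian_mul_cos (r := α / y) (by positivity) (1 / 2 + x * l) 0
    simp only [mul_zero, Real.cos_zero, mul_one, add_zero] at hp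
    have h1 : (√(α / y))⁻¹ = √(y / α) := by rw [← Real.sqrt_inv, inv_div]
    simp only [Equiv.prodComm_apply, Prod.swap]
    rw [tsum_mul_left, mul_left_comm]
    have h2 : ∀ k : ℤ, Real.exp (-(Real.pi * (y / α)) * (k : ℝ) ^ 2) *
        Real.cos (2 * Real.pi * k * (1 / 2 + x * l)) = Real.exp (-(Real.pi / (α / y)) * k ^ 2) *
        Real.cos (2 * Real.pi * (1 / 2 + x * l) * k) := by
      intro k
      congr 2
      · field_simp
      · ring
    simp_rw [h2]
    rw [← h1, ← hp, ← tsum_mul_left]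
    refine tsum_congr fun k => ?_
    rw [← Real.exp_add]
    congr 1
    field_simp
    ring
  · exact ((Equiv.prodComm ℤ ℤ).summable_iff).2
      (summable_exp_neg_shifted_form (c := Real.pi * α / y) (by positivity) hy x (1 / 2)
        (shiftHeight y))

lemma cos_sub_int_mul_pi_comm (u : ℝ) (l : ℤ) :
    Real.cos (u - l * Real.pi) = Real.cos (l * Real.pi) * Real.cos u := by
  rw [Real.cos_sub, Real.sin_int_mul_pi]; ring

lemma summable_latticeThetaHat {y s : ℝ} (hy : 0 < y) (hs : 0 < s) (x : ℝ) :
    Summable fun q : ℤ × ℤ =>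
      Real.exp (-(Real.pi * s / y) * (((q.1 : ℝ) + x * q.2) ^ 2 + y ^ 2 * (q.2 : ℝ) ^ 2)) *
        Real.cos (2 * Real.pi * shiftHeight y * (q.1 + x * q.2) - q.2 * Real.pi) := by
  have h := summable_exp_neg_shifted_form (c := Real.pi * s / y) (by positivity) hy x 0 0
  refine Summable.of_norm_bounded h fun q => ?_
  rw [norm_mul, Real.norm_eq_abs, Real.norm_eq_abs, Real.abs_exp, add_zero, add_zero]
  exact mul_le_of_le_one_right (Real.exp_pos _).le (Real.abs_cos_le_one _)

lemma latticeThetaHat_eq_mixedTheta {y s : ℝ} (hy : 0 < y) (hs : 0 < s) (x : ℝ) :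
    latticeThetaHat x y (bPoint x y) s =
      √(y / s) * mixedTheta x (y / s) (y * s) (shiftHeight y) := by
  have hm := summable_mixedTheta (r := y / s) (τ := y * s) (by positivity) (by positivity) x
    (shiftHeight y)
  rw [latticeThetaHat_bPoint hy, mixedTheta, ← (Equiv.prodComm ℤ ℤ).tsum_eq,
    ← (Equiv.prodComm ℤ ℤ).tsum_eq (fun q : ℤ × ℤ =>
      Real.exp (-(Real.pi * (y / s)) * ((q.1 : ℝ) + shiftHeight y) ^ 2) *
    (Real.exp (-(Real.pi * (y * s)) * (q.2 : ℝ) ^ 2) *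
      Real.cos (2 * Real.pi * q.2 * (1 / 2 + x * q.1)))),
    Summable.tsum_prod, Summable.tsum_prod, ← tsum_mul_left]
  · refine tsum_congr fun l => ?_
    have hp := tsum_gaussian_mul_cos (r := y / s) (by positivity) (shiftHeight y) (x * l)
    have hs' : √(y / s) ≠ 0 := by positivity
    have h1 : ∑' k : ℤ, Real.exp (-(Real.pi / (y / s)) * ((k : ℝ) + x * l) ^ 2) *
        Real.cos (2 * Real.pi * shiftHeight y * (k + x * l)) =
        √(y / s) * ∑' n : ℤ, Real.exp (-(Real.pi * (y / s)) * ((n : ℝ) + shiftHeight y) ^ 2) *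
        Real.cos (2 * Real.pi * n * (x * l)) := by rw [hp, mul_inv_cancel_left₀ hs']
    simp only [Equiv.prodComm_apply, Prod.swap]
    have e1 : ∀ k : ℤ, Real.exp (-(Real.pi * s / y) *
        (((k : ℝ) + x * l) ^ 2 + y ^ 2 * (l : ℝ) ^ 2)) *
        Real.cos (2 * Real.pi * shiftHeight y * (k + x * l) - l * Real.pi) =
        (Real.exp (-(Real.pi * (y * s)) * (l : ℝ) ^ 2) * Real.cos (l * Real.pi)) *
        (Real.exp (-(Real.pi / (y / s)) * ((k : ℝ) + x * l) ^ 2) *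
        Real.cos (2 * Real.pi * shiftHeight y * (k + x * l))) := by
      intro k
      rw [cos_sub_int_mul_pi_comm]
      have : -(Real.pi * s / y) * (((k : ℝ) + x * l) ^ 2 + y ^ 2 * (l : ℝ) ^ 2) =
        -(Real.pi * (y * s)) * (l : ℝ) ^ 2 + -(Real.pi / (y / s)) * ((k : ℝ) + x * l) ^ 2 := by
        field_simp; ring
      rw [this, Real.exp_add]; ring
    have e2 : ∀ n : ℤ, Real.exp (-(Real.pi * (y / s)) * ((n : ℝ) + shiftHeight y) ^ 2) *
        (Real.exp (-(Real.pi * (y * s)) * (l : ℝ) ^ 2) *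
        Real.cos (2 * Real.pi * l * (1 / 2 + x * n))) =
        (Real.exp (-(Real.pi * (y * s)) * (l : ℝ) ^ 2) * Real.cos (l * Real.pi)) *
        (Real.exp (-(Real.pi * (y / s)) * ((n : ℝ) + shiftHeight y) ^ 2) *
        Real.cos (2 * Real.pi * n * (x * l))) := by
      intro n
      have : 2 * Real.pi * l * (1 / 2 + x * n) = -(2 * Real.pi * n * (-(x * l)) - l * Real.pi) := by
        ring
      rw [this, Real.cos_neg, cos_sub_int_mul_pi_comm, mul_neg, Real.cos_neg]; ring
    simp_rw [e1, e2]
    rw [tsum_mul_left, tsum_mul_left, h1]; ring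
  · exact ((Equiv.prodComm ℤ ℤ).summable_iff).2 hm
  · exact ((Equiv.prodComm ℤ ℤ).summable_iff).2 (summable_latticeThetaHat hy hs x)

/-- Duality between the shifted and the charged theta functions at the special shift. -/
lemma latticeTheta_eq_inv_mul_hat {y α : ℝ} (hy : 0 < y) (hα : 0 < α) (x : ℝ) :
    latticeTheta x y (bPoint x y) α = α⁻¹ * latticeThetaHat x y (bPoint x y) α⁻¹ := by
  rw [latticeTheta_eq_mixedTheta hy hα, latticeThetaHat_eq_mixedTheta hy (inv_pos.2 hα),
    div_inv_eq_mul, ← div_eq_mul_inv, ← mul_assoc]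
  congr 1
  rw [Real.sqrt_div hy.le, Real.sqrt_mul hy.le]
  have h := Real.sq_sqrt hα.le
  have h0 : √α ≠ 0 := by positivity
  field_simp
  exact h.symm

/-- A lower bound for a sum over `ℤ` whose terms beyond `-1, 0, 1` decay geometrically. -/
lemma tsum_int_ge {f : ℤ → ℝ} (hf : Summable f) {c c' κ : ℝ} (hκ0 : 0 ≤ κ) (hκ1 : κ < 1)
    (h : ∀ n : ℕ, -(c * κ ^ n) ≤ f (n + 2)) (h' : ∀ n : ℕ, -(c' * κ ^ n) ≤ f (-(n + 2))) :
    f (-1) + f 0 + f 1 - (c + c') / (1 - κ) ≤ ∑' l, f l := by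
  have hg : Summable fun n : ℕ => f n :=
    hf.comp_injective Nat.cast_injective
  have hg' : Summable fun n : ℕ => f (-(n + 1 : ℤ)) :=
    hf.comp_injective (i := fun n : ℕ => -(n + 1 : ℤ)) fun a b hab => by simpa using hab
  have hgeo := hasSum_geometric_of_lt_one hκ0 hκ1
  rw [tsum_of_nat_of_neg_add_one hg hg', ← hg.sum_add_tsum_nat_add 2, ← hg'.sum_add_tsum_nat_add 1]
  have h1 : -(c * (1 - κ)⁻¹) ≤ ∑' n : ℕ, f ((n + 2 : ℕ) : ℤ) := by
    rw [← hgeo.tsum_eq, ← tsum_mul_left, ← tsum_neg]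
    refine Summable.tsum_le_tsum (fun n => ?_) (hgeo.summable.mul_left c).neg
      ((summable_nat_add_iff 2).2 hg)
    simpa using h n
  have h2 : -(c' * (1 - κ)⁻¹) ≤ ∑' n : ℕ, f (-(((n + 1 : ℕ) : ℤ) + 1)) := by
    rw [← hgeo.tsum_eq, ← tsum_mul_left, ← tsum_neg]
    refine Summable.tsum_le_tsum (fun n => ?_) (hgeo.summable.mul_left c').neg
      ((summable_nat_add_iff 1).2 hg')
    have := h' n
    push_cast
    rwa [add_assoc, one_add_one_eq_two]
  simp only [Finset.sum_range_succ, Finset.sum_range_zero]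
  rw [div_eq_mul_inv]
  norm_num at h1 h2 ⊢
  linarith

lemma abs_sin_nat_mul_le (n : ℕ) (t : ℝ) : |Real.sin (n * t)| ≤ n * |Real.sin t| := by
  induction n with
  | zero => simp
  | succ n ih =>
    push_cast
    rw [add_mul, one_mul, Real.sin_add, add_mul, one_mul]
    refine (abs_add_le _ _).trans (add_le_add ?_ ?_)
    · rw [abs_mul]
      exact (mul_le_of_le_one_right (abs_nonneg _) (Real.abs_cos_le_one _)).trans ih
    · rw [abs_mul]
      exact mul_le_of_le_one_left (abs_nonneg _) (Real.abs_cos_le_one _)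

lemma one_sub_cos_eq (t : ℝ) : 1 - Real.cos t = 2 * Real.sin (t / 2) ^ 2 := by
  have h := Real.cos_sq_add_sin_sq (t / 2)
  have h2 := Real.cos_two_mul (t / 2)
  rw [show 2 * (t / 2) = t by ring] at h2
  linarith

lemma one_sub_cos_int_mul_le (n : ℤ) (t : ℝ) :
    1 - Real.cos (n * t) ≤ (n : ℝ) ^ 2 * (1 - Real.cos t) := by
  have key : ∀ m : ℕ, 1 - Real.cos (m * t) ≤ (m : ℝ) ^ 2 * (1 - Real.cos t) := by
    intro m
    rw [one_sub_cos_eq, one_sub_cos_eq]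
    have h := abs_sin_nat_mul_le m (t / 2)
    have h2 := pow_le_pow_left₀ (abs_nonneg _) h 2
    rw [sq_abs, mul_pow, sq_abs] at h2
    rw [mul_div_assoc]
    linarith
  obtain ⟨m, rfl | rfl⟩ := n.eq_nat_or_neg
  · exact_mod_cast key m
  · have := key m
    push_cast at this ⊢
    rw [neg_mul, Real.cos_neg, neg_sq]
    exact this

lemma sq_mul_pow_le {q : ℝ} (hq0 : 0 ≤ q) (hq1 : q ≤ 1) (n : ℕ) :
    ((n : ℝ) + 2) ^ 2 * q ^ ((n + 1) * (n + 2)) ≤ 4 * q ^ 2 * (9 / 4 * q ^ 4) ^ n := by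
  induction n with
  | zero => norm_num
  | succ n ih =>
    have e : (n + 1 + 1) * (n + 1 + 2) = (n + 1) * (n + 2) + 4 + 2 * n := by ring
    rw [e, pow_add, pow_add]
    have h1 : q ^ (2 * n) ≤ 1 := pow_le_one₀ hq0 hq1
    have h2 : ((↑(n + 1) : ℝ) + 2) ^ 2 ≤ 9 / 4 * ((n : ℝ) + 2) ^ 2 := by
      push_cast
      have : (0 : ℝ) ≤ n := Nat.cast_nonneg n
      nlinarith
    calc ((↑(n + 1) : ℝ) + 2) ^ 2 * (q ^ ((n + 1) * (n + 2)) * q ^ 4 * q ^ (2 * n))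
        ≤ (9 / 4 * ((n : ℝ) + 2) ^ 2) * (q ^ ((n + 1) * (n + 2)) * q ^ 4 * 1) := by gcongr
      _ = (((n : ℝ) + 2) ^ 2 * q ^ ((n + 1) * (n + 2))) * (9 / 4 * q ^ 4) := by ring
      _ ≤ (4 * q ^ 2 * (9 / 4 * q ^ 4) ^ n) * (9 / 4 * q ^ 4) := by gcongr
      _ = _ := by ring

/-- The difference of two mixed series, written with the sign `(-1)^(m(l+1))`. -/
lemma mixedTheta_half_sub {r τ : ℝ} (hr : 0 < r) (hτ : 0 < τ) (d β : ℝ) :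
    mixedTheta (1 / 2) r τ β - mixedTheta (1 / 2 - d) r τ β =
      ∑' q : ℤ × ℤ, Real.exp (-(Real.pi * r) * ((q.1 : ℝ) + β) ^ 2) *
        (Real.exp (-(Real.pi * τ) * (q.2 : ℝ) ^ 2) * (Real.cos (q.2 * (q.1 + 1) * Real.pi) *
          (1 - Real.cos (2 * Real.pi * q.1 * q.2 * d)))) ∧
    Summable fun q : ℤ × ℤ => Real.exp (-(Real.pi * r) * ((q.1 : ℝ) + β) ^ 2) *
        (Real.exp (-(Real.pi * τ) * (q.2 : ℝ) ^ 2) * (Real.cos (q.2 * (q.1 + 1) * Real.pi) *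
          (1 - Real.cos (2 * Real.pi * q.1 * q.2 * d)))) := by
  have e : ∀ q : ℤ × ℤ, Real.exp (-(Real.pi * r) * ((q.1 : ℝ) + β) ^ 2) *
        (Real.exp (-(Real.pi * τ) * (q.2 : ℝ) ^ 2) * (Real.cos (q.2 * (q.1 + 1) * Real.pi) *
          (1 - Real.cos (2 * Real.pi * q.1 * q.2 * d)))) =
      Real.exp (-(Real.pi * r) * ((q.1 : ℝ) + β) ^ 2) *
        (Real.exp (-(Real.pi * τ) * (q.2 : ℝ) ^ 2) *
          Real.cos (2 * Real.pi * q.2 * (1 / 2 + 1 / 2 * q.1))) -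
      Real.exp (-(Real.pi * r) * ((q.1 : ℝ) + β) ^ 2) *
        (Real.exp (-(Real.pi * τ) * (q.2 : ℝ) ^ 2) *
          Real.cos (2 * Real.pi * q.2 * (1 / 2 + (1 / 2 - d) * q.1))) := by
    intro q
    have h1 : 2 * Real.pi * q.2 * (1 / 2 + 1 / 2 * q.1) = q.2 * (q.1 + 1) * Real.pi := by ring
    have h2 : 2 * Real.pi * q.2 * (1 / 2 + (1 / 2 - d) * q.1) =
        q.2 * (q.1 + 1) * Real.pi - 2 * Real.pi * q.1 * q.2 * d := by ring
    have h3 : Real.sin (q.2 * (q.1 + 1) * Real.pi) = 0 := by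
      have := Real.sin_int_mul_pi (q.2 * (q.1 + 1))
      exact_mod_cast this
    rw [h1, h2, Real.cos_sub, h3]; ring
  have s1 := summable_mixedTheta hr hτ (1 / 2) β
  have s2 := summable_mixedTheta hr hτ (1 / 2 - d) β
  simp_rw [e]
  exact ⟨(s1.tsum_sub s2).symm, s1.sub s2⟩

lemma one_sub_cos_nonneg (t : ℝ) : 0 ≤ 1 - Real.cos t := by linarith [Real.cos_le_one t]

lemma mixedTheta_lt_of_large {r τ d β : ℝ} (hr : 3 / 10 ≤ r) (hτ : 0 < τ) (hd0 : 0 < d)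
    (hd1 : d ≤ 1 / 2) (hβ0 : 0 ≤ β) (hβ1 : β ≤ 1 / 2) :
    mixedTheta (1 / 2 - d) r τ β < mixedTheta (1 / 2) r τ β := by
  have hr0 : 0 < r := by linarith
  obtain ⟨hsub, hsum⟩ := mixedTheta_half_sub hr0 hτ d β
  rw [← sub_pos, hsub, hsum.tsum_prod]
  set v : ℤ → ℝ := fun m => Real.exp (-(Real.pi * τ) * (m : ℝ) ^ 2) with hv
  have hv0 : ∀ m, 0 < v m := fun m => Real.exp_pos _
  have hvs : Summable v := summable_exp_neg_mul_sq_zero (c := Real.pi * τ) (by positivity)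
  set E : ℝ := ∑' m : ℤ, v m * (1 - Real.cos (m * (2 * Real.pi * d))) with hE
  have hEs : Summable fun m : ℤ => v m * (1 - Real.cos (m * (2 * Real.pi * d))) := by
    refine Summable.of_nonneg_of_le (fun m => mul_nonneg (hv0 m).le (one_sub_cos_nonneg _))
      (fun m => ?_) (hvs.mul_left 2)
    nlinarith [hv0 m, Real.neg_one_le_cos (m * (2 * Real.pi * d))]
  have hE0 : 0 < E := by
    refine hEs.tsum_pos (fun m => mul_nonneg (hv0 m).le (one_sub_cos_nonneg _)) 1 ?_
    refine mul_pos (hv0 1) ?_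
    rw [one_sub_cos_eq]
    have : 0 < Real.sin (((1 : ℤ) : ℝ) * (2 * Real.pi * d) / 2) := by
      refine Real.sin_pos_of_pos_of_lt_pi ?_ ?_
      · have := Real.pi_pos; push_cast; positivity
      · push_cast; nlinarith [Real.pi_pos]
    positivity
  set D : ℤ → ℝ := fun l => ∑' m : ℤ, v m * (Real.cos (m * (l + 1) * Real.pi) *
          (1 - Real.cos (2 * Real.pi * l * m * d))) with hD
  have hbd : ∀ l m : ℤ, |v m * (Real.cos (m * (l + 1) * Real.pi) *
          (1 - Real.cos (2 * Real.pi * l * m * d)))| ≤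
          (l : ℝ) ^ 2 * (v m * (1 - Real.cos (m * (2 * Real.pi * d)))) := by
    intro l m
    rw [abs_mul, abs_mul, abs_of_pos (hv0 m), abs_of_nonneg (one_sub_cos_nonneg _)]
    have h1 := one_sub_cos_int_mul_le l (m * (2 * Real.pi * d))
    rw [show (l : ℝ) * (m * (2 * Real.pi * d)) = 2 * Real.pi * l * m * d by ring] at h1
    calc _ ≤ v m * (1 * ((l : ℝ) ^ 2 * (1 - Real.cos (m * (2 * Real.pi * d))))) := by
          refine mul_le_mul_of_nonneg_left ?_ (hv0 m).le
          exact mul_le_mul (Real.abs_cos_le_one _) h1 (one_sub_cos_nonneg _) zero_le_one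
      _ = _ := by ring
  have hDb : ∀ l : ℤ, |D l| ≤ (l : ℝ) ^ 2 * E := by
    intro l
    rw [hE, ← tsum_mul_left, ← Real.norm_eq_abs]
    exact tsum_of_norm_bounded ((hEs.mul_left _).hasSum) (hbd l)
  have hD1 : D (-1) = E := by
    refine tsum_congr fun m => ?_
    push_cast
    rw [neg_add_cancel, mul_zero, zero_mul, Real.cos_zero, one_mul,
      show 2 * Real.pi * (-1) * m * d = -(m * (2 * Real.pi * d)) by ring, Real.cos_neg]
  have hD0 : D 0 = 0 := by
    simp [hD]
  have hDp : 0 ≤ D 1 := by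
    refine tsum_nonneg fun m => mul_nonneg (hv0 m).le (mul_nonneg ?_ (one_sub_cos_nonneg _))
    push_cast
    rw [show (m : ℝ) * (1 + 1) * Real.pi = m * (2 * Real.pi) by ring, Real.cos_int_mul_two_pi]
    exact zero_le_one
  set q : ℝ := Real.exp (-(Real.pi * r)) with hq
  have hq0 : 0 < q := Real.exp_pos _
  have hq1 : q ≤ 0.395 := by
    have h1 : q ≤ Real.exp (-0.942) :=
      Real.exp_le_exp.2 (by nlinarith [Real.pi_gt_d4])
    have h2 : Real.exp (-0.942) * Real.exp 0.942 = 1 := by rw [← Real.exp_add]; norm_num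
    have h3 : Real.exp 0.942 = Real.exp 1 * Real.exp (-0.058) := by rw [← Real.exp_add]; norm_num
    have h4 := Real.add_one_le_exp (-0.058 : ℝ)
    have h5 := Real.exp_one_gt_d9
    have h6 : 2.56 ≤ Real.exp 0.942 := by rw [h3]; nlinarith
    nlinarith [Real.exp_pos (-0.942)]
  set w : ℤ → ℝ := fun l => Real.exp (-(Real.pi * r) * ((l : ℝ) + β) ^ 2) with hw
  have hw0 : ∀ l, 0 < w l := fun l => Real.exp_pos _
  have hfs : Summable fun l : ℤ => w l * D l := by
    have := hsum.prod
    simp_rw [tsum_mul_left] at this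
    exact this
  have hwn : ∀ n : ℕ, w (-(n + 2)) ≤ w (-1) * q ^ ((n + 1) * (n + 2)) := by
    intro n
    simp only [hw, hq]
    rw [← Real.exp_nat_mul, ← Real.exp_add]
    refine Real.exp_le_exp.2 ?_
    push_cast
    have hn : (0 : ℝ) ≤ n := Nat.cast_nonneg n
    have : (0 : ℝ) ≤ Real.pi * r := by positivity
    nlinarith [mul_nonneg this (mul_nonneg (by linarith : (0 : ℝ) ≤ n + 1)
      (by linarith : 0 ≤ 1 - 2 * β))]
  have hwp : ∀ n : ℕ, w (n + 2) ≤ w (-1) * q * q ^ ((n + 1) * (n + 2)) := by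
    intro n
    simp only [hw, hq]
    rw [← Real.exp_nat_mul, ← Real.exp_add, ← Real.exp_add]
    refine Real.exp_le_exp.2 ?_
    push_cast
    have hn : (0 : ℝ) ≤ n := Nat.cast_nonneg n
    have : (0 : ℝ) ≤ Real.pi * r := by positivity
    nlinarith [mul_nonneg this (mul_nonneg (by linarith : (0 : ℝ) ≤ n + 3) hβ0),
      mul_nonneg this hn]
  have hκ1 : 9 / 4 * q ^ 4 ≤ 0.06 := by
    calc 9 / 4 * q ^ 4 ≤ 9 / 4 * 0.395 ^ 4 := by gcongr
      _ ≤ 0.06 := by norm_num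
  have hmain := tsum_int_ge hfs (c := w (-1) * E * (q * (4 * q ^ 2)))
    (c' := w (-1) * E * (4 * q ^ 2)) (κ := 9 / 4 * q ^ 4) (by positivity) (by linarith)
    (fun n => by
      have h1 := (abs_le.1 (hDb (n + 2))).1
      have h2 := sq_mul_pow_le hq0.le (by linarith) n
      have h3 := hwp n
      push_cast at h1
      have h4 : w (n + 2) * -(((n : ℝ) + 2) ^ 2 * E) ≤ w (n + 2) * D (n + 2) :=
        mul_le_mul_of_nonneg_left h1 (hw0 _).le
      refine le_trans ?_ h4
      rw [mul_neg, neg_le_neg_iff]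
      calc w (n + 2) * (((n : ℝ) + 2) ^ 2 * E)
          ≤ (w (-1) * q * q ^ ((n + 1) * (n + 2))) * (((n : ℝ) + 2) ^ 2 * E) := by gcongr
        _ = w (-1) * E * q * (((n : ℝ) + 2) ^ 2 * q ^ ((n + 1) * (n + 2))) := by ring
        _ ≤ w (-1) * E * q * (4 * q ^ 2 * (9 / 4 * q ^ 4) ^ n) :=
          mul_le_mul_of_nonneg_left h2 (by have := hw0 (-1); positivity)
        _ = _ := by ring)
    (fun n => by
      have h1 := (abs_le.1 (hDb (-(n + 2)))).1
      have h2 := sq_mul_pow_le hq0.le (by linarith) n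
      have h3 := hwn n
      push_cast at h1
      have h4 := mul_le_mul_of_nonneg_left h1 (hw0 (-(n + 2))).le
      refine le_trans ?_ h4
      rw [mul_neg, neg_le_neg_iff]
      calc w (-(n + 2)) * ((-((n : ℝ) + 2)) ^ 2 * E)
          ≤ (w (-1) * q ^ ((n + 1) * (n + 2))) * ((-((n : ℝ) + 2)) ^ 2 * E) := by gcongr
        _ = w (-1) * E * (((n : ℝ) + 2) ^ 2 * q ^ ((n + 1) * (n + 2))) := by ring
        _ ≤ w (-1) * E * (4 * q ^ 2 * (9 / 4 * q ^ 4) ^ n) :=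
          mul_le_mul_of_nonneg_left h2 (by have := hw0 (-1); positivity)
        _ = _ := by ring)
  simp_rw [tsum_mul_left]
  refine lt_of_lt_of_le ?_ hmain
  rw [hD1, hD0, mul_zero, add_zero]
  have hA : 0 < w (-1) * E := mul_pos (hw0 _) hE0
  have hB : 0 ≤ w 1 * D 1 := mul_nonneg (hw0 _).le hDp
  have hC : (w (-1) * E * (q * (4 * q ^ 2)) + w (-1) * E * (4 * q ^ 2)) / (1 - 9 / 4 * q ^ 4) <
      w (-1) * E := by
    rw [div_lt_iff₀ (by linarith)]
    have : q * (4 * q ^ 2) + 4 * q ^ 2 < 1 - 9 / 4 * q ^ 4 := by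
      have : q * (4 * q ^ 2) + 4 * q ^ 2 ≤ 0.395 * (4 * 0.395 ^ 2) + 4 * 0.395 ^ 2 := by gcongr
      norm_num at this hκ1 ⊢
      linarith
    nlinarith
  linarith

/-- A Gaussian modulated by a cosine. -/
noncomputable def gaussCos (X b t : ℝ) : ℝ := Real.exp (-X * t ^ 2) * Real.cos (b * t)

lemma gaussCos_neg (X b t : ℝ) : gaussCos X b (-t) = gaussCos X b t := by
  simp [gaussCos]

lemma sinh_le_mul_exp (u : ℝ) : Real.sinh u ≤ u * Real.exp u := by
  rw [Real.sinh_eq]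
  have h1 := Real.add_one_le_exp (-(2 * u))
  have h2 : Real.exp (-u) = Real.exp u * Real.exp (-(2 * u)) := by rw [← Real.exp_add]; ring_nf
  rw [h2]
  nlinarith [Real.exp_pos u]

lemma cosh_sub_one_le {p : ℝ} (hp : 0 ≤ p) : Real.cosh p - 1 ≤ p ^ 2 / 2 * Real.exp p := by
  have h1 : Real.cosh p = 1 + 2 * Real.sinh (p / 2) ^ 2 := by
    have := Real.cosh_two_mul (p / 2)
    rw [show 2 * (p / 2) = p by ring] at this
    rw [this, Real.cosh_sq]; ring
  have h2 := sinh_le_mul_exp (p / 2)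
  have h3 : Real.exp p = Real.exp (p / 2) ^ 2 := by rw [← Real.exp_nat_mul]; ring_nf
  have h4 : 0 ≤ Real.sinh (p / 2) := Real.sinh_nonneg_iff.2 (div_nonneg hp zero_le_two)
  have h5 := pow_le_pow_left₀ h4 h2 2
  rw [h1, h3]
  nlinarith

lemma cosh_le_exp {p : ℝ} (hp : 0 ≤ p) : Real.cosh p ≤ Real.exp p := by
  rw [Real.cosh_eq]
  linarith [Real.exp_le_exp.2 (by linarith : -p ≤ p)]

lemma gaussCos_add_add_gaussCos_sub (X b κ d : ℝ) :
    gaussCos X b (κ + d) + gaussCos X b (κ - d) - 2 * gaussCos X b κ =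
      2 * Real.exp (-X * (κ ^ 2 + d ^ 2)) *
        ((Real.cosh (2 * X * κ * d) * Real.cos (b * d) - 1) * Real.cos (b * κ) +
          Real.sinh (2 * X * κ * d) * Real.sin (b * d) * Real.sin (b * κ)) -
      2 * (Real.exp (-X * κ ^ 2) - Real.exp (-X * (κ ^ 2 + d ^ 2))) * Real.cos (b * κ) := by
  simp only [gaussCos]
  have e1 : Real.exp (-X * (κ + d) ^ 2) =
      Real.exp (-X * (κ ^ 2 + d ^ 2)) * Real.exp (-(2 * X * κ * d)) := by
    rw [← Real.exp_add]; ring_nf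
  have e2 : Real.exp (-X * (κ - d) ^ 2) =
      Real.exp (-X * (κ ^ 2 + d ^ 2)) * Real.exp (2 * X * κ * d) := by
    rw [← Real.exp_add]; ring_nf
  rw [e1, e2, mul_add b, mul_sub b, Real.cos_add, Real.cos_sub, Real.cosh_eq, Real.sinh_eq]
  ring

lemma abs_gaussCos_second_diff_le {X b d κ : ℝ} (hX : 0 < X) (hb : 0 ≤ b) (hd0 : 0 ≤ d)
    (hd1 : d ≤ 1 / 2) (hκ : 1 / 2 ≤ κ) :
    |gaussCos X b (κ + d) + gaussCos X b (κ - d) - 2 * gaussCos X b κ| ≤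
      2 * d ^ 2 * (4 * X ^ 2 * κ ^ 2 + b ^ 2 + X) * Real.exp (-X * (κ - 1 / 2) ^ 2) := by
  rw [gaussCos_add_add_gaussCos_sub]
  set p := 2 * X * κ * d with hp
  have hp0 : 0 ≤ p := by positivity
  set q := b * d with hq
  have hq0 : 0 ≤ q := by positivity
  set M := Real.exp (-X * (κ - 1 / 2) ^ 2) with hM
  have hM0 : 0 < M := Real.exp_pos _
  set A := Real.exp (-X * (κ ^ 2 + d ^ 2)) with hA
  have hA0 : 0 < A := Real.exp_pos _
  have hAM : A * Real.exp p ≤ M := by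
    rw [hA, hM, ← Real.exp_add]
    refine Real.exp_le_exp.2 ?_
    have h1 : (κ - 1 / 2) ^ 2 ≤ (κ - d) ^ 2 := by nlinarith
    rw [hp]; nlinarith
  have hB : Real.exp (-X * κ ^ 2) - A ≤ X * d ^ 2 * M := by
    have h1 : A = Real.exp (-X * κ ^ 2) * Real.exp (-(X * d ^ 2)) := by
      rw [hA, ← Real.exp_add]; ring_nf
    have h2 := Real.add_one_le_exp (-(X * d ^ 2))
    have h3 : Real.exp (-X * κ ^ 2) ≤ M := Real.exp_le_exp.2 (by nlinarith)
    have h4 : 0 ≤ X * d ^ 2 := by positivity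
    have h5 := Real.exp_pos (-X * κ ^ 2)
    nlinarith [mul_le_mul_of_nonneg_left h3 h4, mul_le_mul_of_nonneg_left h2 h5.le]
  have hB0 : 0 ≤ Real.exp (-X * κ ^ 2) - A :=
    sub_nonneg.2 (Real.exp_le_exp.2 (by nlinarith [mul_nonneg hX.le (sq_nonneg d)]))
  have hC : |Real.cosh p * Real.cos q - 1| ≤ (p ^ 2 + q ^ 2) / 2 * Real.exp p := by
    have h1 := cosh_sub_one_le hp0
    have h2 := cosh_le_exp hp0
    have h3 := Real.one_sub_sq_div_two_le_cos (x := q)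
    have h4 := Real.cos_le_one q
    have h5 := Real.one_le_cosh p
    rw [abs_le]
    constructor
    · nlinarith [mul_le_mul_of_nonneg_left h3 (by linarith : 0 ≤ Real.cosh p),
        mul_le_mul_of_nonneg_left h2 (by positivity : 0 ≤ q ^ 2 / 2),
        mul_nonneg (sq_nonneg p) (Real.exp_pos p).le]
    · nlinarith [mul_le_mul_of_nonneg_left h4 (by linarith : 0 ≤ Real.cosh p),
        mul_nonneg (sq_nonneg q) (Real.exp_pos p).le]
  have hS : |Real.sinh p * Real.sin q| ≤ (p ^ 2 + q ^ 2) / 2 * Real.exp p := by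
    rw [abs_mul, abs_of_nonneg (Real.sinh_nonneg_iff.2 hp0)]
    have h1 := sinh_le_mul_exp p
    have h2 : |Real.sin q| ≤ q := (Real.abs_sin_le_abs).trans_eq (abs_of_nonneg hq0)
    calc Real.sinh p * |Real.sin q| ≤ (p * Real.exp p) * q :=
          mul_le_mul h1 h2 (abs_nonneg _) (by positivity)
      _ ≤ _ := by nlinarith [mul_nonneg (sq_nonneg (p - q)) (Real.exp_pos p).le]
  have t1 : |(Real.cosh p * Real.cos q - 1) * Real.cos (b * κ)| ≤
      (p ^ 2 + q ^ 2) / 2 * Real.exp p := by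
    rw [abs_mul]
    exact (mul_le_of_le_one_right (abs_nonneg _) (Real.abs_cos_le_one _)).trans hC
  have t2 : |Real.sinh p * Real.sin q * Real.sin (b * κ)| ≤
      (p ^ 2 + q ^ 2) / 2 * Real.exp p := by
    rw [abs_mul]
    exact (mul_le_of_le_one_right (abs_nonneg _) (Real.abs_sin_le_one _)).trans hS
  have t3 : |2 * (Real.exp (-X * κ ^ 2) - A) * Real.cos (b * κ)| ≤ 2 * (X * d ^ 2 * M) := by
    rw [abs_mul, abs_mul, abs_two, abs_of_nonneg hB0]
    exact (mul_le_of_le_one_right (by positivity) (Real.abs_cos_le_one _)).trans (by linarith)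
  have t4 : |2 * A * ((Real.cosh p * Real.cos q - 1) * Real.cos (b * κ) +
      Real.sinh p * Real.sin q * Real.sin (b * κ))| ≤ 2 * (p ^ 2 + q ^ 2) * M := by
    rw [abs_mul, abs_of_pos (by positivity : 0 < 2 * A)]
    have := (abs_add_le ((Real.cosh p * Real.cos q - 1) * Real.cos (b * κ))
      (Real.sinh p * Real.sin q * Real.sin (b * κ))).trans (add_le_add t1 t2)
    calc _ ≤ 2 * A * ((p ^ 2 + q ^ 2) * Real.exp p) := by
          refine mul_le_mul_of_nonneg_left (this.trans_eq (by ring)) (by positivity)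
      _ = 2 * (p ^ 2 + q ^ 2) * (A * Real.exp p) := by ring
      _ ≤ _ := mul_le_mul_of_nonneg_left hAM (by positivity)
  refine (abs_sub _ _).trans ((add_le_add t4 t3).trans_eq ?_)
  rw [hp, hq]; ring

lemma gaussCos_second_diff_half_ge {X b d : ℝ} (hX : 0 < X) (hb0 : 2 * Real.pi / 3 ≤ b)
    (hb1 : b ≤ Real.pi) (hd0 : 0 < d) (hd1 : d ≤ 1 / 2) :
    (0.577 * X - 2.3) * d ^ 2 * Real.exp (-X / 4) ≤
      gaussCos X b (1 / 2 + d) + gaussCos X b (1 / 2 - d) - 2 * gaussCos X b (1 / 2) := by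
  have hpi := Real.pi_gt_d4
  have hpi' := Real.pi_lt_d4
  set c := Real.cos (b / 2) with hc
  set s := Real.sin (b / 2) with hs
  set C := Real.cos (b * d) with hC
  set S := Real.sin (b * d) with hS
  have ea : Real.cos (b * (1 / 2 - d)) = c * C + s * S := by
    rw [mul_sub, mul_one_div, Real.cos_sub]
  have eb : Real.cos (b * (1 / 2 + d)) = c * C - s * S := by
    rw [mul_add, mul_one_div, Real.cos_add]
  have hc0 : 0 ≤ c := Real.cos_nonneg_of_neg_pi_div_two_le_of_le (by linarith) (by linarith)
  have hcb : c ≤ (Real.pi - b) / 2 := by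
    rw [hc, ← Real.sin_pi_div_two_sub]
    exact (Real.sin_le (by linarith)).trans_eq (by ring)
  have hc1 : c ≤ 1 / 2 := by
    rw [hc, ← Real.cos_pi_div_three]
    exact Real.cos_le_cos_of_nonneg_of_le_pi (by linarith) (by linarith) (by linarith)
  have hs1 : 0.866 ≤ s := by
    have h1 : 0 ≤ s := Real.sin_nonneg_of_nonneg_of_le_pi (by linarith) (by linarith)
    have h2 := Real.sin_sq_add_cos_sq (b / 2)
    rw [← hc, ← hs] at h2
    nlinarith
  have hC0 : 0 ≤ C :=
    Real.cos_nonneg_of_neg_pi_div_two_le_of_le (by nlinarith) (by nlinarith)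
  have hS1 : 4 / 3 * d ≤ S := by
    have h1 := Real.mul_le_sin (x := b * d) (by nlinarith) (by nlinarith)
    refine le_trans ?_ h1
    rw [div_mul_eq_mul_div 2, le_div_iff₀ Real.pi_pos]
    nlinarith
  have hsS : 1.1546 * d ≤ s * S := by
    nlinarith [mul_le_mul hs1 hS1 (by positivity) (by linarith)]
  have hcC : c - 1.15 * d ^ 2 ≤ c * C := by
    have h1 := Real.one_sub_sq_div_two_le_cos (x := b * d)
    have h2 : c * b ^ 2 ≤ 2.3 := by
      have h3 : c * b ^ 2 ≤ (Real.pi - b) / 2 * b ^ 2 :=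
        mul_le_mul_of_nonneg_right hcb (sq_nonneg b)
      have h4 : (Real.pi - b) / 2 * b ^ 2 ≤ 2 * Real.pi ^ 3 / 27 := by
        nlinarith [mul_nonneg (sq_nonneg (b - 2 * Real.pi / 3))
          (by linarith : 0 ≤ b + Real.pi / 3)]
      have h5 : Real.pi ^ 3 ≤ 3.1416 ^ 3 := by gcongr
      norm_num at h5 ⊢
      linarith
    have := mul_le_mul_of_nonneg_left h1 hc0
    nlinarith [sq_nonneg d]
  have hc2 : c * C ≤ 1 / 2 := by
    nlinarith [mul_le_of_le_one_right hc0 (Real.cos_le_one (b * d))]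
  have hcC0 : 0 ≤ c * C := mul_nonneg hc0 hC0
  have x1 : Real.exp (-X * (1 / 2 + d) ^ 2) =
      Real.exp (-X / 4) * Real.exp (-(X * d * (1 + d))) := by
    rw [← Real.exp_add]; ring_nf
  have x2 : Real.exp (-X * (1 / 2 - d) ^ 2) =
      Real.exp (-X / 4) * Real.exp (X * d * (1 - d)) := by
    rw [← Real.exp_add]; ring_nf
  have x3 : Real.exp (-X * (1 / 2) ^ 2) = Real.exp (-X / 4) := by ring_nf
  simp only [gaussCos]
  rw [x1, x2, x3, ea, eb, mul_one_div, ← hc]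
  have hP := Real.add_one_le_exp (X * d * (1 - d))
  have hQ := Real.add_one_le_exp (-(X * d * (1 + d)))
  have hQ1 : Real.exp (-(X * d * (1 + d))) ≤ 1 := Real.exp_le_one_iff.2 (by
    have : 0 ≤ X * d * (1 + d) := by positivity
    linarith)
  have hXd : 0 < X * d := by positivity
  have hXd2 : 0 < X * d ^ 2 := by positivity
  have hPa := mul_le_mul_of_nonneg_right hP (by nlinarith : 0 ≤ c * C + s * S)
  suffices h : (0.577 * X - 2.3) * d ^ 2 ≤ Real.exp (-(X * d * (1 + d))) * (c * C - s * S) +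
      Real.exp (X * d * (1 - d)) * (c * C + s * S) - 2 * c by
    have := mul_le_mul_of_nonneg_right h (Real.exp_pos (-X / 4)).le
    linarith
  generalize Real.exp (-(X * d * (1 + d))) = eQ at *
  generalize Real.exp (X * d * (1 - d)) = eP at *
  generalize c * C = u at *
  generalize s * S = w at *
  rcases le_or_gt 0 (u - w) with hb' | hb'
  · have hQb := mul_le_mul_of_nonneg_right hQ hb'
    have h1 : 0.577 * d ≤ (1 - d) * (u + w) - (1 + d) * (u - w) := by
      have := mul_le_mul_of_nonneg_left hc2 hd0.le
      linarith
    have h2 := mul_le_mul_of_nonneg_left h1 hXd.le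
    linarith
  · have hQb : u - w ≤ eQ * (u - w) := by
      have := mul_nonneg_of_nonpos_of_nonpos (sub_nonpos.2 hQ1) hb'.le
      linarith
    have h1 : 0.577 * d ≤ (1 - d) * (u + w) := by
      have := mul_nonneg (by linarith : 0 ≤ 1 / 2 - d) (by linarith : 0 ≤ u + w)
      linarith
    have h2 := mul_le_mul_of_nonneg_left h1 hXd.le
    linarith

lemma summable_gaussCos {X : ℝ} (hX : 0 < X) (b t : ℝ) :
    Summable fun k : ℤ => gaussCos X b (k + t) := by
  refine Summable.of_norm_bounded (summable_exp_neg_mul_sq hX t) fun k => ?_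
  rw [gaussCos, norm_mul, Real.norm_eq_abs, Real.norm_eq_abs, Real.abs_exp]
  exact mul_le_of_le_one_right (Real.exp_pos _).le (Real.abs_cos_le_one _)

lemma two_mul_tsum_gaussCos_sub {X : ℝ} (hX : 0 < X) (b d : ℝ) :
    (Summable fun n : ℕ => gaussCos X b (n + 1 / 2 + d) + gaussCos X b (n + 1 / 2 - d) -
      2 * gaussCos X b (n + 1 / 2)) ∧
    ∑' k : ℤ, gaussCos X b (k + (1 / 2 - d)) - ∑' k : ℤ, gaussCos X b (k + 1 / 2) =
      ∑' n : ℕ, (gaussCos X b (n + 1 / 2 + d) + gaussCos X b (n + 1 / 2 - d) -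
        2 * gaussCos X b (n + 1 / 2)) := by
  have hs := summable_gaussCos hX b
  have hn : ∀ t, Summable fun n : ℕ => gaussCos X b (n + t) := fun t => by
    have := (hs t).comp_injective (i := fun n : ℕ => (n : ℤ)) Nat.cast_injective
    simpa [Function.comp_def] using this
  have hsplit : ∀ t, ∑' k : ℤ, gaussCos X b (k + t) =
      ∑' n : ℕ, gaussCos X b (n + t) + ∑' n : ℕ, gaussCos X b (n + (1 - t)) := by
    intro t
    have hn' : ∀ n : ℕ, gaussCos X b (((-(n + 1 : ℤ) : ℤ) : ℝ) + t) =
        gaussCos X b (n + (1 - t)) := by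
      intro n
      rw [← gaussCos_neg]; congr 1; push_cast; ring
    rw [tsum_of_nat_of_neg_add_one (f := fun k : ℤ => gaussCos X b (k + t))
      (by simpa using hn t) (by simp_rw [hn']; exact hn (1 - t))]
    simp_rw [hn']
    simp
  have e1 : ∀ n : ℕ, gaussCos X b (n + 1 / 2 + d) = gaussCos X b (n + (1 - (1 / 2 - d))) :=
    fun n => by congr 1; ring
  have e2 : ∀ n : ℕ, gaussCos X b (n + 1 / 2 - d) = gaussCos X b (n + (1 / 2 - d)) :=
    fun n => by congr 1; ring
  simp_rw [e1, e2]
  refine ⟨((hn _).add (hn _)).sub ((hn _).mul_left 2), ?_⟩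
  rw [((hn _).add (hn _)).tsum_sub ((hn _).mul_left 2), (hn _).tsum_add (hn _), tsum_mul_left,
    hsplit (1 / 2 - d), hsplit (1 / 2)]
  norm_num
  ring

lemma mul_sq_le_exp {X : ℝ} (hX : 10.47 ≤ X) : 19 * X ^ 2 * Real.exp (-X) ≤
    0.85 * Real.exp (-X / 4) := by
  have h1 : Real.exp (-X / 4) = Real.exp (-X) * (Real.exp 7 * Real.exp (3 / 4 * X - 7)) := by
    rw [← Real.exp_add, ← Real.exp_add]; ring_nf
  have h2 : 1096 ≤ Real.exp 7 := by
    have : Real.exp 7 = Real.exp 1 ^ 7 := by rw [← Real.exp_nat_mul]; norm_num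
    rw [this]
    calc (1096 : ℝ) ≤ 2.7182818283 ^ 7 := by norm_num
      _ ≤ _ := by gcongr; exact Real.exp_one_gt_d9.le
  have h3 := Real.quadratic_le_exp_of_nonneg (by linarith : 0 ≤ 3 / 4 * X - 7)
  have h3' := Real.sum_le_exp_of_nonneg (by linarith : 0 ≤ 3 / 4 * X - 7) 5
  simp only [Finset.sum_range_succ, Finset.sum_range_zero, Nat.factorial] at h3'
  push_cast at h3'
  set v := 3 / 4 * X - 7 with hv
  have hX' : X = 4 / 3 * (v + 7) := by rw [hv]; ring
  have hv0 : 0.8525 ≤ v := by rw [hv]; linarith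
  have h4 : 19 * X ^ 2 ≤ 0.85 * (1096 * Real.exp v) := by
    rw [hX']
    have : 19 * (4 / 3 * (v + 7)) ^ 2 ≤ 0.85 * (1096 * (1 + v + v ^ 2 / 2 + v ^ 3 / 6)) := by
      nlinarith [mul_nonneg (by linarith : 0 ≤ v - 0.8525) (sq_nonneg v),
        mul_nonneg (by linarith : 0 ≤ v - 0.8525) (by linarith : 0 ≤ v)]
    have h5 : 1 + v + v ^ 2 / 2 + v ^ 3 / 6 ≤ Real.exp v := by
      refine le_trans ?_ h3'
      have : 0 ≤ v ^ 4 := by positivity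
      norm_num
      linarith
    nlinarith
  rw [h1]
  have h6 : 19 * X ^ 2 ≤ 0.85 * (Real.exp 7 * Real.exp v) := by
    refine h4.trans ?_
    gcongr
  nlinarith [Real.exp_pos (-X)]

lemma tsum_gaussCos_sub_ge {X b d : ℝ} (hX : 10.47 ≤ X) (hb0 : 2 * Real.pi / 3 ≤ b)
    (hb1 : b ≤ Real.pi) (hd0 : 0 < d) (hd1 : d ≤ 1 / 2) :
    2 * d ^ 2 * Real.exp (-X / 4) ≤
      ∑' k : ℤ, gaussCos X b (k + (1 / 2 - d)) - ∑' k : ℤ, gaussCos X b (k + 1 / 2) := by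
  have hX0 : 0 < X := by linarith
  obtain ⟨hs, he⟩ := two_mul_tsum_gaussCos_sub hX0 b d
  set Δ : ℕ → ℝ := fun n => gaussCos X b (n + 1 / 2 + d) + gaussCos X b (n + 1 / 2 - d) -
    2 * gaussCos X b (n + 1 / 2) with hΔ
  rw [he, hs.tsum_eq_zero_add]
  have hmain := gaussCos_second_diff_half_ge hX0 hb0 hb1 hd0 hd1
  have hb : 0 ≤ b := by have := Real.pi_pos; linarith
  have hgeo := hasSum_geometric_of_lt_one (r := 1 / 100) (by norm_num) (by norm_num)
  have hq : 4 * Real.exp (-X) ≤ 1 / 100 := by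
    have h1 : Real.exp (-X) * Real.exp X = 1 := by rw [← Real.exp_add]; simp
    have h2 : Real.exp 7 ≤ Real.exp X := Real.exp_le_exp.2 (by linarith)
    have h3 : 1096 ≤ Real.exp 7 := by
      have : Real.exp 7 = Real.exp 1 ^ 7 := by rw [← Real.exp_nat_mul]; norm_num
      rw [this]
      calc (1096 : ℝ) ≤ 2.7182818283 ^ 7 := by norm_num
        _ ≤ _ := by gcongr; exact Real.exp_one_gt_d9.le
    nlinarith [Real.exp_pos (-X)]
  have htail : ∀ n : ℕ, -(19 * X ^ 2 * Real.exp (-X) * d ^ 2 * (1 / 100) ^ n) ≤ Δ (n + 1) := by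
    intro n
    rw [hΔ]
    have hn : (0 : ℝ) ≤ n := Nat.cast_nonneg n
    have h1 := (abs_le.1 (abs_gaussCos_second_diff_le (κ := ((n + 1 : ℕ) : ℝ) + 1 / 2) hX0 hb
      hd0.le hd1 (by push_cast; linarith))).1
    refine le_trans (neg_le_neg ?_) h1
    push_cast
    have h2 : ((n : ℝ) + 1) ≤ 2 ^ n := by
      exact_mod_cast Nat.lt_two_pow_self (n := n)
    have h3 : b ^ 2 ≤ 0.0911 * X ^ 2 := by
      have h4 : b ^ 2 ≤ 3.1416 ^ 2 :=
        pow_le_pow_left₀ hb (hb1.trans Real.pi_lt_d4.le) 2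
      nlinarith
    have h4 : 4 * X ^ 2 * ((n : ℝ) + 1 + 1 / 2) ^ 2 + b ^ 2 + X ≤
        19 / 2 * X ^ 2 * ((n : ℝ) + 1) ^ 2 := by
      have : X ≤ 0.1 * X ^ 2 := by nlinarith
      have h5 : 4 * ((n : ℝ) + 1 + 1 / 2) ^ 2 ≤ 9 * ((n : ℝ) + 1) ^ 2 := by nlinarith
      have h6 : 1 ≤ ((n : ℝ) + 1) ^ 2 := by nlinarith
      nlinarith [mul_le_mul_of_nonneg_left h5 (sq_nonneg X),
        mul_le_mul_of_nonneg_left h6 (sq_nonneg X)]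
    have h5 : Real.exp (-X * ((n : ℝ) + 1 + 1 / 2 - 1 / 2) ^ 2) ≤
        Real.exp (-X) * Real.exp (-X) ^ n := by
      rw [← Real.exp_nat_mul, ← Real.exp_add]
      refine Real.exp_le_exp.2 ?_
      nlinarith [mul_nonneg hX0.le (mul_nonneg hn hn), mul_nonneg hX0.le hn]
    have h6 : ((n : ℝ) + 1) ^ 2 ≤ 4 ^ n := by
      calc ((n : ℝ) + 1) ^ 2 ≤ (2 ^ n) ^ 2 := by gcongr
        _ = 4 ^ n := by rw [← pow_mul, mul_comm, pow_mul]; norm_num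
    have h7 : (4 * Real.exp (-X)) ^ n ≤ (1 / 100) ^ n :=
      pow_le_pow_left₀ (by positivity) hq n
    calc 2 * d ^ 2 * (4 * X ^ 2 * ((n : ℝ) + 1 + 1 / 2) ^ 2 + b ^ 2 + X) *
          Real.exp (-X * ((n : ℝ) + 1 + 1 / 2 - 1 / 2) ^ 2)
        ≤ 2 * d ^ 2 * (19 / 2 * X ^ 2 * 4 ^ n) * (Real.exp (-X) * Real.exp (-X) ^ n) := by
          gcongr
          refine h4.trans ?_
          gcongr
      _ = 19 * X ^ 2 * Real.exp (-X) * d ^ 2 * (4 * Real.exp (-X)) ^ n := by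
          rw [mul_pow]; ring
      _ ≤ _ := by gcongr
  have hsum : -(19 * X ^ 2 * Real.exp (-X) * d ^ 2 * (1 - 1 / 100)⁻¹) ≤
      ∑' n : ℕ, Δ (n + 1) := by
    have hs1 : Summable fun n : ℕ => Δ (n + 1) := (summable_nat_add_iff 1).2 hs
    rw [← hgeo.tsum_eq, ← tsum_mul_left, ← tsum_neg]
    exact Summable.tsum_le_tsum htail (hgeo.summable.mul_left _).neg hs1
  have hX2 := mul_sq_le_exp hX
  have hE := Real.exp_pos (-X / 4)
  have hd2 : 0 < d ^ 2 := by positivity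
  have h8 : 3.7 * (d ^ 2 * Real.exp (-X / 4)) ≤
      (0.577 * X - 2.3) * (d ^ 2 * Real.exp (-X / 4)) :=
    mul_le_mul_of_nonneg_right (by linarith) (by positivity)
  have h9 := mul_le_mul_of_nonneg_right hX2 hd2.le
  have hΔ0 : Δ 0 = gaussCos X b (1 / 2 + d) + gaussCos X b (1 / 2 - d) -
      2 * gaussCos X b (1 / 2) := by simp [hΔ]
  rw [← hΔ0] at hmain
  have h10 : (1 - 1 / 100 : ℝ)⁻¹ = 100 / 99 := by norm_num
  rw [h10] at hsum
  have h11 : 0 < d ^ 2 * Real.exp (-X / 4) := by positivity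
  linarith

lemma tsum_exp_neg_mul_sq_le {p : ℝ} (hp : 0 < p) :
    ∑' k : ℤ, Real.exp (-p * (k : ℝ) ^ 2) ≤ 1 + 2 * Real.exp (-p) / (1 - Real.exp (-p)) := by
  have hq1 : Real.exp (-p) < 1 := Real.exp_lt_one_iff.2 (by linarith)
  have hs := summable_exp_neg_mul_sq_zero hp
  have hk : ∀ n : ℕ, Real.exp (-p * ((n : ℝ) + 2) ^ 2) ≤ Real.exp (-p) ^ 2 * Real.exp (-p) ^ n := by
    intro n
    rw [← Real.exp_nat_mul, ← Real.exp_nat_mul, ← Real.exp_add]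
    refine Real.exp_le_exp.2 ?_
    have hn : (0 : ℝ) ≤ n := Nat.cast_nonneg n
    push_cast
    nlinarith [mul_nonneg hp.le hn, mul_nonneg hp.le (mul_nonneg hn hn)]
  have h := tsum_int_ge hs.neg (c := Real.exp (-p) ^ 2) (c' := Real.exp (-p) ^ 2)
    (Real.exp_pos _).le hq1 (fun n => by push_cast; exact neg_le_neg (hk n))
    (fun n => by push_cast; rw [neg_sq]; exact neg_le_neg (hk n))
  rw [tsum_neg] at h
  norm_num at h
  have h2 : (1 : ℝ) - Real.exp (-p) ≠ 0 := by linarith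
  have h3 : 2 * Real.exp (-p) / (1 - Real.exp (-p)) = 2 * Real.exp (-p) +
      (Real.exp (-p) ^ 2 + Real.exp (-p) ^ 2) / (1 - Real.exp (-p)) := by
    field_simp; ring
  simp only [neg_mul] at h3 ⊢
  rw [h3]
  linarith

/-- By Poisson summation, Gaussian sums are largest at the unshifted lattice. -/
lemma tsum_shifted_le {r : ℝ} (hr : 0 < r) (a : ℝ) :
    ∑' n : ℤ, Real.exp (-(Real.pi * r) * ((n : ℝ) + a) ^ 2) ≤
      (√r)⁻¹ * ∑' k : ℤ, Real.exp (-(Real.pi / r) * (k : ℝ) ^ 2) := by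
  have h := tsum_gaussian_mul_cos hr a 0
  simp only [mul_zero, Real.cos_zero, mul_one, add_zero] at h
  rw [h]
  have hs := summable_exp_neg_mul_sq_zero (c := Real.pi / r) (by positivity)
  refine mul_le_mul_of_nonneg_left ?_ (by positivity)
  refine Summable.tsum_le_tsum (fun k => ?_) ?_ hs
  · exact mul_le_of_le_one_right (Real.exp_pos _).le (Real.cos_le_one _)
  · refine Summable.of_norm_bounded hs fun k => ?_
    rw [norm_mul, Real.norm_eq_abs, Real.norm_eq_abs, Real.abs_exp]
    exact mul_le_of_le_one_right (Real.exp_pos _).le (Real.abs_cos_le_one _)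

lemma sqrt_mul_tsum_one_sub_cos_le {r β d : ℝ} (hr : 0 < r) (hr1 : r ≤ 3 / 10) (hβ0 : 0 ≤ β)
    (hβ1 : β ≤ 1 / 2) :
    (Summable fun l : ℤ => Real.exp (-(Real.pi * r) * ((l : ℝ) + β) ^ 2) *
      (1 - Real.cos (l * (2 * Real.pi * d)))) ∧
    √r * ∑' l : ℤ, Real.exp (-(Real.pi * r) * ((l : ℝ) + β) ^ 2) *
      (1 - Real.cos (l * (2 * Real.pi * d))) ≤ 30 * (Real.pi / r) * d ^ 2 := by
  have hpi := Real.pi_pos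
  have hpi3 := Real.pi_gt_d4
  have hpi4 := Real.pi_lt_d4
  have hs := summable_exp_neg_mul_sq (c := Real.pi * (r / 2)) (by positivity) β
  set K : ℝ := 2 * Real.pi ^ 2 * d ^ 2 * (4 / (Real.pi * r) + 1 / 2) with hK
  have hK0 : 0 ≤ K := by positivity
  have hle : ∀ l : ℤ, Real.exp (-(Real.pi * r) * ((l : ℝ) + β) ^ 2) *
      (1 - Real.cos (l * (2 * Real.pi * d))) ≤
      K * Real.exp (-(Real.pi * (r / 2)) * ((l : ℝ) + β) ^ 2) := by
    intro l
    have h1 := Real.one_sub_sq_div_two_le_cos (x := l * (2 * Real.pi * d))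
    set u := ((l : ℝ) + β) ^ 2 with hu
    have hu0 : 0 ≤ u := sq_nonneg _
    have h2 : (l : ℝ) ^ 2 ≤ 2 * u + 1 / 2 := by rw [hu]; nlinarith [sq_nonneg ((l : ℝ) + 2 * β)]
    have h3 : 1 - Real.cos (l * (2 * Real.pi * d)) ≤
        2 * Real.pi ^ 2 * d ^ 2 * (2 * u + 1 / 2) := by
      have := mul_le_mul_of_nonneg_left h2 (by positivity : 0 ≤ 2 * Real.pi ^ 2 * d ^ 2)
      linarith
    have h4 : Real.exp (-(Real.pi * r) * u) =
        Real.exp (-(Real.pi * (r / 2) * u)) * Real.exp (-(Real.pi * (r / 2)) * u) := by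
      rw [← Real.exp_add]; ring_nf
    have h5 : Real.exp (-(Real.pi * (r / 2) * u)) * (2 * u + 1 / 2) ≤
        4 / (Real.pi * r) + 1 / 2 := by
      rw [Real.exp_neg, inv_mul_le_iff₀ (Real.exp_pos _)]
      have h6 := Real.add_one_le_exp (Real.pi * (r / 2) * u)
      have h7 : (Real.pi * (r / 2) * u + 1) * (4 / (Real.pi * r) + 1 / 2) =
        2 * u + 1 / 2 + (Real.pi * (r / 2) * u / 2 + 4 / (Real.pi * r)) := by
        field_simp; ring
      have h8 : 0 ≤ Real.pi * (r / 2) * u / 2 + 4 / (Real.pi * r) := by positivity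
      have h9 : 0 ≤ 4 / (Real.pi * r) + 1 / 2 := by positivity
      nlinarith [mul_le_mul_of_nonneg_right h6 h9]
    rw [h4]
    calc _ ≤ Real.exp (-(Real.pi * (r / 2) * u)) * Real.exp (-(Real.pi * (r / 2)) * u) *
          (2 * Real.pi ^ 2 * d ^ 2 * (2 * u + 1 / 2)) := by gcongr
      _ = 2 * Real.pi ^ 2 * d ^ 2 * (Real.exp (-(Real.pi * (r / 2) * u)) * (2 * u + 1 / 2)) *
          Real.exp (-(Real.pi * (r / 2)) * u) := by ring
      _ ≤ _ := by rw [hK]; gcongr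
  have hsum : Summable fun l : ℤ => Real.exp (-(Real.pi * r) * ((l : ℝ) + β) ^ 2) *
      (1 - Real.cos (l * (2 * Real.pi * d))) :=
    Summable.of_nonneg_of_le (fun l => mul_nonneg (Real.exp_pos _).le (one_sub_cos_nonneg _)) hle
      (hs.mul_left K)
  refine ⟨hsum, ?_⟩
  have h1 := hsum.tsum_le_tsum hle (hs.mul_left K)
  rw [tsum_mul_left] at h1
  have h2 := tsum_shifted_le (r := r / 2) (by positivity) β
  have hp : 0 < Real.pi / (r / 2) := by positivity
  have h3 := tsum_exp_neg_mul_sq_le hp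
  have h4 : Real.exp (-(Real.pi / (r / 2))) ≤ 1 / 21 := by
    rw [Real.exp_neg, one_div]
    refine inv_anti₀ (by norm_num) ?_
    have h5 := Real.add_one_le_exp (Real.pi / (r / 2))
    have h6 : 20 ≤ Real.pi / (r / 2) := by
      rw [le_div_iff₀ (by positivity)]; nlinarith
    linarith
  have h5 : ∑' k : ℤ, Real.exp (-(Real.pi / (r / 2)) * (k : ℝ) ^ 2) ≤ 1.1 := by
    refine h3.trans ?_
    have : 2 * Real.exp (-(Real.pi / (r / 2))) / (1 - Real.exp (-(Real.pi / (r / 2)))) ≤ 0.1 := by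
      rw [div_le_iff₀ (by linarith)]; linarith
    linarith
  have h6 : √r * (√(r / 2))⁻¹ ≤ 1.4143 := by
    rw [← Real.sqrt_inv, ← Real.sqrt_mul hr.le, Real.sqrt_le_left (by norm_num)]
    have : r * (r / 2)⁻¹ = 2 := by field_simp
    rw [this]; norm_num
  have h7 : K ≤ 19 * (Real.pi / r) * d ^ 2 := by
    have e : K = d ^ 2 * (8 * (Real.pi / r) + Real.pi ^ 2) := by
      rw [hK]; field_simp; ring
    have h8 : Real.pi ≤ 0.955 / r := by rw [le_div_iff₀ hr]; nlinarith
    have h9 : Real.pi ^ 2 ≤ 11 * (Real.pi / r) := by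
      have : 1 ≤ 1 / r := by rw [le_div_iff₀ hr]; linarith
      have e2 : Real.pi / r = Real.pi * (1 / r) := by ring
      rw [e2]; nlinarith
    rw [e]; nlinarith [sq_nonneg d]
  calc √r * ∑' l : ℤ, Real.exp (-(Real.pi * r) * ((l : ℝ) + β) ^ 2) *
      (1 - Real.cos (l * (2 * Real.pi * d)))
      ≤ √r * (K * ((√(r / 2))⁻¹ * 1.1)) := by
        refine mul_le_mul_of_nonneg_left (h1.trans ?_) (Real.sqrt_nonneg _)
        refine mul_le_mul_of_nonneg_left (h2.trans ?_) hK0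
        exact mul_le_mul_of_nonneg_left h5 (by positivity)
    _ = K * (√r * (√(r / 2))⁻¹) * 1.1 := by ring
    _ ≤ (19 * (Real.pi / r) * d ^ 2) * 1.4143 * 1.1 := by gcongr
    _ ≤ _ := by
      have : 0 ≤ (Real.pi / r) * d ^ 2 := by positivity
      nlinarith

lemma sq_mul_pow_le' {q : ℝ} (hq0 : 0 ≤ q) (hq1 : q ≤ 1) (n : ℕ) :
    ((n : ℝ) + 2) ^ 2 * q ^ ((n + 1) * (n + 3)) ≤ 4 * q ^ 3 * (9 / 4 * q ^ 4) ^ n := by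
  have h := sq_mul_pow_le hq0 hq1 n
  have e : (n + 1) * (n + 3) = (n + 1) * (n + 2) + 1 + n := by ring
  rw [e, pow_add, pow_add, pow_one]
  have h1 : q ^ n ≤ 1 := pow_le_one₀ hq0 hq1
  calc _ = (((n : ℝ) + 2) ^ 2 * q ^ ((n + 1) * (n + 2))) * q * q ^ n := by ring
    _ ≤ (4 * q ^ 2 * (9 / 4 * q ^ 4) ^ n) * q * 1 := by gcongr
    _ = _ := by ring

set_option maxHeartbeats 800000 in
lemma mixedTheta_lt_of_small {r τ d β : ℝ} (hr0 : 0 < r) (hr : r < 3 / 10) (hrτ : 3 / 4 ≤ r * τ)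
    (hd0 : 0 < d) (hd1 : d ≤ 1 / 2) (hβ0 : 1 / 3 ≤ β) (hβ1 : β ≤ 1 / 2) :
    mixedTheta (1 / 2 - d) r τ β < mixedTheta (1 / 2) r τ β := by
  have hpi := Real.pi_pos
  have hpi3 := Real.pi_gt_d4
  have hτ : 0 < τ := by
    by_contra h
    nlinarith
  obtain ⟨hsub, hsum⟩ := mixedTheta_half_sub hr0 hτ d β
  have hsum' := (Equiv.prodComm ℤ ℤ).summable_iff.2 hsum
  simp only [Function.comp_def] at hsum'
  rw [← sub_pos, hsub, ← (Equiv.prodComm ℤ ℤ).tsum_eq, Summable.tsum_prod hsum']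
  simp only [Equiv.prodComm_apply, Prod.swap] at hsum' ⊢
  set v : ℤ → ℝ := fun m => Real.exp (-(Real.pi * τ) * (m : ℝ) ^ 2) with hv
  set w : ℤ → ℝ := fun l => Real.exp (-(Real.pi * r) * ((l : ℝ) + β) ^ 2) with hw
  have hv0 : ∀ m, 0 < v m := fun m => Real.exp_pos _
  have hw0 : ∀ l, 0 < w l := fun l => Real.exp_pos _
  have hws : Summable w := summable_exp_neg_mul_sq (c := Real.pi * r) (by positivity) β
  set D : ℤ → ℝ := fun m => ∑' l : ℤ, w l * (Real.cos (m * (l + 1) * Real.pi) *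
          (1 - Real.cos (2 * Real.pi * l * m * d))) with hD
  have hrow : ∀ m : ℤ, ∑' l : ℤ, Real.exp (-(Real.pi * r) * ((l : ℝ) + β) ^ 2) *
      (Real.exp (-(Real.pi * τ) * (m : ℝ) ^ 2) * (Real.cos (m * (l + 1) * Real.pi) *
      (1 - Real.cos (2 * Real.pi * l * m * d)))) = v m * D m := by
    intro m
    rw [hD, ← tsum_mul_left]
    exact tsum_congr fun l => mul_left_comm _ _ _
  have hfs : Summable fun m : ℤ => v m * D m := by
    have := hsum'.prod
    simp only [hrow] at this
    exact this
  simp only [hrow]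
  obtain ⟨hEs, hEle⟩ := sqrt_mul_tsum_one_sub_cos_le (d := d) hr0 hr.le (by linarith) hβ1
  set E : ℝ := ∑' l : ℤ, w l * (1 - Real.cos (l * (2 * Real.pi * d))) with hE
  have hE0 : 0 ≤ E := tsum_nonneg fun l => mul_nonneg (hw0 l).le (one_sub_cos_nonneg _)
  have hDb : ∀ m : ℤ, |D m| ≤ (m : ℝ) ^ 2 * E := by
    intro m
    rw [hE, ← tsum_mul_left, ← Real.norm_eq_abs]
    refine tsum_of_norm_bounded ((hEs.mul_left _).hasSum) fun l => ?_
    rw [Real.norm_eq_abs, abs_mul, abs_mul, abs_of_pos (hw0 l),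
      abs_of_nonneg (one_sub_cos_nonneg _)]
    have h1 := one_sub_cos_int_mul_le m (l * (2 * Real.pi * d))
    rw [show (m : ℝ) * (l * (2 * Real.pi * d)) = 2 * Real.pi * l * m * d by ring] at h1
    calc _ ≤ w l * (1 * ((m : ℝ) ^ 2 * (1 - Real.cos (l * (2 * Real.pi * d))))) := by
          refine mul_le_mul_of_nonneg_left ?_ (hw0 l).le
          exact mul_le_mul (Real.abs_cos_le_one _) h1 (one_sub_cos_nonneg _) zero_le_one
      _ = _ := by ring
  have hD0 : D 0 = 0 := by simp [hD]
  have hDn : D (-1) = D 1 := by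
    refine tsum_congr fun l => ?_
    push_cast
    rw [show (-1 : ℝ) * (l + 1) * Real.pi = -(1 * (l + 1) * Real.pi) by ring, Real.cos_neg,
      show 2 * Real.pi * l * (-1) * d = -(2 * Real.pi * l * 1 * d) by ring, Real.cos_neg]
  set X : ℝ := Real.pi / r with hX
  have hX1 : 10.47 ≤ X := by rw [hX, le_div_iff₀ hr0]; nlinarith
  have hD1 : √r * D 1 = ∑' k : ℤ, gaussCos X (2 * Real.pi * β) (k + (1 / 2 - d)) -
      ∑' k : ℤ, gaussCos X (2 * Real.pi * β) (k + 1 / 2) := by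
    have g : ∀ t, ∑' l : ℤ, w l * Real.cos (2 * Real.pi * l * t) =
        (√r)⁻¹ * ∑' k : ℤ, gaussCos X (2 * Real.pi * β) (k + t) := fun t =>
      tsum_gaussian_mul_cos hr0 β t
    have sg : ∀ t, Summable fun l : ℤ => w l * Real.cos (2 * Real.pi * l * t) := fun t => by
      refine Summable.of_norm_bounded hws fun l => ?_
      rw [norm_mul, Real.norm_eq_abs, Real.norm_eq_abs, abs_of_pos (hw0 l)]
      exact mul_le_of_le_one_right (hw0 l).le (Real.abs_cos_le_one _)
    have : D 1 = ∑' l : ℤ, w l * Real.cos (2 * Real.pi * l * (1 / 2 - d)) -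
        ∑' l : ℤ, w l * Real.cos (2 * Real.pi * l * (1 / 2)) := by
      rw [← (sg _).tsum_sub (sg _)]
      refine tsum_congr fun l => ?_
      push_cast
      rw [show 2 * Real.pi * l * (1 / 2 - d) = l * Real.pi - 2 * Real.pi * l * 1 * d by ring,
        show 2 * Real.pi * l * (1 / 2) = l * Real.pi by ring,
        show 1 * ((l : ℝ) + 1) * Real.pi = l * Real.pi + Real.pi by ring, Real.cos_add_pi,
        Real.cos_sub, Real.sin_int_mul_pi]
      ring
    have hr' : √r ≠ 0 := by positivity
    rw [this, g, g, ← mul_sub, mul_inv_cancel_left₀ hr']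
  have hD1' : 2 * d ^ 2 * Real.exp (-X / 4) ≤ √r * D 1 := by
    rw [hD1]
    exact tsum_gaussCos_sub_ge hX1 (by nlinarith) (by nlinarith) hd0 hd1
  set q : ℝ := Real.exp (-(Real.pi * τ)) with hq
  have hq0 : 0 < q := Real.exp_pos _
  have hτX : 3 / 4 * X ≤ Real.pi * τ := by
    rw [hX, ← mul_div_assoc, div_le_iff₀ hr0]; nlinarith
  have hq1 : q ≤ 1 / 2 := by
    have h1 : q * Real.exp (Real.pi * τ) = 1 := by rw [hq, ← Real.exp_add]; simp
    have h2 := Real.add_one_le_exp (Real.pi * τ)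
    nlinarith
  have hvn : ∀ n : ℕ, v (n + 2) = v 1 * q ^ ((n + 1) * (n + 3)) := by
    intro n
    simp only [hv, hq]
    rw [← Real.exp_nat_mul, ← Real.exp_add]
    congr 1
    push_cast
    ring
  have hvm : ∀ m : ℤ, v (-m) = v m := fun m => by simp [hv]
  have hκ1 : 9 / 4 * q ^ 4 ≤ 1 / 2 := by
    calc 9 / 4 * q ^ 4 ≤ 9 / 4 * (1 / 2) ^ 4 := by gcongr
      _ ≤ 1 / 2 := by norm_num
  have htail : ∀ n : ℕ, v (n + 2) * (((n : ℝ) + 2) ^ 2 * E) ≤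
      v 1 * E * (4 * q ^ 3) * (9 / 4 * q ^ 4) ^ n := by
    intro n
    have h2 := sq_mul_pow_le' hq0.le (by linarith) n
    rw [hvn]
    calc _ = v 1 * E * (((n : ℝ) + 2) ^ 2 * q ^ ((n + 1) * (n + 3))) := by ring
      _ ≤ v 1 * E * (4 * q ^ 3 * (9 / 4 * q ^ 4) ^ n) :=
          mul_le_mul_of_nonneg_left h2 (mul_nonneg (hv0 1).le hE0)
      _ = _ := by ring
  have hmain := tsum_int_ge hfs (c := v 1 * E * (4 * q ^ 3))
    (c' := v 1 * E * (4 * q ^ 3)) (κ := 9 / 4 * q ^ 4) (by positivity) (by linarith)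
    (fun n => by
      have h1 := (abs_le.1 (hDb (n + 2))).1
      push_cast at h1
      have h4 := mul_le_mul_of_nonneg_left h1 (hv0 (n + 2)).le
      linarith [htail n])
    (fun n => by
      have h1 := (abs_le.1 (hDb (-(n + 2)))).1
      push_cast at h1
      rw [neg_sq] at h1
      have h4 := mul_le_mul_of_nonneg_left h1 (hv0 (n + 2)).le
      rw [hvm]
      linarith [htail n])
  refine lt_of_lt_of_le ?_ hmain
  rw [hD0, hDn, mul_zero, add_zero, hvm 1]
  have hnum : q ^ 3 * (240 * X) < Real.exp (-X / 4) := by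
    have h1 : q ^ 3 ≤ Real.exp (-(9 / 4 * X)) := by
      rw [hq, ← Real.exp_nat_mul]
      refine Real.exp_le_exp.2 ?_
      push_cast
      linarith
    have h2 : Real.exp (-X / 4) = Real.exp (-(9 / 4 * X)) * (Real.exp X * Real.exp X) := by
      rw [← Real.exp_add, ← Real.exp_add]; ring_nf
    have h3 := Real.add_one_le_exp X
    have h4 : 240 * X < Real.exp X * Real.exp X := by
      have h5 := Real.sum_le_exp_of_nonneg (by linarith : 0 ≤ X) 4
      simp only [Finset.sum_range_succ, Finset.sum_range_zero, Nat.factorial] at h5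
      push_cast at h5
      norm_num at h5
      nlinarith [sq_nonneg X, mul_nonneg (by linarith : 0 ≤ X - 10) (sq_nonneg X)]
    rw [h2]
    calc q ^ 3 * (240 * X) ≤ Real.exp (-(9 / 4 * X)) * (240 * X) := by gcongr
      _ < _ := mul_lt_mul_of_pos_left h4 (Real.exp_pos _)
  have hD1E : 8 * q ^ 3 * E < D 1 := by
    have hr' : 0 < √r := by positivity
    refine lt_of_mul_lt_mul_left (a := √r) ?_ hr'.le
    refine lt_of_lt_of_le ?_ hD1'
    have hd2 : 0 < d ^ 2 := by positivity
    calc √r * (8 * q ^ 3 * E) = 8 * q ^ 3 * (√r * E) := by ring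
      _ ≤ 8 * q ^ 3 * (30 * X * d ^ 2) := by gcongr
      _ = d ^ 2 * (q ^ 3 * (240 * X)) := by ring
      _ < d ^ 2 * Real.exp (-X / 4) := mul_lt_mul_of_pos_left hnum hd2
      _ ≤ _ := by linarith [mul_pos hd2 (Real.exp_pos (-X / 4))]
  have hC : (v 1 * E * (4 * q ^ 3) + v 1 * E * (4 * q ^ 3)) / (1 - 9 / 4 * q ^ 4) ≤
      v 1 * (2 * (8 * q ^ 3 * E)) := by
    rw [div_le_iff₀ (by linarith)]
    have : 0 ≤ v 1 * E * q ^ 3 := mul_nonneg (mul_nonneg (hv0 1).le hE0) (by positivity)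
    linarith [mul_le_mul_of_nonneg_left hκ1 this]
  have hF := mul_lt_mul_of_pos_left hD1E (hv0 1)
  linarith

lemma shiftHeight_bounds {y : ℝ} (hy0 : 0 < y) (hy : 3 / 4 ≤ y ^ 2) :
    1 / 3 ≤ shiftHeight y ∧ shiftHeight y < 1 / 2 := by
  have h1 : 1 / (8 * y ^ 2) ≤ 1 / 6 := one_div_le_one_div_of_le (by norm_num) (by linarith)
  have h2 : 0 < 1 / (8 * y ^ 2) := by positivity
  rw [shiftHeight]
  constructor <;> linarith

/-- For fixed height the shifted theta function is strictly maximal on the line `x = 1/2`. -/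
lemma latticeTheta_lt_half {x y α : ℝ} (hy0 : 0 < y) (hy : 3 / 4 ≤ y ^ 2) (hx0 : 0 ≤ x)
    (hx1 : x < 1 / 2) (hα : 0 < α) :
    latticeTheta x y (bPoint x y) α < latticeTheta (1 / 2) y (bPoint (1 / 2) y) α := by
  rw [latticeTheta_eq_mixedTheta hy0 hα, latticeTheta_eq_mixedTheta hy0 hα]
  refine mul_lt_mul_of_pos_left ?_ (by positivity)
  obtain ⟨h1, h2⟩ := shiftHeight_bounds hy0 hy
  have hx : x = 1 / 2 - (1 / 2 - x) := by ring
  rw [hx]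
  rcases le_or_gt (3 / 10) (y * α) with hr | hr
  · exact mixedTheta_lt_of_large hr (by positivity) (by linarith) (by linarith) (by linarith)
      h2.le
  · refine mixedTheta_lt_of_small (by positivity) hr ?_ (by linarith) (by linarith) h1 h2.le
    have : y * α * (y / α) = y ^ 2 := by field_simp
    linarith

lemma tsum_le_sum_add_of_le_off {ι : Type*} {f g : ι → ℝ} {G : ℝ} (hf : Summable f)
    (hg : HasSum g G) (S : Finset ι) (h : ∀ i ∉ S, f i ≤ g i) :
    ∑' i, f i ≤ ∑ i ∈ S, f i + (G - ∑ i ∈ S, g i) := by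
  have h1 := hf.sum_add_tsum_compl (s := S)
  have h2 := hg.summable.sum_add_tsum_compl (s := S)
  rw [hg.tsum_eq] at h2
  have h3 : ∑' x : ↥(↑S : Set ι)ᶜ, f x ≤ ∑' x : ↥(↑S : Set ι)ᶜ, g x :=
    (hf.subtype _).tsum_le_tsum (fun x => h x fun hx => x.2 (by exact_mod_cast hx))
      (hg.summable.subtype _)
  linarith

lemma hasSum_pow_natAbs {ρ : ℝ} (h0 : 0 ≤ ρ) (h1 : ρ < 1) :
    HasSum (fun n : ℤ => ρ ^ n.natAbs) ((1 + ρ) / (1 - ρ)) := by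
  have hg := hasSum_geometric_of_lt_one h0 h1
  have e : (1 + ρ) / (1 - ρ) = (1 - ρ)⁻¹ + ρ * (1 - ρ)⁻¹ := by
    rw [div_eq_mul_inv]; ring
  rw [e]
  refine HasSum.of_nat_of_neg_add_one (by simpa using hg) ?_
  have : ∀ n : ℕ, (-((n : ℤ) + 1)).natAbs = n + 1 := fun n => by omega
  simp only [this, pow_succ']
  exact hg.mul_left ρ

lemma hasSum_pow_natAbs_add {ρ : ℝ} (h0 : 0 ≤ ρ) (h1 : ρ < 1) :
    HasSum (fun q : ℤ × ℤ => ρ ^ (q.1.natAbs + q.2.natAbs)) (((1 + ρ) / (1 - ρ)) ^ 2) := by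
  have h := hasSum_pow_natAbs h0 h1
  have hs := h.summable.mul_of_nonneg h.summable (fun n => pow_nonneg h0 _)
    (fun n => pow_nonneg h0 _)
  have hmul := h.mul h hs
  simp only [pow_add, sq]
  exact hmul

/-- Termwise differentiation of Gaussian trigonometric sums over `ℤ × ℤ`. -/
lemma hasDerivAt_tsum_exp_mul_cos {E E' ψ ψ' : ℤ × ℤ → ℝ → ℝ} {c δ C C' A M : ℝ} (hc : 0 < c)
    (hδ : 0 < δ) (hE : ∀ q, ∀ y ∈ Set.Ioo A M, HasDerivAt (E q) (E' q y) y)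
    (hψ : ∀ q, ∀ y ∈ Set.Ioo A M, HasDerivAt (ψ q) (ψ' q y) y)
    (hE' : ∀ q : ℤ × ℤ, ∀ y ∈ Set.Ioo A M, |E' q y| ≤ C * (1 + (q.1 : ℝ) ^ 2 + (q.2 : ℝ) ^ 2))
    (hψ' : ∀ q : ℤ × ℤ, ∀ y ∈ Set.Ioo A M, |ψ' q y| ≤ C * (1 + (q.1 : ℝ) ^ 2 + (q.2 : ℝ) ^ 2))
    (hlow : ∀ q : ℤ × ℤ, ∀ y ∈ Set.Ioo A M,
      δ * ((q.1 : ℝ) ^ 2 + (q.2 : ℝ) ^ 2) - C' ≤ E q y) :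
    ∀ y ∈ Set.Ioo A M, (Summable fun q => Real.exp (-c * E q y) *
        (-c * E' q y * Real.cos (ψ q y) - ψ' q y * Real.sin (ψ q y))) ∧
      HasDerivAt (fun y => ∑' q, Real.exp (-c * E q y) * Real.cos (ψ q y))
        (∑' q, Real.exp (-c * E q y) *
          (-c * E' q y * Real.cos (ψ q y) - ψ' q y * Real.sin (ψ q y))) y := by
  intro y hy
  have hs0 := summable_quadratic_mul_exp (mul_pos hc hδ)
  have hexp : ∀ q : ℤ × ℤ, ∀ y ∈ Set.Ioo A M, Real.exp (-c * E q y) ≤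
      Real.exp (c * C') * Real.exp (-(c * δ) * ((q.1 : ℝ) ^ 2 + (q.2 : ℝ) ^ 2)) := by
    intro q y hy
    rw [← Real.exp_add]
    refine Real.exp_le_exp.2 ?_
    linarith [mul_le_mul_of_nonneg_left (hlow q y hy) hc.le]
  have hbound : ∀ q : ℤ × ℤ, ∀ y ∈ Set.Ioo A M, ‖Real.exp (-c * E q y) *
        (-c * E' q y * Real.cos (ψ q y) - ψ' q y * Real.sin (ψ q y))‖ ≤
      Real.exp (c * C') * (c * C + C) * ((1 + (q.1 : ℝ) ^ 2 + (q.2 : ℝ) ^ 2) *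
        Real.exp (-(c * δ) * ((q.1 : ℝ) ^ 2 + (q.2 : ℝ) ^ 2))) := by
    intro q y hy
    rw [norm_mul, Real.norm_eq_abs, Real.norm_eq_abs, Real.abs_exp]
    have h1 : |-c * E' q y * Real.cos (ψ q y) - ψ' q y * Real.sin (ψ q y)| ≤
        (c * C + C) * (1 + (q.1 : ℝ) ^ 2 + (q.2 : ℝ) ^ 2) := by
      refine (abs_sub _ _).trans ?_
      rw [abs_mul, abs_mul, abs_mul, abs_neg, abs_of_pos hc]
      have h2 : c * |E' q y| * |Real.cos (ψ q y)| ≤ c * |E' q y| * 1 :=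
        mul_le_mul_of_nonneg_left (Real.abs_cos_le_one _) (by positivity)
      have h3 : |ψ' q y| * |Real.sin (ψ q y)| ≤ |ψ' q y| * 1 :=
        mul_le_mul_of_nonneg_left (Real.abs_sin_le_one _) (by positivity)
      have h4 := mul_le_mul_of_nonneg_left (hE' q y hy) hc.le
      linarith [hψ' q y hy]
    calc _ ≤ (Real.exp (c * C') * Real.exp (-(c * δ) * ((q.1 : ℝ) ^ 2 + (q.2 : ℝ) ^ 2))) *
          ((c * C + C) * (1 + (q.1 : ℝ) ^ 2 + (q.2 : ℝ) ^ 2)) :=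
        mul_le_mul (hexp q y hy) h1 (abs_nonneg _) (by positivity)
      _ = _ := by ring
  refine ⟨Summable.of_norm_bounded (hs0.mul_left _) fun q => hbound q y hy, ?_⟩
  refine hasDerivAt_tsum_of_isPreconnected (hs0.mul_left _) isOpen_Ioo isPreconnected_Ioo
    (fun q z hz => ?_) hbound hy ?_ hy
  · have h := (((hE q z hz).const_mul (-c)).exp).mul ((hψ q z hz).cos)
    exact h.congr_deriv (by ring)
  · refine Summable.of_norm_bounded (hs0.mul_left (Real.exp (c * C'))) fun q => ?_
    rw [norm_mul, Real.norm_eq_abs, Real.norm_eq_abs, Real.abs_exp]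
    have h1 := hexp q y hy
    have h2 : (0 : ℝ) ≤ (q.1 : ℝ) ^ 2 + (q.2 : ℝ) ^ 2 := by positivity
    have h3 := Real.exp_pos (-(c * δ) * ((q.1 : ℝ) ^ 2 + (q.2 : ℝ) ^ 2))
    calc _ ≤ Real.exp (-c * E q y) * 1 :=
          mul_le_mul_of_nonneg_left (Real.abs_cos_le_one _) (Real.exp_pos _).le
      _ ≤ Real.exp (c * C') * (1 * Real.exp (-(c * δ) * ((q.1 : ℝ) ^ 2 + (q.2 : ℝ) ^ 2))) := by
          linarith
      _ ≤ _ := by gcongr; linarith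

/-- The quadratic polynomial on `ℤ × ℤ` measuring squared distances to a deep hole of the
hexagonal lattice. -/
def holeForm (q : ℤ × ℤ) : ℤ := q.1 ^ 2 + q.1 * q.2 + q.2 ^ 2 + q.1 + q.2

def rowForm (q : ℤ × ℤ) : ℤ := q.2 * (q.2 + 1)

/-- The points of `ℤ × ℤ` where `holeForm` is at most `2`. -/
def holeCore : Finset (ℤ × ℤ) :=
  {(0, 0), (0, -1), (-1, 0), (1, -1), (-1, 1), (-1, -1), (1, 0), (-2, 0), (0, 1), (-2, 1),
    (0, -2), (1, -2)}

lemma rowForm_nonneg (q : ℤ × ℤ) : 0 ≤ rowForm q := by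
  rw [rowForm]
  rcases le_or_gt 0 q.2 with h | h
  · exact mul_nonneg h (by omega)
  · exact mul_nonneg_of_nonpos_of_nonpos (by omega) (by omega)

lemma rowForm_le (q : ℤ × ℤ) : rowForm q ≤ 2 * holeForm q := by
  obtain ⟨k, l⟩ := q
  have h1 := rowForm_nonneg (0, k)
  have h2 := rowForm_nonneg (0, -1 - k - l)
  simp only [rowForm, holeForm] at *
  linarith

lemma holeForm_nonneg (q : ℤ × ℤ) : 0 ≤ holeForm q := by
  linarith [rowForm_le q, rowForm_nonneg q]

lemma natAbs_add_le_holeForm (q : ℤ × ℤ) :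
    3 * ((q.1.natAbs : ℤ) + q.2.natAbs) ≤ 2 * holeForm q + 5 := by
  obtain ⟨k, l⟩ := q
  simp only [holeForm, Int.natCast_natAbs]
  rcases abs_cases k with ⟨h1, h1'⟩ | ⟨h1, h1'⟩ <;>
  rcases abs_cases l with ⟨h2, h2'⟩ | ⟨h2, h2'⟩ <;> rw [h1, h2]
  · nlinarith [sq_nonneg (2 * k - 1), sq_nonneg (2 * l - 1), mul_nonneg h1' h2']
  · by_contra! h
    nlinarith [sq_nonneg (k - l - 3), sq_nonneg (3 * k + 3 * l + 2)]
  · by_contra! h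
    nlinarith [sq_nonneg (l - k - 3), sq_nonneg (3 * k + 3 * l + 2)]
  · nlinarith [sq_nonneg (2 * k + 2), sq_nonneg (2 * l + 2), sq_nonneg (k + l + 2),
      sq_nonneg (k - l)]

lemma four_le_holeForm {q : ℤ × ℤ} (hq : q ∉ holeCore) : 4 ≤ holeForm q := by
  by_contra! h
  have h1 := natAbs_add_le_holeForm q
  obtain ⟨k, l⟩ := q
  have hk1 : -3 ≤ k := by dsimp only at h1; omega
  have hk2 : k ≤ 3 := by dsimp only at h1; omega
  have hl1 : -3 ≤ l := by dsimp only at h1; omega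
  have hl2 : l ≤ 3 := by dsimp only at h1; omega
  clear h1
  interval_cases k <;> interval_cases l <;> revert hq h <;> decide

lemma quadratic_le_holeForm (q : ℤ × ℤ) :
    ((q.1 : ℝ) ^ 2 + (q.2 : ℝ) ^ 2) / 8 - 3 / 8 ≤ holeForm q - (rowForm q : ℝ) / 2 := by
  simp only [holeForm, rowForm]
  push_cast
  nlinarith [sq_nonneg (3 * (q.1 : ℝ) + 2 * q.2 + 2), sq_nonneg ((q.2 : ℝ) - 1),
    sq_nonneg ((q.1 : ℝ) + (q.2 + 1) / 2), sq_nonneg ((q.2 : ℝ) + 1)]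

lemma summable_of_abs_le_holeForm {p C : ℝ} (hp : 0 < p) {f : ℤ × ℤ → ℝ}
    (h : ∀ q : ℤ × ℤ, |f q| ≤ C * (1 + (q.1 : ℝ) ^ 2 + (q.2 : ℝ) ^ 2) *
      Real.exp (-p * holeForm q)) : Summable f := by
  have hs := (summable_quadratic_mul_exp (δ := p / 8) (by positivity)).mul_left
    (|C| * Real.exp (3 / 8 * p))
  refine Summable.of_norm_bounded hs fun q => (h q).trans ?_
  have h1 := quadratic_le_holeForm q
  have h2 : (0 : ℝ) ≤ rowForm q := by exact_mod_cast rowForm_nonneg q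
  have h3 : Real.exp (-p * holeForm q) ≤ Real.exp (3 / 8 * p) *
      Real.exp (-(p / 8) * ((q.1 : ℝ) ^ 2 + (q.2 : ℝ) ^ 2)) := by
    rw [← Real.exp_add]
    refine Real.exp_le_exp.2 ?_
    have h4 : ((q.1 : ℝ) ^ 2 + (q.2 : ℝ) ^ 2) / 8 - 3 / 8 ≤ holeForm q := by linarith
    linarith [mul_le_mul_of_nonneg_left h4 hp.le]
  calc _ ≤ |C| * (1 + (q.1 : ℝ) ^ 2 + (q.2 : ℝ) ^ 2) * (Real.exp (3 / 8 * p) *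
      Real.exp (-(p / 8) * ((q.1 : ℝ) ^ 2 + (q.2 : ℝ) ^ 2))) := by
        gcongr
        exact le_abs_self C
    _ = _ := by ring

lemma holeForm_le_quadratic (q : ℤ × ℤ) :
    (holeForm q : ℝ) ≤ 2 * (1 + (q.1 : ℝ) ^ 2 + (q.2 : ℝ) ^ 2) := by
  simp only [holeForm]
  push_cast
  nlinarith [sq_nonneg ((q.1 : ℝ) - q.2), sq_nonneg ((q.1 : ℝ) - 1), sq_nonneg ((q.2 : ℝ) - 1)]

lemma rowForm_le_quadratic (q : ℤ × ℤ) :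
    (rowForm q : ℝ) ≤ 2 * (1 + (q.1 : ℝ) ^ 2 + (q.2 : ℝ) ^ 2) := by
  simp only [rowForm]
  push_cast
  nlinarith [sq_nonneg (q.1 : ℝ), sq_nonneg ((q.2 : ℝ) - 1)]

noncomputable def geomMajorant (q : ℤ × ℤ) : ℝ :=
  Real.exp (13 / 4) * Real.exp (-(3 / 4)) ^ (q.1.natAbs + q.2.natAbs)

lemma exp_holeForm_le (q : ℤ × ℤ) :
    Real.exp (-((holeForm q : ℝ) - 4) / 2) ≤ geomMajorant q := by
  rw [geomMajorant, ← Real.exp_nat_mul, ← Real.exp_add]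
  refine Real.exp_le_exp.2 ?_
  have h : (3 * ((q.1.natAbs : ℝ) + q.2.natAbs) : ℝ) ≤ 2 * holeForm q + 5 := by
    have := (Int.cast_le (R := ℝ)).2 (natAbs_add_le_holeForm q)
    push_cast [Nat.cast_natAbs] at this ⊢
    exact this
  push_cast at h ⊢
  linarith

lemma exp_neg_three_quarters_bounds :
    0.472 ≤ Real.exp (-(3 / 4)) ∧ Real.exp (-(3 / 4)) ≤ 0.473 := by
  have e1 := Real.exp_one_gt_d9
  have e2 := Real.exp_one_lt_d9
  have h : Real.exp (-(3 / 4)) ^ 4 * Real.exp 1 ^ 3 = 1 := by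
    rw [← Real.exp_nat_mul, ← Real.exp_nat_mul, ← Real.exp_add]; norm_num
  have h0 := Real.exp_pos (-(3 / 4) : ℝ)
  generalize Real.exp 1 = e at *
  constructor
  · by_contra! hc
    have h1 : Real.exp (-(3 / 4)) ^ 4 * e ^ 3 ≤ 0.472 ^ 4 * 2.7182818286 ^ 3 := by
      gcongr
    norm_num at h1
    linarith
  · by_contra! hc
    have h1 : (0.473 : ℝ) ^ 4 * 2.7182818283 ^ 3 ≤ Real.exp (-(3 / 4)) ^ 4 * e ^ 3 := by
      gcongr
    norm_num at h1
    linarith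

lemma hasSum_geomMajorant : HasSum geomMajorant (Real.exp (13 / 4) *
    ((1 + Real.exp (-(3 / 4))) / (1 - Real.exp (-(3 / 4)))) ^ 2) :=
  (hasSum_pow_natAbs_add (Real.exp_pos _).le
    (by linarith [exp_neg_three_quarters_bounds.2])).mul_left _

lemma exp_thirteen_quarters_le : Real.exp (13 / 4) ≤ 25.8 := by
  have e2 := Real.exp_one_lt_d9
  have h : Real.exp (13 / 4) ^ 4 = Real.exp 1 ^ 13 := by
    rw [← Real.exp_nat_mul, ← Real.exp_nat_mul]; norm_num
  by_contra! hc
  have h1 : (25.8 : ℝ) ^ 4 ≤ Real.exp (13 / 4) ^ 4 := by gcongr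
  have h2 : Real.exp 1 ^ 13 ≤ 2.7182818286 ^ 13 := by gcongr
  rw [← h] at h2
  norm_num at h1 h2
  linarith

lemma geomMajorant_tail_le :
    Real.exp (13 / 4) * ((1 + Real.exp (-(3 / 4))) / (1 - Real.exp (-(3 / 4)))) ^ 2 -
      ∑ q ∈ holeCore, geomMajorant q ≤ 95 := by
  obtain ⟨h1, h2⟩ := exp_neg_three_quarters_bounds
  have h3 := exp_thirteen_quarters_le
  simp only [holeCore, geomMajorant]
  repeat rw [Finset.sum_insert (by decide)]
  rw [Finset.sum_singleton]
  generalize Real.exp (-(3 / 4)) = ρ at *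
  have h0 := Real.exp_pos (13 / 4)
  generalize Real.exp (13 / 4) = X at *
  norm_num
  have h4 : ((1 + ρ) / (1 - ρ)) ^ 2 ≤ 7.82 := by
    have : (1 + ρ) / (1 - ρ) ≤ 2.796 := by rw [div_le_iff₀ (by linarith)]; linarith
    have h5 : 0 ≤ (1 + ρ) / (1 - ρ) := div_nonneg (by linarith) (by linarith)
    calc _ ≤ (2.796 : ℝ) ^ 2 := by gcongr
      _ ≤ _ := by norm_num
  have h5 : (4.212 : ℝ) ≤ 1 + 4 * ρ + 5 * ρ ^ 2 + 2 * ρ ^ 3 := by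
    have : 1 + 4 * (0.472 : ℝ) + 5 * 0.472 ^ 2 + 2 * 0.472 ^ 3 ≤
      1 + 4 * ρ + 5 * ρ ^ 2 + 2 * ρ ^ 3 := by gcongr
    norm_num at this ⊢
    linarith
  have h6 := mul_le_mul_of_nonneg_left h4 h0.le
  have h7 := mul_le_mul_of_nonneg_left h5 h0.le
  linarith

lemma mul_exp_le_of_four_le {p n : ℝ} (hp : 1 ≤ p) (hn : 4 ≤ n) :
    n * Real.exp (-p * n) ≤ 4 * Real.exp (-4 * p) * Real.exp (-(n - 4) / 2) := by
  have e : Real.exp (-4 * p) * Real.exp (-(n - 4) / 2) =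
      Real.exp (-p * n) * Real.exp ((p - 1 / 2) * (n - 4)) := by
    rw [← Real.exp_add, ← Real.exp_add]; ring_nf
  rw [mul_assoc, e, mul_left_comm, mul_comm n]
  refine mul_le_mul_of_nonneg_left ?_ (Real.exp_pos _).le
  have := Real.add_one_le_exp ((p - 1 / 2) * (n - 4))
  nlinarith

lemma sq_mul_exp_le_of_four_le {p n : ℝ} (hp : 1 ≤ p) (hn : 4 ≤ n) :
    n ^ 2 * Real.exp (-p * n) ≤ 16 * Real.exp (-4 * p) * Real.exp (-(n - 4) / 2) := by
  have e : Real.exp (-4 * p) * Real.exp (-(n - 4) / 2) =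
      Real.exp (-p * n) * Real.exp ((p - 1 / 2) * (n - 4) / 2) ^ 2 := by
    rw [← Real.exp_nat_mul, ← Real.exp_add, ← Real.exp_add]; push_cast; ring_nf
  rw [mul_assoc, e, mul_left_comm, mul_comm (n ^ 2)]
  refine mul_le_mul_of_nonneg_left ?_ (Real.exp_pos _).le
  have h1 := Real.add_one_le_exp ((p - 1 / 2) * (n - 4) / 2)
  have h2 : n ≤ 4 * Real.exp ((p - 1 / 2) * (n - 4) / 2) := by nlinarith
  have h3 : n ^ 2 ≤ (4 * Real.exp ((p - 1 / 2) * (n - 4) / 2)) ^ 2 := by gcongr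
  linarith

/-- The deep hole is a centre of three-fold symmetry. -/
lemma tsum_holeForm_sub_rowForm {p : ℝ} (hp : 0 < p) :
    ∑' q : ℤ × ℤ, ((holeForm q : ℝ) - 3 / 2 * rowForm q) * Real.exp (-p * holeForm q) = 0 := by
  have hs : Summable fun q : ℤ × ℤ => (rowForm q : ℝ) * Real.exp (-p * holeForm q) :=
    summable_of_abs_le_holeForm hp fun q => by
      rw [abs_mul, Real.abs_exp, abs_of_nonneg (by exact_mod_cast rowForm_nonneg q)]
      gcongr
      exact rowForm_le_quadratic q
  let σ : ℤ × ℤ ≃ ℤ × ℤ :=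
    { toFun := fun q => (q.2, -1 - q.1 - q.2)
      invFun := fun q => (-1 - q.1 - q.2, q.1)
      left_inv := fun q => by ext <;> simp
      right_inv := fun q => by ext <;> simp only [] ; ring }
  have hσ : ∀ q, holeForm (σ q) = holeForm q := fun q => by
    simp only [σ, Equiv.coe_fn_mk, holeForm]; ring
  have h1 := σ.tsum_eq fun q : ℤ × ℤ => (rowForm q : ℝ) * Real.exp (-p * holeForm q)
  have h2 := σ.tsum_eq fun q : ℤ × ℤ => (rowForm (σ q) : ℝ) * Real.exp (-p * holeForm q)
  have hs1 := σ.summable_iff.2 hs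
  have hs2 := σ.summable_iff.2 hs1
  simp only [Function.comp_def, hσ] at h1 h2 hs1 hs2
  have h3 : ∀ q : ℤ × ℤ, (holeForm q : ℝ) - 3 / 2 * rowForm q =
      1 / 2 * rowForm (σ (σ q)) + 1 / 2 * rowForm (σ q) - rowForm q := by
    intro q
    simp only [σ, Equiv.coe_fn_mk, holeForm, rowForm]
    push_cast
    ring
  have h4 : ∀ q : ℤ × ℤ, ((holeForm q : ℝ) - 3 / 2 * rowForm q) * Real.exp (-p * holeForm q) =
      1 / 2 * ((rowForm (σ (σ q)) : ℝ) * Real.exp (-p * holeForm q)) +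
      1 / 2 * ((rowForm (σ q) : ℝ) * Real.exp (-p * holeForm q)) -
      (rowForm q : ℝ) * Real.exp (-p * holeForm q) := fun q => by rw [h3]; ring
  simp only [h4]
  rw [((hs2.mul_left _).add (hs1.mul_left _)).tsum_sub hs,
    (hs2.mul_left _).tsum_add (hs1.mul_left _), tsum_mul_left, tsum_mul_left]
  linarith

lemma summable_directTerm {ω p : ℝ} (hω : 0 ≤ ω) (hp : 0 < p) :
    Summable fun q : ℤ × ℤ => ((holeForm q : ℝ) - rowForm q * (3 / 2 + ω)) *
      Real.exp (-p * (holeForm q + rowForm q * ω)) := by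
  refine summable_of_abs_le_holeForm (C := 2 + 2 * (3 / 2 + ω)) hp fun q => ?_
  have hn : (0 : ℝ) ≤ holeForm q := by exact_mod_cast holeForm_nonneg q
  have hb : (0 : ℝ) ≤ rowForm q := by exact_mod_cast rowForm_nonneg q
  rw [abs_mul, Real.abs_exp]
  have h1 : |(holeForm q : ℝ) - rowForm q * (3 / 2 + ω)| ≤
      (2 + 2 * (3 / 2 + ω)) * (1 + (q.1 : ℝ) ^ 2 + (q.2 : ℝ) ^ 2) := by
    have h2 := holeForm_le_quadratic q
    have h3 := mul_le_mul_of_nonneg_right (rowForm_le_quadratic q)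
      (by linarith : 0 ≤ 3 / 2 + ω)
    have h4 : 0 ≤ (rowForm q : ℝ) * (3 / 2 + ω) := by positivity
    rw [abs_le]
    constructor <;> linarith
  have h2 : Real.exp (-p * (holeForm q + rowForm q * ω)) ≤ Real.exp (-p * holeForm q) := by
    refine Real.exp_le_exp.2 ?_
    have : 0 ≤ p * (rowForm q * ω) := by positivity
    linarith
  gcongr

lemma tsum_directTerm_le {ω p : ℝ} (hω : 0 ≤ ω) (hp : 1 ≤ p) :
    ∑' q : ℤ × ℤ, ((holeForm q : ℝ) - rowForm q * (3 / 2 + ω)) *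
      Real.exp (-p * (holeForm q + rowForm q * ω)) ≤
      2 * Real.exp (-p) + 4 * Real.exp (-p) ^ 2 + 380 * Real.exp (-p) ^ 4 := by
  have hle : ∀ q : ℤ × ℤ, ((holeForm q : ℝ) - rowForm q * (3 / 2 + ω)) *
      Real.exp (-p * (holeForm q + rowForm q * ω)) ≤
        max ((holeForm q : ℝ) - rowForm q * (3 / 2)) 0 * Real.exp (-p * holeForm q) := by
    intro q
    have hb : (0 : ℝ) ≤ rowForm q := by exact_mod_cast rowForm_nonneg q
    have h2 : Real.exp (-p * (holeForm q + rowForm q * ω)) ≤ Real.exp (-p * holeForm q) := by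
      refine Real.exp_le_exp.2 ?_
      have : 0 ≤ p * (rowForm q * ω) := by positivity
      linarith
    have h3 : (holeForm q : ℝ) - rowForm q * (3 / 2 + ω) ≤
        max ((holeForm q : ℝ) - rowForm q * (3 / 2)) 0 :=
      le_max_of_le_left (by linarith [mul_nonneg hb hω])
    calc _ ≤ max ((holeForm q : ℝ) - rowForm q * (3 / 2)) 0 *
          Real.exp (-p * (holeForm q + rowForm q * ω)) := by gcongr
      _ ≤ _ := by gcongr
  have h := tsum_le_sum_add_of_le_off (summable_directTerm hω (by linarith : 0 < p))
    (hasSum_geomMajorant.mul_left (4 * Real.exp (-4 * p))) holeCore (fun q hq => by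
      refine (hle q).trans ?_
      have h4 : (4 : ℝ) ≤ holeForm q := by exact_mod_cast four_le_holeForm hq
      have hb : (0 : ℝ) ≤ rowForm q := by exact_mod_cast rowForm_nonneg q
      have h5 : max ((holeForm q : ℝ) - rowForm q * (3 / 2)) 0 ≤ holeForm q :=
        max_le (by linarith) (by linarith)
      calc _ ≤ (holeForm q : ℝ) * Real.exp (-p * holeForm q) := by gcongr
        _ ≤ _ := mul_exp_le_of_four_le hp h4
        _ ≤ _ := by
          refine mul_le_mul_of_nonneg_left (exp_holeForm_le q) (by positivity))
  rw [← Finset.mul_sum] at h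
  have h1 := Finset.sum_le_sum fun q (_ : q ∈ holeCore) => hle q
  have h2 : ∑ q ∈ holeCore, max ((holeForm q : ℝ) - rowForm q * (3 / 2)) 0 *
      Real.exp (-p * holeForm q) = 2 * Real.exp (-p) + 4 * Real.exp (-p) ^ 2 := by
    rw [← Real.exp_nat_mul]
    rw [holeCore]
    repeat rw [Finset.sum_insert (by decide)]
    rw [Finset.sum_singleton]
    norm_num [holeForm, rowForm]
    ring_nf
  have h3 := mul_le_mul_of_nonneg_left geomMajorant_tail_le
    (by positivity : 0 ≤ 4 * Real.exp (-4 * p))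
  have h4 : Real.exp (-4 * p) = Real.exp (-p) ^ 4 := by
    rw [← Real.exp_nat_mul]; push_cast; ring_nf
  rw [h4] at h h3
  linarith

lemma tsum_directTerm_le_mul {ω p : ℝ} (hω : 0 ≤ ω) (hp : 1 ≤ p) :
    ∑' q : ℤ × ℤ, ((holeForm q : ℝ) - rowForm q * (3 / 2 + ω)) *
      Real.exp (-p * (holeForm q + rowForm q * ω)) ≤
      p * ω * (4 * Real.exp (-p) + 8 * Real.exp (-p) ^ 2 + 6080 * Real.exp (-p) ^ 4) := by
  have hp0 : 0 < p := by linarith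
  have hs0 : Summable fun q : ℤ × ℤ =>
      ((holeForm q : ℝ) - 3 / 2 * rowForm q) * Real.exp (-p * holeForm q) := by
    have := summable_directTerm le_rfl hp0
    refine this.congr fun q => ?_
    rw [mul_zero, add_zero, add_zero, mul_comm (3 / 2 : ℝ)]
  have hs := summable_directTerm hω hp0
  have hle : ∀ q : ℤ × ℤ, ((holeForm q : ℝ) - rowForm q * (3 / 2 + ω)) *
      Real.exp (-p * (holeForm q + rowForm q * ω)) -
        ((holeForm q : ℝ) - 3 / 2 * rowForm q) * Real.exp (-p * holeForm q) ≤
      p * ω * (rowForm q * max (3 / 2 * (rowForm q : ℝ) - holeForm q) 0 *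
        Real.exp (-p * holeForm q)) := by
    intro q
    have hb : (0 : ℝ) ≤ rowForm q := by exact_mod_cast rowForm_nonneg q
    have e : Real.exp (-p * (holeForm q + rowForm q * ω)) =
        Real.exp (-p * holeForm q) * Real.exp (-(p * rowForm q * ω)) := by
      rw [← Real.exp_add]; ring_nf
    have h1 := Real.add_one_le_exp (-(p * rowForm q * ω))
    have h2 : 0 ≤ p * rowForm q * ω := by positivity
    have h3 : Real.exp (-(p * rowForm q * ω)) ≤ 1 := Real.exp_le_one_iff.2 (by linarith)
    have h0 := Real.exp_pos (-(p * rowForm q * ω))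
    rw [e]
    generalize Real.exp (-(p * rowForm q * ω)) = w at *
    have h4 := Real.exp_pos (-p * holeForm q)
    have h5 : (holeForm q - 3 / 2 * rowForm q) * (w - 1) - rowForm q * ω * w ≤
        p * ω * (rowForm q * max (3 / 2 * (rowForm q : ℝ) - holeForm q) 0) := by
      have h6 : 0 ≤ (rowForm q : ℝ) * ω * w := by positivity
      have h7 : (holeForm q - 3 / 2 * rowForm q) * (w - 1) ≤
          max (3 / 2 * (rowForm q : ℝ) - holeForm q) 0 * (1 - w) := by
        have := mul_le_mul_of_nonneg_right (le_max_left (3 / 2 * (rowForm q : ℝ) - holeForm q) 0)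
          (by linarith : 0 ≤ 1 - w)
        linarith
      have h8 := mul_le_mul_of_nonneg_left (by linarith : 1 - w ≤ p * rowForm q * ω)
        (le_max_right (3 / 2 * (rowForm q : ℝ) - holeForm q) 0)
      linarith
    have h6 := mul_le_mul_of_nonneg_left h5 h4.le
    linarith
  have h := tsum_le_sum_add_of_le_off (hs.sub hs0)
    (hasSum_geomMajorant.mul_left (p * ω * (64 * Real.exp (-4 * p)))) holeCore (fun q hq => by
      refine (hle q).trans ?_
      have h4 : (4 : ℝ) ≤ holeForm q := by exact_mod_cast four_le_holeForm hq
      have hb : (0 : ℝ) ≤ rowForm q := by exact_mod_cast rowForm_nonneg q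
      have hbn : (rowForm q : ℝ) ≤ 2 * holeForm q := by exact_mod_cast rowForm_le q
      have h5 : max (3 / 2 * (rowForm q : ℝ) - holeForm q) 0 ≤ 2 * holeForm q :=
        max_le (by linarith) (by linarith)
      have h6 : 0 ≤ p * ω := by positivity
      rw [mul_assoc (p * ω)]
      refine mul_le_mul_of_nonneg_left ?_ h6
      calc _ ≤ (2 * holeForm q : ℝ) * (2 * holeForm q) * Real.exp (-p * holeForm q) := by gcongr
        _ = 4 * ((holeForm q : ℝ) ^ 2 * Real.exp (-p * holeForm q)) := by ring
        _ ≤ 4 * (16 * Real.exp (-4 * p) * Real.exp (-((holeForm q : ℝ) - 4) / 2)) :=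
          mul_le_mul_of_nonneg_left (sq_mul_exp_le_of_four_le hp h4) (by norm_num)
        _ ≤ 4 * (16 * Real.exp (-4 * p) * geomMajorant q) := by
          gcongr
          exact exp_holeForm_le q
        _ = _ := by ring)
  rw [← Finset.mul_sum, hs.tsum_sub hs0, tsum_holeForm_sub_rowForm hp0, sub_zero] at h
  have h1 := Finset.sum_le_sum fun q (_ : q ∈ holeCore) => hle q
  have h2 : ∑ q ∈ holeCore, rowForm q * max (3 / 2 * (rowForm q : ℝ) - holeForm q) 0 *
        Real.exp (-p * holeForm q) = 4 * Real.exp (-p) + 8 * Real.exp (-p) ^ 2 := by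
    rw [← Real.exp_nat_mul]
    rw [holeCore]
    repeat rw [Finset.sum_insert (by decide)]
    rw [Finset.sum_singleton]
    norm_num [holeForm, rowForm]
    ring_nf
  rw [← Finset.mul_sum, h2] at h1
  have h3 := mul_le_mul_of_nonneg_left geomMajorant_tail_le
    (by positivity : 0 ≤ p * ω * (64 * Real.exp (-4 * p)))
  have h4 : Real.exp (-4 * p) = Real.exp (-p) ^ 4 := by
    rw [← Real.exp_nat_mul]; push_cast; ring_nf
  rw [h4] at h h3
  linarith

lemma summable_exp_holeForm {ω p : ℝ} (hω : 0 ≤ ω) (hp : 0 < p) :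
    Summable fun q : ℤ × ℤ => Real.exp (-p * (holeForm q + rowForm q * ω)) := by
  refine summable_of_abs_le_holeForm (C := 1) hp fun q => ?_
  have hb : (0 : ℝ) ≤ rowForm q := by exact_mod_cast rowForm_nonneg q
  rw [Real.abs_exp]
  have h2 : Real.exp (-p * (holeForm q + rowForm q * ω)) ≤ Real.exp (-p * holeForm q) := by
    refine Real.exp_le_exp.2 ?_
    have : 0 ≤ p * (rowForm q * ω) := by positivity
    linarith
  refine h2.trans (le_mul_of_one_le_left (Real.exp_pos _).le ?_)
  nlinarith [sq_nonneg (q.1 : ℝ), sq_nonneg (q.2 : ℝ)]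

lemma three_le_tsum_exp_holeForm {ω p : ℝ} (hω : 0 ≤ ω) (hp : 0 < p) :
    3 ≤ ∑' q : ℤ × ℤ, Real.exp (-p * (holeForm q + rowForm q * ω)) := by
  have h := (summable_exp_holeForm hω hp).sum_le_tsum {((0 : ℤ), (0 : ℤ)), (0, -1), (-1, 0)}
    (fun q _ => (Real.exp_pos _).le)
  refine le_trans (le_of_eq ?_) h
  rw [Finset.sum_insert (by decide), Finset.sum_insert (by decide), Finset.sum_singleton]
  norm_num [holeForm, rowForm]

lemma exp_neg_le_inv_exp_one_mul {x : ℝ} (hx : 0 < x) : Real.exp (-x) ≤ 1 / (Real.exp 1 * x) := by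
  have h : x ≤ Real.exp (x - 1) := by linarith [Real.add_one_le_exp (x - 1)]
  rw [le_div_iff₀ (by positivity)]
  calc _ ≤ Real.exp (-x) * (Real.exp 1 * Real.exp (x - 1)) := by gcongr
    _ = 1 := by rw [← Real.exp_add, ← Real.exp_add]; simp

lemma exp_three_ge : 20 ≤ Real.exp 3 := by
  have e1 := Real.exp_one_gt_d9
  have h : Real.exp 3 = Real.exp 1 ^ 3 := by rw [← Real.exp_nat_mul]; norm_num
  rw [h]
  generalize Real.exp 1 = e at *
  calc (20 : ℝ) ≤ 2.7182818283 ^ 3 := by norm_num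
    _ ≤ _ := by gcongr

lemma mul_exp_neg_le {p : ℝ} (hp : 3.14 ≤ p) : p * Real.exp (-p) ≤ 0.138 := by
  have h := Real.add_one_le_exp (p - 3)
  have h3 := exp_three_ge
  have e : Real.exp (-p) * (Real.exp 3 * Real.exp (p - 3)) = 1 := by
    rw [← Real.exp_add, ← Real.exp_add]; simp
  have h4 : 20 * (p - 2) ≤ Real.exp 3 * Real.exp (p - 3) := by
    have := mul_le_mul h3 h (by linarith) (by linarith)
    linarith
  have h5 := mul_le_mul_of_nonneg_left h4 (Real.exp_pos (-p)).le
  have h6 := mul_nonneg (Real.exp_pos (-p)).le (by linarith : 0 ≤ 1.76 * p - 5.52)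
  linarith

lemma directTerm_bound_of_le_one {p : ℝ} (hp : 3.14 ≤ p) :
    p * (4 * Real.exp (-p) + 8 * Real.exp (-p) ^ 2 + 6080 * Real.exp (-p) ^ 4) < 0.75 := by
  have h1 := mul_exp_neg_le hp
  have h0 := Real.exp_pos (-p)
  generalize Real.exp (-p) = u at *
  have h2 : u ≤ 0.044 := by
    have := mul_le_mul_of_nonneg_right hp h0.le
    linarith
  have h3 : u ^ 3 ≤ 0.044 ^ 3 := by gcongr
  have e : p * (4 * u + 8 * u ^ 2 + 6080 * u ^ 4) = p * u * (4 + 8 * u + 6080 * u ^ 3) := by ring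
  rw [e]
  calc _ ≤ (0.138 : ℝ) * (4 + 8 * 0.044 + 6080 * 0.044 ^ 3) := by gcongr
    _ < _ := by norm_num

lemma directTerm_bound_of_one_le {y : ℝ} (hy1 : 1 ≤ y) (hy2 : y ≤ 5 / 2) :
    2 * Real.exp (-(Real.pi / y)) + 4 * Real.exp (-(Real.pi / y)) ^ 2 +
      380 * Real.exp (-(Real.pi / y)) ^ 4 <
    3 * ((y ^ 2 - 3 / 4) * (y ^ 2 + 1 / 4) / (4 * y ^ 2)) := by
  have hpi := Real.pi_gt_d4
  have e1 := Real.exp_one_gt_d9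
  have hy0 : 0 < y := by linarith
  have hep : 8.5394 ≤ Real.exp 1 * Real.pi := by nlinarith
  have hx : ∀ c : ℝ, 0 < c → Real.exp (-(c * (Real.pi / y))) ≤ y / c / 8.5394 := by
    intro c hc
    refine (exp_neg_le_inv_exp_one_mul (x := c * (Real.pi / y)) (by positivity)).trans ?_
    have e : 1 / (Real.exp 1 * (c * (Real.pi / y))) = y / c / (Real.exp 1 * Real.pi) := by
      field_simp
    rw [e]
    gcongr
  have h1 : Real.exp (-(Real.pi / y)) ≤ 0.0549 * y ^ 2 := by
    have h := hx (1 / 2) (by norm_num)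
    have e : Real.exp (-(Real.pi / y)) = Real.exp (-(1 / 2 * (Real.pi / y))) ^ 2 := by
      rw [← Real.exp_nat_mul]; push_cast; ring_nf
    rw [e]
    calc _ ≤ (y / (1 / 2) / 8.5394) ^ 2 := by gcongr
      _ = y ^ 2 * (1 / (1 / 2) / 8.5394) ^ 2 := by ring
      _ ≤ y ^ 2 * 0.0549 := by gcongr; norm_num
      _ = _ := by ring
  have h2 : Real.exp (-(Real.pi / y)) ^ 2 ≤ 0.01373 * y ^ 2 := by
    have h := hx 1 (by norm_num)
    rw [one_mul] at h
    calc _ ≤ (y / 1 / 8.5394) ^ 2 := by gcongr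
      _ = y ^ 2 * (1 / 8.5394) ^ 2 := by ring
      _ ≤ y ^ 2 * 0.01373 := by gcongr; norm_num
      _ = _ := by ring
  have h3 : Real.exp (-(Real.pi / y)) ^ 4 ≤ 0.00002942 * y ^ 6 := by
    have h := hx (2 / 3) (by norm_num)
    have e : Real.exp (-(Real.pi / y)) ^ 4 = Real.exp (-(2 / 3 * (Real.pi / y))) ^ 6 := by
      rw [← Real.exp_nat_mul, ← Real.exp_nat_mul]; push_cast; ring_nf
    rw [e]
    calc _ ≤ (y / (2 / 3) / 8.5394) ^ 6 := by gcongr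
      _ = y ^ 6 * (1 / (2 / 3) / 8.5394) ^ 6 := by ring
      _ ≤ y ^ 6 * 0.00002942 := by gcongr; norm_num
      _ = _ := by ring
  have e : 3 * ((y ^ 2 - 3 / 4) * (y ^ 2 + 1 / 4) / (4 * y ^ 2)) =
      3 * ((y ^ 2 - 3 / 4) * (y ^ 2 + 1 / 4)) / (4 * y ^ 2) := by ring
  rw [e, lt_div_iff₀ (by positivity)]
  have hY1 : 1 ≤ y ^ 2 := by nlinarith
  have hY2 : y ^ 2 ≤ 6.25 := by nlinarith
  rw [show y ^ 6 = (y ^ 2) ^ 3 by ring] at h3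
  generalize Real.exp (-(Real.pi / y)) = v at *
  generalize y ^ 2 = Y at *
  have h4 : (2 * v + 4 * v ^ 2 + 380 * v ^ 4) * (4 * Y) ≤
      (0.16472 * Y + 0.01118 * Y ^ 3) * (4 * Y) := by
    refine mul_le_mul_of_nonneg_right ?_ (by linarith)
    have : 0 ≤ Y ^ 3 := by positivity
    linarith
  have h5 : 0 ≤ (Y - 1) * (6.25 - Y) := mul_nonneg (by linarith) (by linarith)
  have h6 := mul_nonneg h5 (by linarith : 0 ≤ Y)
  have h7 := mul_nonneg h6 (by linarith : 0 ≤ Y)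
  linarith [sq_nonneg (Y - 1)]

lemma tsum_directTerm_lt {y a : ℝ} (hy0 : 0 < y) (hy : 3 / 4 < y ^ 2) (hy2 : y ≤ 5 / 2)
    (ha : Real.pi ≤ a) :
    ∑' q : ℤ × ℤ, ((holeForm q : ℝ) - rowForm q * (3 / 2 + (y ^ 2 - 3 / 4))) *
      Real.exp (-(a / y) * (holeForm q + rowForm q * (y ^ 2 - 3 / 4))) <
    (y ^ 2 - 3 / 4) * (y ^ 2 + 1 / 4) / (4 * y ^ 2) *
      ∑' q : ℤ × ℤ, Real.exp (-(a / y) * (holeForm q + rowForm q * (y ^ 2 - 3 / 4))) := by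
  have hpi := Real.pi_gt_d4
  have hω : 0 < y ^ 2 - 3 / 4 := by linarith
  have hpy : Real.pi / y ≤ a / y := by gcongr
  have hp1 : 1 ≤ a / y := by rw [le_div_iff₀ hy0]; linarith
  have hZ := three_le_tsum_exp_holeForm hω.le (by linarith : 0 < a / y)
  have hc : 0 ≤ (y ^ 2 - 3 / 4) * (y ^ 2 + 1 / 4) / (4 * y ^ 2) := by positivity
  refine lt_of_lt_of_le ?_ (mul_le_mul_of_nonneg_left hZ hc)
  rcases le_or_gt y 1 with h1 | h1
  · refine (tsum_directTerm_le_mul hω.le hp1).trans_lt ?_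
    have hp : 3.14 ≤ a / y := by
      rw [le_div_iff₀ hy0]; linarith
    have h2 := mul_lt_mul_of_pos_left (directTerm_bound_of_le_one hp) hω
    have h3 : (0.25 : ℝ) ≤ (y ^ 2 + 1 / 4) / (4 * y ^ 2) := by
      rw [le_div_iff₀ (by positivity)]; nlinarith
    have h4 := mul_le_mul_of_nonneg_left h3 hω.le
    rw [← mul_div_assoc] at h4
    linarith
  · refine (tsum_directTerm_le hω.le hp1).trans_lt ?_
    rw [mul_comm _ (3 : ℝ)]
    refine lt_of_le_of_lt ?_ (directTerm_bound_of_one_le h1.le hy2)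
    have : Real.exp (-(a / y)) ≤ Real.exp (-(Real.pi / y)) := Real.exp_le_exp.2 (by linarith)
    gcongr

lemma latticeTheta_half_eq {y : ℝ} (hy : 0 < y) (α : ℝ) :
    latticeTheta (1 / 2) y (bPoint (1 / 2) y) α = ∑' q : ℤ × ℤ,
      Real.exp (-(Real.pi * α) * (holeForm q / y + rowForm q * (y - 3 / 4 / y) +
        (y / 4 + 1 / 8 / y + 1 / 64 / y ^ 3))) := by
  rw [latticeTheta_bPoint hy]
  refine tsum_congr fun q => ?_
  congr 1
  simp only [holeForm, rowForm, shiftHeight]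
  push_cast
  field_simp
  ring

lemma hasDerivAt_energy (N B : ℝ) {y : ℝ} (hy : 0 < y) :
    HasDerivAt (fun y : ℝ => N / y + B * (y - 3 / 4 / y) + (y / 4 + 1 / 8 / y + 1 / 64 / y ^ 3))
      (-N / y ^ 2 + B * (1 + 3 / 4 / y ^ 2) + (1 / 4 - 1 / 8 / y ^ 2 - 3 / 64 / y ^ 4)) y := by
  have hi : ∀ c : ℝ, HasDerivAt (fun y : ℝ => c / y) (-c / y ^ 2) y := fun c => by
    have h := ((hasDerivAt_inv hy.ne').const_mul c)
    exact h.congr_deriv (by ring)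
  have h3 : HasDerivAt (fun y : ℝ => 1 / 64 / y ^ 3) (-(3 / 64 / y ^ 4)) y := by
    have h := (((hasDerivAt_pow 3 y).fun_inv (by positivity)).const_mul (1 / 64 : ℝ))
    refine h.congr_deriv ?_
    push_cast
    field_simp
  have h := ((hi N).add (((hasDerivAt_id y).sub (hi (3 / 4))).const_mul B)).add
    ((((hasDerivAt_id y).div_const 4).add (hi (1 / 8))).add h3)
  exact h.congr_deriv (by ring)

lemma strictAntiOn_latticeTheta_half {α : ℝ} (hα : 1 ≤ α) :
    StrictAntiOn (fun y => latticeTheta (1 / 2) y (bPoint (1 / 2) y) α)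
      (Set.Icc (√3 / 2) (5 / 2)) := by
  have hpi := Real.pi_pos
  have h3 : √3 ^ 2 = 3 := Real.sq_sqrt (by norm_num)
  have h3p : 0 < √3 := by positivity
  have hh : 1 / 2 < √3 / 2 := by nlinarith
  have hc : 0 < Real.pi * α := by positivity
  have key := hasDerivAt_tsum_exp_mul_cos (c := Real.pi * α) (δ := 1 / 24) (C := 20) (C' := 1)
    (A := 1 / 2) (M := 3)
    (E := fun q y => holeForm q / y + rowForm q * (y - 3 / 4 / y) +
        (y / 4 + 1 / 8 / y + 1 / 64 / y ^ 3))
    (E' := fun q y => -holeForm q / y ^ 2 + rowForm q * (1 + 3 / 4 / y ^ 2) +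
        (1 / 4 - 1 / 8 / y ^ 2 - 3 / 64 / y ^ 4))
    (ψ := fun _ _ => 0) (ψ' := fun _ _ => 0) hc (by norm_num)
    (fun q y hy => hasDerivAt_energy _ _ (by linarith [hy.1]))
    (fun q y hy => hasDerivAt_const _ _)
    (fun q y hy => by
      have hy0 : 0 < y := by linarith [hy.1]
      have hn : (0 : ℝ) ≤ holeForm q := by exact_mod_cast holeForm_nonneg q
      have hb : (0 : ℝ) ≤ rowForm q := by exact_mod_cast rowForm_nonneg q
      have hn2 := holeForm_le_quadratic q
      have hb2 := rowForm_le_quadratic q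
      have hi : 1 / y ≤ 2 := by rw [div_le_iff₀ hy0]; linarith [hy.1]
      have hi0 : 0 < 1 / y := by positivity
      have e1 : -(holeForm q : ℝ) / y ^ 2 = -(holeForm q * (1 / y) ^ 2) := by ring
      have e2 : 3 / 4 / y ^ 2 = 3 / 4 * (1 / y) ^ 2 := by ring
      have e3 : 1 / 8 / y ^ 2 = 1 / 8 * (1 / y) ^ 2 := by ring
      have e4 : 3 / 64 / y ^ 4 = 3 / 64 * (1 / y) ^ 4 := by ring
      have i2 : (1 / y) ^ 2 ≤ 2 ^ 2 := by gcongr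
      have i4 : (1 / y) ^ 4 ≤ 2 ^ 4 := by gcongr
      have j2 : 0 ≤ (1 / y) ^ 2 := by positivity
      have j4 : 0 ≤ (1 / y) ^ 4 := by positivity
      have hQ : (0 : ℝ) ≤ (q.1 : ℝ) ^ 2 + (q.2 : ℝ) ^ 2 := by positivity
      rw [e1, e2, e3, e4]
      have m1 := mul_le_mul_of_nonneg_left i2 hn
      have m2 := mul_le_mul_of_nonneg_left i2 hb
      have m3 := mul_nonneg hn j2
      have m4 := mul_nonneg hb j2
      rw [abs_le]
      constructor <;> linarith)
    (fun q y hy => by simp only [abs_zero]; positivity)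
    (fun q y hy => by
      have hy0 : 0 < y := by linarith [hy.1]
      have hb : (0 : ℝ) ≤ rowForm q := by exact_mod_cast rowForm_nonneg q
      have hq := quadratic_le_holeForm q
      have hQ : (0 : ℝ) ≤ (q.1 : ℝ) ^ 2 + (q.2 : ℝ) ^ 2 := by positivity
      have e : (holeForm q : ℝ) / y + rowForm q * (y - 3 / 4 / y) =
          (holeForm q + rowForm q * (y ^ 2 - 3 / 4)) / y := by field_simp
      have h1 : (0 : ℝ) ≤ y / 4 + 1 / 8 / y + 1 / 64 / y ^ 3 := by positivity
      have h2 : ((q.1 : ℝ) ^ 2 + (q.2 : ℝ) ^ 2) / 24 - 1 ≤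
          (holeForm q + rowForm q * (y ^ 2 - 3 / 4)) / y := by
        rw [le_div_iff₀ hy0]
        have h3 : -(1 / 2 : ℝ) ≤ y ^ 2 - 3 / 4 := by nlinarith [hy.1]
        have h4 := mul_le_mul_of_nonneg_left h3 hb
        have h5 := mul_le_mul_of_nonneg_left hy.2.le hQ
        linarith [hy.1]
      rw [e]
      linarith)
  simp only [Real.cos_zero, Real.sin_zero, mul_zero, mul_one, sub_zero] at key
  have hder : ∀ y ∈ Set.Ioo (1 / 2 : ℝ) 3, HasDerivAt
      (fun y => latticeTheta (1 / 2) y (bPoint (1 / 2) y) α) _ y := fun y hy =>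
    (key y hy).2.congr_of_eventuallyEq (by
      filter_upwards [isOpen_Ioo.mem_nhds hy] with z hz
      exact latticeTheta_half_eq (by linarith [hz.1]) α)
  refine strictAntiOn_of_deriv_neg (convex_Icc _ _) (fun y hy => ?_) fun y hy => ?_
  · exact (hder y ⟨by linarith [hy.1], by linarith [hy.2]⟩).continuousAt.continuousWithinAt
  rw [interior_Icc] at hy
  have hy' : y ∈ Set.Ioo (1 / 2 : ℝ) 3 := ⟨by linarith [hy.1], by linarith [hy.2]⟩
  rw [(hder y hy').deriv]
  have hy0 : 0 < y := by linarith [hy'.1]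
  have hy2 : 3 / 4 < y ^ 2 := by nlinarith [hy.1]
  have hlt := tsum_directTerm_lt hy0 hy2 hy.2.le (by nlinarith : Real.pi ≤ Real.pi * α)
  have hp : 0 < Real.pi * α / y := by positivity
  have hs1 := summable_directTerm (by linarith : 0 ≤ y ^ 2 - 3 / 4) hp
  have hs2 := (summable_exp_holeForm (by linarith : 0 ≤ y ^ 2 - 3 / 4) hp).mul_left
    ((y ^ 2 - 3 / 4) * (y ^ 2 + 1 / 4) / (4 * y ^ 2))
  rw [← tsum_mul_left, ← sub_pos, ← hs2.tsum_sub hs1] at hlt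
  have hterm : ∀ q : ℤ × ℤ, Real.exp (-(Real.pi * α) * (holeForm q / y +
      rowForm q * (y - 3 / 4 / y) + (y / 4 + 1 / 8 / y + 1 / 64 / y ^ 3))) *
      (-(Real.pi * α) * (-holeForm q / y ^ 2 + rowForm q * (1 + 3 / 4 / y ^ 2) +
        (1 / 4 - 1 / 8 / y ^ 2 - 3 / 64 / y ^ 4))) =
      -(Real.pi * α / y ^ 2 * Real.exp (-(Real.pi * α) * (y / 4 + 1 / 8 / y + 1 / 64 / y ^ 3))) *
      ((y ^ 2 - 3 / 4) * (y ^ 2 + 1 / 4) / (4 * y ^ 2) *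
          Real.exp (-(Real.pi * α / y) * (holeForm q + rowForm q * (y ^ 2 - 3 / 4))) -
        (holeForm q - rowForm q * (3 / 2 + (y ^ 2 - 3 / 4))) *
          Real.exp (-(Real.pi * α / y) * (holeForm q + rowForm q * (y ^ 2 - 3 / 4)))) := by
    intro q
    have e : Real.exp (-(Real.pi * α) * (holeForm q / y +
      rowForm q * (y - 3 / 4 / y) + (y / 4 + 1 / 8 / y + 1 / 64 / y ^ 3))) =
      Real.exp (-(Real.pi * α / y) * (holeForm q + rowForm q * (y ^ 2 - 3 / 4))) *
      Real.exp (-(Real.pi * α) * (y / 4 + 1 / 8 / y + 1 / 64 / y ^ 3)) := by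
      rw [← Real.exp_add]
      congr 1
      field_simp
      ring
    rw [e]
    generalize Real.exp (-(Real.pi * α / y) * (holeForm q + rowForm q * (y ^ 2 - 3 / 4))) = X
    generalize Real.exp (-(Real.pi * α) * (y / 4 + 1 / 8 / y + 1 / 64 / y ^ 3)) = Y
    field_simp
    ring
  rw [tsum_congr hterm, tsum_mul_left]
  refine mul_neg_of_neg_of_pos ?_ hlt
  have := Real.exp_pos (-(Real.pi * α) * (y / 4 + 1 / 8 / y + 1 / 64 / y ^ 3))
  exact neg_neg_of_pos (by positivity)

lemma tsum_exp_neg_shifted_sq_le_add {c β : ℝ} (hc : 0 < c) (hβ1 : 1 / 3 ≤ β) (hβ2 : β ≤ 1 / 2) :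
    ∑' l : ℤ, Real.exp (-c * ((l : ℝ) + β) ^ 2) ≤
      (Real.exp (-c * β ^ 2) + Real.exp (-c * (1 - β) ^ 2)) / (1 - Real.exp (-(5 / 3 * c))) := by
  have hρ : Real.exp (-(5 / 3 * c)) < 1 := Real.exp_lt_one_iff.2 (by linarith)
  have hs := summable_exp_neg_mul_sq hc β
  have hg := fun b : ℝ =>
    (hasSum_geometric_of_lt_one (Real.exp_pos _).le hρ).mul_left (Real.exp (-c * b ^ 2))
  have hle : ∀ (n : ℕ) (b x : ℝ), b ^ 2 + 5 / 3 * n ≤ x ^ 2 → Real.exp (-c * x ^ 2) ≤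
      Real.exp (-c * b ^ 2) * Real.exp (-(5 / 3 * c)) ^ n := by
    intro n b x hx
    rw [← Real.exp_nat_mul, ← Real.exp_add]
    refine Real.exp_le_exp.2 ?_
    linarith [mul_le_mul_of_nonneg_left hx hc.le]
  generalize hf : (fun l : ℤ => Real.exp (-c * ((l : ℝ) + β) ^ 2)) = f at hs ⊢
  have hfl : ∀ l : ℤ, f l = Real.exp (-c * ((l : ℝ) + β) ^ 2) := fun l => by rw [← hf]
  have hs1 : Summable fun n : ℕ => f n := hs.comp_injective Nat.cast_injective
  have hs2 : Summable fun n : ℕ => f (-((n : ℤ) + 1)) :=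
    hs.comp_injective (i := fun n : ℕ => -((n : ℤ) + 1)) fun m n h => by simpa using h
  have hsq : ∀ n : ℕ, (n : ℝ) ≤ (n : ℝ) ^ 2 := fun n => by
    exact_mod_cast Nat.le_self_pow two_ne_zero n
  have hA : ∀ t : ℝ, 0 ≤ t → t ≤ t ^ 2 → β ^ 2 + 5 / 3 * t ≤ (t + β) ^ 2 ∧
      (1 - β) ^ 2 + 5 / 3 * t ≤ (-(t + 1) + β) ^ 2 := fun t h0 h1 => by
    have h2 := mul_le_mul_of_nonneg_left hβ1 h0
    have h3 := mul_le_mul_of_nonneg_left hβ2 h0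
    constructor <;> linarith
  have h1 := hs1.tsum_le_tsum (fun n => by
    rw [hfl]
    refine hle n β _ ?_
    push_cast
    exact (hA n n.cast_nonneg (hsq n)).1) (hg β).summable
  have h2 := hs2.tsum_le_tsum (fun n => by
    rw [hfl]
    refine hle n (1 - β) _ ?_
    push_cast
    exact (hA n n.cast_nonneg (hsq n)).2) (hg (1 - β)).summable
  rw [(hg _).tsum_eq] at h1 h2
  rw [tsum_of_nat_of_neg_add_one hs1 hs2]
  refine (add_le_add h1 h2).trans (le_of_eq ?_)
  simp only [add_div, div_eq_mul_inv (Real.exp _)]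

lemma tsum_exp_neg_shifted_sq_le {c β : ℝ} (hc : 0 < c) (hβ1 : 1 / 3 ≤ β) (hβ2 : β ≤ 1 / 2) :
    ∑' l : ℤ, Real.exp (-c * ((l : ℝ) + β) ^ 2) ≤
      2 * Real.exp (-c * β ^ 2) / (1 - Real.exp (-(5 / 3 * c))) := by
  have hρ : Real.exp (-(5 / 3 * c)) < 1 := Real.exp_lt_one_iff.2 (by linarith)
  have h : Real.exp (-c * (1 - β) ^ 2) ≤ Real.exp (-c * β ^ 2) := by
    refine Real.exp_le_exp.2 ?_
    have := mul_nonneg hc.le (by linarith : 0 ≤ 1 - 2 * β)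
    linarith
  refine (tsum_exp_neg_shifted_sq_le_add hc hβ1 hβ2).trans
    (div_le_div_of_nonneg_right ?_ (by linarith))
  linarith

/-- Crude bound for a rectangular-type sum by the product of its marginals. -/
lemma tsum_exp_shifted_form_le {c y R : ℝ} (hc : 0 < c) (hy : 0 < y) (x u v : ℝ)
    (hR : ∀ a : ℝ, ∑' k : ℤ, Real.exp (-c * ((k : ℝ) + a) ^ 2) ≤ R) :
    ∑' q : ℤ × ℤ, Real.exp (-c * (((q.1 : ℝ) + u + x * q.2) ^ 2 + y ^ 2 * ((q.2 : ℝ) + v) ^ 2)) ≤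
      R * ∑' l : ℤ, Real.exp (-(c * y ^ 2) * ((l : ℝ) + v) ^ 2) := by
  have hs := summable_exp_neg_shifted_form hc hy x u v
  have hs' := (Equiv.prodComm ℤ ℤ).summable_iff.2 hs
  simp only [Function.comp_def] at hs'
  rw [← (Equiv.prodComm ℤ ℤ).tsum_eq, Summable.tsum_prod hs', ← tsum_mul_left]
  have hp := hs'.prod
  refine hp.tsum_le_tsum (fun l => ?_)
    ((summable_exp_neg_mul_sq (c := c * y ^ 2) (by positivity) v).mul_left R)
  simp only [Equiv.prodComm_apply, Prod.swap]
  have e : ∀ k : ℤ, Real.exp (-c * (((k : ℝ) + u + x * l) ^ 2 + y ^ 2 * ((l : ℝ) + v) ^ 2)) =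
      Real.exp (-c * ((k : ℝ) + (u + x * l)) ^ 2) *
        Real.exp (-(c * y ^ 2) * ((l : ℝ) + v) ^ 2) := by
    intro k
    rw [← Real.exp_add]
    ring_nf
  rw [tsum_congr e, tsum_mul_right]
  exact mul_le_mul_of_nonneg_right (hR _) (Real.exp_pos _).le

lemma exp_neg_pi_le : Real.exp (-Real.pi) ≤ 0.044 := by
  have hpi := Real.pi_gt_d4
  have h := mul_exp_neg_le (p := Real.pi) (by linarith)
  nlinarith [Real.exp_pos (-Real.pi)]

lemma tsum_exp_neg_pi_mul_sq_le {t : ℝ} (ht : 1 ≤ t) :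
    ∑' k : ℤ, Real.exp (-(Real.pi * t) * (k : ℝ) ^ 2) ≤ 1.1 := by
  have hpi := Real.pi_pos
  refine (tsum_exp_neg_mul_sq_le (by positivity)).trans ?_
  have h : Real.exp (-(Real.pi * t)) ≤ 0.044 :=
    (Real.exp_le_exp.2 (by nlinarith)).trans exp_neg_pi_le
  have : 2 * Real.exp (-(Real.pi * t)) / (1 - Real.exp (-(Real.pi * t))) ≤ 0.1 := by
    rw [div_le_iff₀ (by linarith)]; linarith
  linarith

lemma tsum_exp_neg_pi_mul_shifted_sq_le {r B : ℝ} (hr : 0 < r) (hB1 : 1 ≤ B)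
    (hB2 : (√r)⁻¹ ≤ B) (a : ℝ) :
    ∑' k : ℤ, Real.exp (-(Real.pi * r) * ((k : ℝ) + a) ^ 2) ≤ 1.1 * B := by
  refine (tsum_shifted_le hr a).trans ?_
  rcases le_or_gt r 1 with h1 | h1
  · have h2 := tsum_exp_neg_pi_mul_sq_le (t := 1 / r) (by rw [le_div_iff₀ hr]; linarith)
    rw [mul_one_div] at h2
    have h3 : 0 < (√r)⁻¹ := by positivity
    calc _ ≤ (√r)⁻¹ * 1.1 := by gcongr
      _ ≤ B * 1.1 := by gcongr
      _ = _ := by ring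
  · have h := tsum_gaussian_mul_cos hr 0 0
    simp only [mul_zero, Real.cos_zero, mul_one, add_zero, zero_mul] at h
    rw [← h]
    refine (tsum_exp_neg_pi_mul_sq_le h1.le).trans ?_
    linarith

lemma latticeTheta_half_lt_of_ge {y α : ℝ} (hy : 5 / 2 ≤ y) (hα : 1 ≤ α) :
    latticeTheta (1 / 2) y (bPoint (1 / 2) y) α <
      latticeTheta (1 / 2) (√3 / 2) (bPoint (1 / 2) (√3 / 2)) α := by
  have hpi := Real.pi_gt_d4
  have hy0 : 0 < y := by linarith
  have hα0 : 0 < α := by linarith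
  have h3 : √3 ^ 2 = 3 := Real.sq_sqrt (by norm_num)
  have h3p : 0 < √3 := by positivity
  have hβ : 0.48 ≤ shiftHeight y := by
    have : 1 / (8 * y ^ 2) ≤ 1 / 50 := one_div_le_one_div_of_le (by norm_num) (by nlinarith)
    rw [shiftHeight]
    linarith
  obtain ⟨-, hβ2⟩ := shiftHeight_bounds hy0 (by nlinarith)
  have hr : 0 < α / y := by positivity
  have hB : (√(α / y))⁻¹ ≤ Real.exp ((y - 1) / 2) := by
    rw [← Real.sqrt_inv, inv_div, Real.sqrt_le_left (Real.exp_pos _).le, ← Real.exp_nat_mul]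
    push_cast
    rw [mul_div_cancel₀ _ (two_ne_zero)]
    have := Real.add_one_le_exp (y - 1)
    have h2 : y / α ≤ y := div_le_self hy0.le hα
    linarith
  have hR := fun a => tsum_exp_neg_pi_mul_shifted_sq_le hr
    (Real.one_le_exp (by linarith : 0 ≤ (y - 1) / 2)) hB a
  rw [← mul_div_assoc] at hR
  have hc : 0 < Real.pi * α / y := by positivity
  have hU := tsum_exp_shifted_form_le hc hy0 (1 / 2) (1 / 2) (shiftHeight y) hR
  rw [← latticeTheta_bPoint hy0] at hU
  have hV := tsum_exp_neg_shifted_sq_le (c := Real.pi * α / y * y ^ 2) (by positivity)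
    (by linarith) hβ2.le
  have ec : Real.pi * α / y * y ^ 2 = Real.pi * α * y := by field_simp
  rw [ec] at hU hV
  have hαy : 7.85 ≤ Real.pi * α * y := by
    have h1 : 3.14 ≤ Real.pi * α := by nlinarith
    nlinarith
  have hden : Real.exp (-(5 / 3 * (Real.pi * α * y))) ≤ 0.001 := by
    have h1 := Real.exp_le_exp.2 (by linarith : -(5 / 3 * (Real.pi * α * y)) ≤ -12)
    have h2 : Real.exp (-12) = Real.exp (-3) ^ 4 := by
      rw [← Real.exp_nat_mul]; norm_num
    have h3 : Real.exp (-3) ≤ 1 / 20 := by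
      rw [Real.exp_neg, one_div]; exact inv_anti₀ (by norm_num) exp_three_ge
    have h4 : Real.exp (-3) ^ 4 ≤ (1 / 20) ^ 4 := by gcongr
    norm_num at h4
    linarith
  have hX := Real.exp_pos (-(Real.pi * α * y) * shiftHeight y ^ 2)
  have hV2 : 2 * Real.exp (-(Real.pi * α * y) * shiftHeight y ^ 2) /
      (1 - Real.exp (-(5 / 3 * (Real.pi * α * y)))) ≤
      2.003 * Real.exp (-(Real.pi * α * y) * shiftHeight y ^ 2) := by
    rw [div_le_iff₀ (by linarith)]
    have := mul_le_mul_of_nonneg_left hden hX.le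
    linarith
  have hlow : 3 * Real.exp (-(Real.pi * α) * 0.385) ≤
      latticeTheta (1 / 2) (√3 / 2) (bPoint (1 / 2) (√3 / 2)) α := by
    rw [latticeTheta_half_eq (by positivity)]
    have h := three_le_tsum_exp_holeForm (ω := 0) le_rfl
      (by positivity : 0 < Real.pi * α / (√3 / 2))
    have e : ∀ q : ℤ × ℤ, Real.exp (-(Real.pi * α) * (holeForm q / (√3 / 2) +
        rowForm q * (√3 / 2 - 3 / 4 / (√3 / 2)) +
        (√3 / 2 / 4 + 1 / 8 / (√3 / 2) + 1 / 64 / (√3 / 2) ^ 3))) =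
        Real.exp (-(Real.pi * α) * (2 / (3 * √3))) *
          Real.exp (-(Real.pi * α / (√3 / 2)) * (holeForm q + rowForm q * 0)) := by
      intro q
      rw [← Real.exp_add]
      congr 1
      have e1 : √3 / 2 - 3 / 4 / (√3 / 2) = 0 := by field_simp; linarith
      have e2 : √3 / 2 / 4 + 1 / 8 / (√3 / 2) + 1 / 64 / (√3 / 2) ^ 3 = 2 / (3 * √3) := by
        field_simp
        rw [h3]
        norm_num
      rw [e1, e2]
      ring
    rw [tsum_congr e, tsum_mul_left]
    have h4 : 2 / (3 * √3) ≤ 0.385 := by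
      rw [div_le_iff₀ (by positivity)]
      nlinarith
    have h5 : Real.exp (-(Real.pi * α) * 0.385) ≤ Real.exp (-(Real.pi * α) * (2 / (3 * √3))) := by
      refine Real.exp_le_exp.2 ?_
      have := mul_le_mul_of_nonneg_left h4 (by positivity : 0 ≤ Real.pi * α)
      linarith
    have h6 := mul_le_mul_of_nonneg_left h (Real.exp_pos (-(Real.pi * α) * (2 / (3 * √3)))).le
    linarith
  refine lt_of_lt_of_le ?_ hlow
  have hfin : Real.exp ((y - 1) / 2) * Real.exp (-(Real.pi * α * y) * shiftHeight y ^ 2) ≤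
      1.18 * Real.exp (-(Real.pi * α) * 0.385) := by
    have h1 : Real.exp 0.15 ≤ 1.18 := by
      have := Real.add_one_le_exp (-0.15 : ℝ)
      have e : Real.exp 0.15 * Real.exp (-0.15) = 1 := by rw [← Real.exp_add]; norm_num
      nlinarith [Real.exp_pos 0.15]
    refine le_trans ?_ (mul_le_mul_of_nonneg_right h1 (Real.exp_pos _).le)
    rw [← Real.exp_add, ← Real.exp_add]
    refine Real.exp_le_exp.2 ?_
    have h2 : 0.2304 ≤ shiftHeight y ^ 2 := by nlinarith
    have h3 := mul_le_mul_of_nonneg_left h2 (by positivity : 0 ≤ Real.pi * α * y)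
    have h4 : 3.1415 ≤ Real.pi * α := by nlinarith
    have h5 := mul_le_mul_of_nonneg_right h4 (by linarith : 0 ≤ 0.2304 * y - 0.385)
    linarith
  have hV3 := hV.trans hV2
  have hexp := Real.exp_pos ((y - 1) / 2)
  calc _ ≤ _ := hU
    _ ≤ 1.1 * Real.exp ((y - 1) / 2) *
        (2.003 * Real.exp (-(Real.pi * α * y) * shiftHeight y ^ 2)) := by gcongr
    _ = 2.2033 * (Real.exp ((y - 1) / 2) *
        Real.exp (-(Real.pi * α * y) * shiftHeight y ^ 2)) := by ring
    _ ≤ 2.2033 * (1.18 * Real.exp (-(Real.pi * α) * 0.385)) := by gcongr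
    _ < _ := by linarith [Real.exp_pos (-(Real.pi * α) * 0.385)]

/-- On the line `x = 1/2` the hexagonal height is strictly optimal when `1 ≤ α`. -/
lemma latticeTheta_half_lt_hexagonal {y α : ℝ} (hy : √3 / 2 < y) (hα : 1 ≤ α) :
    latticeTheta (1 / 2) y (bPoint (1 / 2) y) α <
      latticeTheta (1 / 2) (√3 / 2) (bPoint (1 / 2) (√3 / 2)) α := by
  rcases le_or_gt (5 / 2) y with h | h
  · exact latticeTheta_half_lt_of_ge h hα
  · exact strictAntiOn_latticeTheta_half hα ⟨le_rfl, by linarith⟩ ⟨hy.le, h.le⟩ hy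

/-- The quadratic form of the hexagonal lattice. -/
def hexForm (q : ℤ × ℤ) : ℤ := q.1 ^ 2 + q.1 * q.2 + q.2 ^ 2

/-- The points of `ℤ × ℤ` where `hexForm` is at most `1`. -/
def hexCore : Finset (ℤ × ℤ) := {(0, 0), (1, 0), (-1, 0), (0, 1), (0, -1), (1, -1), (-1, 1)}

/-- The points of `ℤ × ℤ` where `hexForm` equals `3`. -/
def hexShellThree : Finset (ℤ × ℤ) := {(1, 1), (-1, -1), (2, -1), (-2, 1), (1, -2), (-1, 2)}

/-- The points of `ℤ × ℤ` where `hexForm` equals `4`. -/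
def hexShellFour : Finset (ℤ × ℤ) := {(2, 0), (-2, 0), (0, 2), (0, -2), (2, -2), (-2, 2)}

lemma natAbs_add_le_hexForm (q : ℤ × ℤ) :
    24 * ((q.1.natAbs : ℤ) + q.2.natAbs) ≤ 9 * hexForm q + 64 := by
  obtain ⟨k, l⟩ := q
  simp only [hexForm, Int.natCast_natAbs]
  rcases abs_cases k with ⟨h1, h1'⟩ | ⟨h1, h1'⟩ <;>
  rcases abs_cases l with ⟨h2, h2'⟩ | ⟨h2, h2'⟩ <;> rw [h1, h2]
  · nlinarith [sq_nonneg (3 * (k + l) - 4), sq_nonneg (k - l)]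
  · nlinarith [sq_nonneg (3 * (k - l) - 16), sq_nonneg (k + l)]
  · nlinarith [sq_nonneg (3 * (l - k) - 16), sq_nonneg (k + l)]
  · nlinarith [sq_nonneg (3 * (k + l) + 4), sq_nonneg (k - l)]

lemma seven_le_hexForm {q : ℤ × ℤ} (hq : q ∉ hexCore ∪ (hexShellThree ∪ hexShellFour)) :
    7 ≤ hexForm q := by
  by_contra! h
  have h1 := natAbs_add_le_hexForm q
  obtain ⟨k, l⟩ := q
  have hk1 : -4 ≤ k := by dsimp only at h1; omega
  have hk2 : k ≤ 4 := by dsimp only at h1; omega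
  have hl1 : -4 ≤ l := by dsimp only at h1; omega
  have hl2 : l ≤ 4 := by dsimp only at h1; omega
  clear h1
  interval_cases k <;> interval_cases l <;> revert hq h <;> decide

lemma quadratic_le_hexForm (q : ℤ × ℤ) :
    ((q.1 : ℝ) ^ 2 + (q.2 : ℝ) ^ 2) / 2 ≤ hexForm q := by
  simp only [hexForm]
  push_cast
  nlinarith [sq_nonneg ((q.1 : ℝ) + q.2)]

lemma hexForm_nonneg (q : ℤ × ℤ) : (0 : ℝ) ≤ hexForm q :=
  le_trans (by positivity) (quadratic_le_hexForm q)

lemma hexForm_le_quadratic (q : ℤ × ℤ) :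
    (hexForm q : ℝ) ≤ 2 * (1 + (q.1 : ℝ) ^ 2 + (q.2 : ℝ) ^ 2) := by
  simp only [hexForm]
  push_cast
  nlinarith [sq_nonneg ((q.1 : ℝ) - q.2), sq_nonneg (q.1 : ℝ), sq_nonneg (q.2 : ℝ)]

lemma summable_of_abs_le_hexForm {p C : ℝ} (hp : 0 < p) {f : ℤ × ℤ → ℝ}
    (h : ∀ q : ℤ × ℤ, |f q| ≤ C * (1 + (q.1 : ℝ) ^ 2 + (q.2 : ℝ) ^ 2) *
      Real.exp (-p * hexForm q)) : Summable f := by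
  have hs := (summable_quadratic_mul_exp (δ := p / 2) (by positivity)).mul_left |C|
  refine Summable.of_norm_bounded hs fun q => (h q).trans ?_
  have h3 : Real.exp (-p * hexForm q) ≤
      Real.exp (-(p / 2) * ((q.1 : ℝ) ^ 2 + (q.2 : ℝ) ^ 2)) := by
    refine Real.exp_le_exp.2 ?_
    linarith [mul_le_mul_of_nonneg_left (quadratic_le_hexForm q) hp.le]
  calc _ ≤ |C| * (1 + (q.1 : ℝ) ^ 2 + (q.2 : ℝ) ^ 2) *
      Real.exp (-(p / 2) * ((q.1 : ℝ) ^ 2 + (q.2 : ℝ) ^ 2)) := by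
        gcongr
        exact le_abs_self C
    _ = _ := by ring

noncomputable def hexMajorant (q : ℤ × ℤ) : ℝ :=
  Real.exp (127 / 32) * Real.exp (-(3 / 4)) ^ (q.1.natAbs + q.2.natAbs)

lemma exp_hexForm_le (q : ℤ × ℤ) :
    Real.exp (-(9 / 32 * ((hexForm q : ℝ) - 7))) ≤ hexMajorant q := by
  rw [hexMajorant, ← Real.exp_nat_mul, ← Real.exp_add]
  refine Real.exp_le_exp.2 ?_
  have h : (24 * ((q.1.natAbs : ℝ) + q.2.natAbs) : ℝ) ≤ 9 * hexForm q + 64 := by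
    have := (Int.cast_le (R := ℝ)).2 (natAbs_add_le_hexForm q)
    push_cast [Nat.cast_natAbs] at this ⊢
    exact this
  push_cast at h ⊢
  linarith

lemma hasSum_hexMajorant : HasSum hexMajorant (Real.exp (127 / 32) *
    ((1 + Real.exp (-(3 / 4))) / (1 - Real.exp (-(3 / 4)))) ^ 2) :=
  (hasSum_pow_natAbs_add (Real.exp_pos _).le
    (by linarith [exp_neg_three_quarters_bounds.2])).mul_left _


lemma hexMajorant_tail_le :
    Real.exp (127 / 32) * ((1 + Real.exp (-(3 / 4))) / (1 - Real.exp (-(3 / 4)))) ^ 2 -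
      ∑ q ∈ hexCore ∪ (hexShellThree ∪ hexShellFour), hexMajorant q ≤ 142 := by
  obtain ⟨h1, h2⟩ := exp_neg_three_quarters_bounds
  have h3 : Real.exp (127 / 32) ≤ 53 := by
    have e2 := Real.exp_one_lt_d9
    have h : Real.exp (127 / 32) ≤ Real.exp 1 ^ 4 * Real.exp (-(1 / 32)) := by
      rw [← Real.exp_nat_mul, ← Real.exp_add]; norm_num
    have h4 : Real.exp (-(1 / 32)) ≤ 0.97 := by
      have := Real.add_one_le_exp (1 / 32 : ℝ)
      rw [Real.exp_neg]
      exact inv_le_of_inv_le₀ (by norm_num) (le_trans (by norm_num) this)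
    have h5 : Real.exp 1 ^ 4 ≤ 2.7182818286 ^ 4 := by gcongr
    have h6 : Real.exp 1 ^ 4 * Real.exp (-(1 / 32)) ≤ 2.7182818286 ^ 4 * 0.97 := by gcongr
    exact h.trans (h6.trans (by norm_num))
  have hS : hexCore ∪ (hexShellThree ∪ hexShellFour) = {(0, 0), (1, 0), (-1, 0), (0, 1), (0, -1),
      (1, -1), (-1, 1), (1, 1), (-1, -1), (2, -1), (-2, 1), (1, -2), (-1, 2), (2, 0), (-2, 0),
      (0, 2), (0, -2), (2, -2), (-2, 2)} := by decide
  rw [hS]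
  simp only [hexMajorant]
  repeat rw [Finset.sum_insert (by decide)]
  rw [Finset.sum_singleton]
  generalize Real.exp (-(3 / 4)) = ρ at *
  have h0 := Real.exp_pos (127 / 32)
  generalize Real.exp (127 / 32) = X at *
  norm_num
  have h4 : ((1 + ρ) / (1 - ρ)) ^ 2 ≤ 7.82 := by
    have : (1 + ρ) / (1 - ρ) ≤ 2.796 := by rw [div_le_iff₀ (by linarith)]; linarith
    have h5 : 0 ≤ (1 + ρ) / (1 - ρ) := div_nonneg (by linarith) (by linarith)
    calc _ ≤ (2.796 : ℝ) ^ 2 := by gcongr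
      _ ≤ _ := by norm_num
  have h5 : (5.19 : ℝ) ≤ 1 + 4 * ρ + 8 * ρ ^ 2 + 4 * ρ ^ 3 + 2 * ρ ^ 4 := by
    have : 1 + 4 * (0.472 : ℝ) + 8 * 0.472 ^ 2 + 4 * 0.472 ^ 3 + 2 * 0.472 ^ 4 ≤
      1 + 4 * ρ + 8 * ρ ^ 2 + 4 * ρ ^ 3 + 2 * ρ ^ 4 := by gcongr
    norm_num at this ⊢
    linarith
  have h6 := mul_le_mul_of_nonneg_left h4 h0.le
  have h7 := mul_le_mul_of_nonneg_left h5 h0.le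
  linarith

lemma pow_mul_exp_le_of_seven_le {p n : ℝ} {j : ℕ} (hj : j ≤ 2) (hp : 2 ≤ p) (hn : 7 ≤ n) :
    n ^ j * Real.exp (-(p * n)) ≤
      7 ^ j * Real.exp (-(p * 7)) * Real.exp (-(9 / 32 * (n - 7))) := by
  have h1 : n / 7 ≤ Real.exp (n / 7 - 1) := by
    linarith [Real.add_one_le_exp (n / 7 - 1)]
  have h2 : (n / 7) ^ j ≤ Real.exp (j * (n / 7 - 1)) := by
    rw [Real.exp_nat_mul]
    gcongr
  have hj' : (j : ℝ) ≤ 2 := by exact_mod_cast hj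
  have h3 : Real.exp (j * (n / 7 - 1)) ≤ Real.exp ((p - 9 / 32) * (n - 7)) := by
    refine Real.exp_le_exp.2 ?_
    have := mul_le_mul_of_nonneg_right hj' (by linarith : 0 ≤ n / 7 - 1)
    have := mul_le_mul_of_nonneg_right hp (by linarith : 0 ≤ n - 7)
    linarith
  have e : Real.exp (-(p * 7)) * Real.exp (-(9 / 32 * (n - 7))) =
      Real.exp ((p - 9 / 32) * (n - 7)) * Real.exp (-(p * n)) := by
    rw [← Real.exp_add, ← Real.exp_add]; ring_nf
  rw [mul_assoc, e, ← mul_assoc]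
  refine mul_le_mul_of_nonneg_right ?_ (Real.exp_pos _).le
  have h4 := mul_le_mul_of_nonneg_left (h2.trans h3) (by positivity : (0 : ℝ) ≤ 7 ^ j)
  rw [div_pow, mul_div_cancel₀ _ (by positivity)] at h4
  exact h4

/-- Sums over the hexagonal lattice are controlled by their first seven terms. -/
lemma tsum_le_sum_hexCore_add {p D : ℝ} {j : ℕ} (hj : j ≤ 2) (hp : 2 ≤ p) (hD : 0 ≤ D)
    {f : ℤ × ℤ → ℝ} (hf : Summable f) (h : ∀ q, 3 ≤ hexForm q →
      f q ≤ D * ((hexForm q : ℝ) ^ j * Real.exp (-(p * hexForm q)))) :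
    ∑' q, f q ≤ ∑ q ∈ hexCore, f q + D * (6 * (3 ^ j * Real.exp (-(p * 3))) +
      6 * (4 ^ j * Real.exp (-(p * 4))) + 142 * (7 ^ j * Real.exp (-(p * 7)))) := by
  have hg := hasSum_hexMajorant.mul_left (D * (7 ^ j * Real.exp (-(p * 7))))
  have hmain := tsum_le_sum_add_of_le_off hf hg
    (hexCore ∪ (hexShellThree ∪ hexShellFour)) fun q hq => by
      have h7 := seven_le_hexForm hq
      refine (h q (by omega)).trans ?_
      rw [mul_assoc]
      refine mul_le_mul_of_nonneg_left ?_ hD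
      refine (pow_mul_exp_le_of_seven_le hj hp (by exact_mod_cast h7)).trans ?_
      exact mul_le_mul_of_nonneg_left (exp_hexForm_le q) (by positivity)
  rw [← Finset.mul_sum, ← mul_sub] at hmain
  have hK := mul_le_mul_of_nonneg_left hexMajorant_tail_le
    (by positivity : 0 ≤ D * (7 ^ j * Real.exp (-(p * 7))))
  rw [Finset.sum_union (by decide), Finset.sum_union (by decide)] at hmain
  have h3 : ∑ q ∈ hexShellThree, f q ≤ 6 * (D * (3 ^ j * Real.exp (-(p * 3)))) := by
    have := Finset.sum_le_card_nsmul hexShellThree f (D * (3 ^ j * Real.exp (-(p * 3))))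
      fun q hq => by
        have e : hexForm q = 3 := by revert q; decide
        have := h q e.ge
        rw [e] at this
        exact_mod_cast this
    rw [show hexShellThree.card = 6 by decide] at this
    simpa using this
  have h4 : ∑ q ∈ hexShellFour, f q ≤ 6 * (D * (4 ^ j * Real.exp (-(p * 4)))) := by
    have := Finset.sum_le_card_nsmul hexShellFour f (D * (4 ^ j * Real.exp (-(p * 4))))
      fun q hq => by
        have e : hexForm q = 4 := by revert q; decide
        have := h q (by omega)
        rw [e] at this
        exact_mod_cast this
    rw [show hexShellFour.card = 6 by decide] at this
    simpa using this
  linarith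

/-- With `ω = y ^ 2 - 3 / 4` and `β = shiftHeight y`, the termwise derivative in `y`, up to the
factor `π / y ^ 2`, of the charged theta function on the line `x = 1/2`. -/
noncomputable def dualTerm (s y ω β : ℝ) (q : ℤ × ℤ) : ℝ :=
  Real.exp (-(Real.pi * s / y * (hexForm q + (q.2 : ℝ) ^ 2 * ω))) *
    (s * (hexForm q - (q.2 : ℝ) ^ 2 * (3 / 2 + ω)) *
        Real.cos (2 * Real.pi * β * (q.1 + 1 / 2 * q.2) - q.2 * Real.pi) -
      (2 * q.1 + q.2) / (4 * y) *
        Real.sin (2 * Real.pi * β * (q.1 + 1 / 2 * q.2) - q.2 * Real.pi))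

lemma hasDerivAt_shiftHeight {y : ℝ} (hy : 0 < y) :
    HasDerivAt shiftHeight (1 / (4 * y ^ 3)) y := by
  have h := ((((hasDerivAt_pow 2 y).const_mul 8).fun_inv (by positivity)).const_sub (1 / 2 : ℝ))
  have e : shiftHeight = fun y : ℝ => 1 / 2 - (8 * y ^ 2)⁻¹ := by
    funext z; rw [shiftHeight, one_div (8 * z ^ 2)]
  rw [e]
  refine h.congr_deriv ?_
  push_cast
  field_simp
  norm_num

lemma hasDerivAt_latticeThetaHat_half {s y : ℝ} (hs : 0 < s) (hy : 1 / 2 < y) :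
    Summable (dualTerm s y (y ^ 2 - 3 / 4) (shiftHeight y)) ∧
    HasDerivAt (fun y => latticeThetaHat (1 / 2) y (bPoint (1 / 2) y) s)
      (Real.pi / y ^ 2 * ∑' q, dualTerm s y (y ^ 2 - 3 / 4) (shiftHeight y) q) y := by
  have hpi := Real.pi_pos
  have hy0 : 0 < y := by linarith
  have hym : y ∈ Set.Ioo (1 / 2 : ℝ) (y + 1) := ⟨hy, by linarith⟩
  have key := hasDerivAt_tsum_exp_mul_cos (c := Real.pi * s) (δ := 1 / (8 * (y + 1))) (C := 20)
    (C' := 0) (A := 1 / 2) (M := y + 1)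
    (E := fun q y => ((q.1 : ℝ) + 1 / 2 * q.2) ^ 2 / y + (q.2 : ℝ) ^ 2 * y)
    (E' := fun q y => -(((q.1 : ℝ) + 1 / 2 * q.2) ^ 2) / y ^ 2 + (q.2 : ℝ) ^ 2)
    (ψ := fun q y => 2 * Real.pi * shiftHeight y * (q.1 + 1 / 2 * q.2) - q.2 * Real.pi)
    (ψ' := fun q y => 2 * Real.pi * (1 / (4 * y ^ 3)) * (q.1 + 1 / 2 * q.2))
    (by positivity) (by positivity)
    (fun q z hz => by
      have hz0 : 0 < z := by linarith [hz.1]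
      have h := ((hasDerivAt_inv hz0.ne').const_mul (((q.1 : ℝ) + 1 / 2 * q.2) ^ 2)).add
        ((hasDerivAt_id z).const_mul ((q.2 : ℝ) ^ 2))
      exact h.congr_deriv (by ring))
    (fun q z hz => by
      have hz0 : 0 < z := by linarith [hz.1]
      exact ((((hasDerivAt_shiftHeight hz0).const_mul (2 * Real.pi)).mul_const _).sub_const _))
    (fun q z hz => by
      have hz0 : 0 < z := by linarith [hz.1]
      have hi : 1 / z ≤ 2 := by rw [div_le_iff₀ hz0]; linarith [hz.1]
      have i2 : (1 / z) ^ 2 ≤ 2 ^ 2 := by gcongr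
      have j2 : 0 ≤ (1 / z) ^ 2 := by positivity
      have e1 : -(((q.1 : ℝ) + 1 / 2 * q.2) ^ 2) / z ^ 2 =
        -(((q.1 : ℝ) + 1 / 2 * q.2) ^ 2 * (1 / z) ^ 2) := by ring
      have hn := sq_nonneg ((q.1 : ℝ) + 1 / 2 * q.2)
      have m1 := mul_le_mul_of_nonneg_left i2 hn
      have m3 := mul_nonneg hn j2
      have hq := sq_nonneg ((q.1 : ℝ) - 1 / 2 * q.2)
      have h1 := sq_nonneg (q.1 : ℝ)
      have h2 := sq_nonneg (q.2 : ℝ)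
      rw [e1, abs_le]
      constructor <;> linarith)
    (fun q z hz => by
      have hz0 : 0 < z := by linarith [hz.1]
      have hi : 1 / z ≤ 2 := by rw [div_le_iff₀ hz0]; linarith [hz.1]
      have i3 : (1 / z) ^ 3 ≤ 2 ^ 3 := by gcongr
      have e1 : 2 * Real.pi * (1 / (4 * z ^ 3)) = Real.pi / 2 * (1 / z) ^ 3 := by ring
      have hc : 2 * Real.pi * (1 / (4 * z ^ 3)) ≤ 13 := by
        rw [e1]
        have := mul_le_mul_of_nonneg_left i3 (by positivity : 0 ≤ Real.pi / 2)
        linarith [Real.pi_lt_d2]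
      have hc0 : 0 ≤ 2 * Real.pi * (1 / (4 * z ^ 3)) := by positivity
      have hκ : |(q.1 : ℝ) + 1 / 2 * q.2| ≤ 1 + (q.1 : ℝ) ^ 2 + (q.2 : ℝ) ^ 2 := by
        rw [abs_le]
        constructor <;>
        linarith [sq_nonneg ((q.1 : ℝ) - 1 / 2), sq_nonneg ((q.1 : ℝ) + 1 / 2),
          sq_nonneg ((q.2 : ℝ) - 1 / 2), sq_nonneg ((q.2 : ℝ) + 1 / 2)]
      rw [abs_mul, abs_of_nonneg hc0]
      gcongr
      linarith)
    (fun q z hz => by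
      have hz0 : 0 < z := by linarith [hz.1]
      have e : ((q.1 : ℝ) + 1 / 2 * q.2) ^ 2 / z + (q.2 : ℝ) ^ 2 * z =
          (((q.1 : ℝ) + 1 / 2 * q.2) ^ 2 + (q.2 : ℝ) ^ 2 * z ^ 2) / z := by field_simp
      have h4 : 1 / 4 ≤ z ^ 2 := by nlinarith [hz.1]
      have h5 := mul_le_mul_of_nonneg_left h4 (sq_nonneg (q.2 : ℝ))
      have h6 : 1 / 8 * ((q.1 : ℝ) ^ 2 + (q.2 : ℝ) ^ 2) ≤
          ((q.1 : ℝ) + 1 / 2 * q.2) ^ 2 + (q.2 : ℝ) ^ 2 * z ^ 2 := by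
        nlinarith [sq_nonneg (7 * (q.1 : ℝ) + 4 * q.2)]
      rw [e, sub_zero, le_div_iff₀ hz0]
      have h7 : 1 / (8 * (y + 1)) * z ≤ 1 / 8 := by
        rw [div_mul_eq_mul_div, div_le_iff₀ (by positivity)]
        linarith [hz.2]
      have h8 := mul_le_mul_of_nonneg_right h7
        (by positivity : 0 ≤ (q.1 : ℝ) ^ 2 + (q.2 : ℝ) ^ 2)
      linarith)
  obtain ⟨hsum, hder⟩ := key y hym
  have hterm : ∀ q : ℤ × ℤ, Real.exp (-(Real.pi * s) * (((q.1 : ℝ) + 1 / 2 * q.2) ^ 2 / y +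
      (q.2 : ℝ) ^ 2 * y)) * (-(Real.pi * s) * (-(((q.1 : ℝ) + 1 / 2 * q.2) ^ 2) / y ^ 2 +
        (q.2 : ℝ) ^ 2) * Real.cos (2 * Real.pi * shiftHeight y * (q.1 + 1 / 2 * q.2) -
          q.2 * Real.pi) - 2 * Real.pi * (1 / (4 * y ^ 3)) * (q.1 + 1 / 2 * q.2) *
        Real.sin (2 * Real.pi * shiftHeight y * (q.1 + 1 / 2 * q.2) - q.2 * Real.pi)) =
      Real.pi / y ^ 2 * dualTerm s y (y ^ 2 - 3 / 4) (shiftHeight y) q := by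
    intro q
    have e : -(Real.pi * s) * (((q.1 : ℝ) + 1 / 2 * q.2) ^ 2 / y + (q.2 : ℝ) ^ 2 * y) =
      -(Real.pi * s / y * (hexForm q + (q.2 : ℝ) ^ 2 * (y ^ 2 - 3 / 4))) := by
      simp only [hexForm]
      push_cast
      field_simp
      ring
    rw [e, dualTerm]
    generalize Real.exp _ = X
    generalize Real.cos _ = u
    generalize Real.sin _ = v
    simp only [hexForm]
    push_cast
    field_simp
    ring
  constructor
  · refine (summable_mul_left_iff (by positivity : Real.pi / y ^ 2 ≠ 0)).1 ?_
    exact hsum.congr fun q => hterm q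
  · rw [tsum_congr hterm, tsum_mul_left] at hder
    refine hder.congr_of_eventuallyEq ?_
    filter_upwards [isOpen_Ioo.mem_nhds hym] with z hz
    have hz0 : 0 < z := by linarith [hz.1]
    rw [latticeThetaHat_bPoint hz0]
    refine tsum_congr fun q => ?_
    congr 2
    field_simp

lemma dualTerm_neg (s y ω β : ℝ) (q : ℤ × ℤ) : dualTerm s y ω β (-q) = dualTerm s y ω β q := by
  have e : 2 * Real.pi * β * (((-q).1 : ℝ) + 1 / 2 * ((-q).2 : ℝ)) -
      ((-q).2 : ℝ) * Real.pi =
      -(2 * Real.pi * β * (q.1 + 1 / 2 * q.2) - q.2 * Real.pi) := by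
    simp only [Prod.fst_neg, Prod.snd_neg]; push_cast; ring
  have e2 : hexForm (-q) = hexForm q := by
    simp only [hexForm, Prod.fst_neg, Prod.snd_neg]; ring
  rw [dualTerm, dualTerm, e, e2, Real.cos_neg, Real.sin_neg]
  simp only [Prod.fst_neg, Prod.snd_neg]
  push_cast
  ring_nf

lemma sum_hexCore_dualTerm (s y ω β : ℝ) : ∑ q ∈ hexCore, dualTerm s y ω β q =
    2 * Real.exp (-(Real.pi * s / y)) *
      (s * (2 * Real.cos (Real.pi * β) ^ 2 - 1) -
        Real.cos (Real.pi * β) * Real.sin (Real.pi * β) / y +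
        Real.exp (-(Real.pi * s / y * ω)) *
          (s * (1 + 2 * ω) * Real.cos (Real.pi * β) +
            Real.sin (Real.pi * β) / (2 * y))) := by
  have h0 : dualTerm s y ω β (0, 0) = 0 := by simp [dualTerm, hexForm]
  have h1 : dualTerm s y ω β (1, 0) = Real.exp (-(Real.pi * s / y)) *
      (s * (2 * Real.cos (Real.pi * β) ^ 2 - 1) -
        Real.cos (Real.pi * β) * Real.sin (Real.pi * β) / y) := by
    have e : 2 * Real.pi * β * (((1 : ℤ) : ℝ) + 1 / 2 * ((0 : ℤ) : ℝ)) -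
      ((0 : ℤ) : ℝ) * Real.pi = 2 * (Real.pi * β) := by push_cast; ring
    simp only [dualTerm, hexForm]
    rw [e, Real.cos_two_mul, Real.sin_two_mul]
    push_cast
    ring_nf
  have hexp : Real.exp (-(Real.pi * s / y * (1 + ω))) =
      Real.exp (-(Real.pi * s / y)) * Real.exp (-(Real.pi * s / y * ω)) := by
    rw [← Real.exp_add]; ring_nf
  have h2 : dualTerm s y ω β (0, 1) = Real.exp (-(Real.pi * s / y)) *
      (Real.exp (-(Real.pi * s / y * ω)) *
        (s * (1 / 2 + ω) * Real.cos (Real.pi * β) +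
          Real.sin (Real.pi * β) / (4 * y))) := by
    have e : 2 * Real.pi * β * (((0 : ℤ) : ℝ) + 1 / 2 * ((1 : ℤ) : ℝ)) -
      ((1 : ℤ) : ℝ) * Real.pi = Real.pi * β - Real.pi := by push_cast; ring
    simp only [dualTerm, hexForm]
    rw [e, Real.cos_sub_pi, Real.sin_sub_pi, ← mul_assoc, ← hexp]
    push_cast
    ring_nf
  have h3 : dualTerm s y ω β (1, -1) = Real.exp (-(Real.pi * s / y)) *
      (Real.exp (-(Real.pi * s / y * ω)) *
        (s * (1 / 2 + ω) * Real.cos (Real.pi * β) +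
          Real.sin (Real.pi * β) / (4 * y))) := by
    have e : 2 * Real.pi * β * (((1 : ℤ) : ℝ) + 1 / 2 * ((-1 : ℤ) : ℝ)) -
      ((-1 : ℤ) : ℝ) * Real.pi = Real.pi * β + Real.pi := by push_cast; ring
    simp only [dualTerm, hexForm]
    rw [e, Real.cos_add_pi, Real.sin_add_pi, ← mul_assoc, ← hexp]
    push_cast
    ring_nf
  have n1 := dualTerm_neg s y ω β (1, 0)
  have n2 := dualTerm_neg s y ω β (0, 1)
  have n3 := dualTerm_neg s y ω β (1, -1)
  simp only [Prod.neg_mk, neg_zero, neg_neg] at n1 n2 n3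
  rw [hexCore]
  repeat rw [Finset.sum_insert (by decide)]
  rw [Finset.sum_singleton, n1, n2, n3, h0, h1, h2, h3]
  ring

lemma sqrt_three_mul_le_one_sub_two_cos {t : ℝ} (h0 : 0 ≤ t) (h1 : t ≤ Real.pi / 6) :
    √3 * t ≤ 1 - 2 * Real.cos (Real.pi / 3 + t) := by
  rcases h0.eq_or_lt with rfl | h0
  · simp
  have hpi := Real.pi_lt_d2
  have h3 : √3 ≤ 1.74 := by rw [Real.sqrt_le_left (by norm_num)]; norm_num
  have ht1 : t ≤ 0.53 := by linarith
  have hs := (Real.sin_gt_sub_cube h0).le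
  have hc := Real.cos_le_one t
  have hsc := Real.sin_sq_add_cos_sq t
  have ht2 : t ^ 2 ≤ 0.281 := by nlinarith
  have hp : 0 ≤ t - t ^ 3 / 6 := by
    rw [show t - t ^ 3 / 6 = t * (1 - t ^ 2 / 6) by ring]
    exact mul_nonneg h0.le (by linarith)
  have h4 : (t - t ^ 3 / 6) ^ 2 ≤ Real.sin t ^ 2 := by gcongr
  have h5 : Real.sin t ^ 2 / 2 ≤ 1 - Real.cos t := by nlinarith [sq_nonneg (1 - Real.cos t)]
  have h6 : √3 * (t - t ^ 3 / 6) ≤ √3 * Real.sin t := by gcongr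
  have h7 : 0.86 * t ^ 2 ≤ (t - t ^ 3 / 6) ^ 2 := by
    have e : (t - t ^ 3 / 6) ^ 2 = t ^ 2 * (1 - t ^ 2 / 6) ^ 2 := by ring
    have : 0.86 ≤ (1 - t ^ 2 / 6) ^ 2 := by nlinarith
    rw [e]
    nlinarith [sq_nonneg t]
  have h8 : √3 * t ^ 3 ≤ 1.74 * (0.53 * t ^ 2) := by
    have : t ^ 3 ≤ 0.53 * t ^ 2 := by nlinarith [sq_nonneg t]
    gcongr
  rw [Real.cos_add, Real.cos_pi_div_three, Real.sin_pi_div_three]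
  linarith [sq_nonneg t]

lemma sum_hexCore_dualTerm_le {s y : ℝ} (hy : √3 / 2 ≤ y) (hs : 1 ≤ s)
    (hp : 2 ≤ Real.pi * s / y) : ∑ q ∈ hexCore, dualTerm s y (y ^ 2 - 3 / 4) (shiftHeight y) q ≤
      -(10.88 * (shiftHeight y - 1 / 3) * s * (1 - 1 / (2 * y)) *
        Real.exp (-(Real.pi * s / y))) := by
  have h3 : √3 ^ 2 = 3 := Real.sq_sqrt (by norm_num)
  have h3p : 0 < √3 := by positivity
  have h3l : 1.732 ≤ √3 := Real.le_sqrt_of_sq_le (by norm_num)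
  have hy0 : 0 < y := by linarith
  have hyl : 0.866 ≤ y := by linarith
  have hy2 : 3 / 4 ≤ y ^ 2 := by nlinarith
  obtain ⟨hβ1, hβ2⟩ := shiftHeight_bounds hy0 hy2
  have hpi := Real.pi_gt_d4
  have hpi0 := Real.pi_pos
  rw [sum_hexCore_dualTerm]
  set β := shiftHeight y
  have hcos : 5.44 * (β - 1 / 3) ≤ 1 - 2 * Real.cos (Real.pi * β) := by
    have h := sqrt_three_mul_le_one_sub_two_cos (t := Real.pi * (β - 1 / 3))
      (mul_nonneg hpi0.le (by linarith)) (by nlinarith)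
    rw [show Real.pi / 3 + Real.pi * (β - 1 / 3) = Real.pi * β by ring] at h
    refine le_trans ?_ h
    rw [← mul_assoc]
    refine mul_le_mul_of_nonneg_right ?_ (by linarith)
    nlinarith
  have hc0 : 0 ≤ Real.cos (Real.pi * β) :=
    Real.cos_nonneg_of_mem_Icc ⟨by nlinarith, by nlinarith⟩
  have ht0 : 0 ≤ Real.sin (Real.pi * β) :=
    Real.sin_nonneg_of_nonneg_of_le_pi (by nlinarith) (by nlinarith)
  have ht1 := Real.sin_le_one (Real.pi * β)
  generalize Real.cos (Real.pi * β) = c at *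
  generalize Real.sin (Real.pi * β) = t at *
  have hω : 0 ≤ y ^ 2 - 3 / 4 := by linarith
  have hE1 : Real.exp (-(Real.pi * s / y * (y ^ 2 - 3 / 4))) * (1 + 2 * (y ^ 2 - 3 / 4)) ≤ 1 := by
    have h1 := Real.add_one_le_exp (Real.pi * s / y * (y ^ 2 - 3 / 4))
    have h2 := mul_le_mul_of_nonneg_right hp hω
    rw [Real.exp_neg, inv_mul_le_iff₀ (Real.exp_pos _)]
    linarith
  have hE2 : Real.exp (-(Real.pi * s / y * (y ^ 2 - 3 / 4))) ≤ 1 :=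
    Real.exp_le_one_iff.2 (neg_nonpos.2 (mul_nonneg (by positivity) hω))
  generalize Real.exp (-(Real.pi * s / y * (y ^ 2 - 3 / 4))) = E at *
  have hX := Real.exp_pos (-(Real.pi * s / y))
  generalize Real.exp (-(Real.pi * s / y)) = X at *
  have hi : 0 < 1 / (2 * y) := by positivity
  have hi1 : 1 / (2 * y) ≤ 0.58 := by rw [div_le_iff₀ (by positivity)]; linarith
  have e1 : c * t / y = 2 * (c * t) * (1 / (2 * y)) := by field_simp
  have e2 : t / (2 * y) = t * (1 / (2 * y)) := by ring
  rw [e1, e2]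
  generalize 1 / (2 * y) = v at *
  have hsc : 0 ≤ s * c := by positivity
  have htv : 0 ≤ t * v := by positivity
  have k1 := mul_le_mul_of_nonneg_right hE1 hsc
  have k2 := mul_le_mul_of_nonneg_right hE2 htv
  have k3 : s * (2 * c ^ 2 - 1) - 2 * (c * t) * v +
      E * (s * (1 + 2 * (y ^ 2 - 3 / 4)) * c + t * v) ≤
      -((1 - 2 * c) * (s * (1 + c) - t * v)) := by linarith
  have k4 : s * (1 - v) ≤ s * (1 + c) - t * v := by
    have : t * v ≤ s * v := by gcongr; linarith
    linarith
  have k5 : 0 ≤ s * (1 - v) := mul_nonneg (by linarith) (by linarith)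
  have k6 : 5.44 * (β - 1 / 3) * (s * (1 - v)) ≤ (1 - 2 * c) * (s * (1 + c) - t * v) := by
    have : 0 ≤ 5.44 * (β - 1 / 3) := mul_nonneg (by norm_num) (by linarith)
    gcongr
    linarith
  have k7 := mul_le_mul_of_nonneg_left (k3.trans (neg_le_neg k6)) (by linarith : 0 ≤ 2 * X)
  linarith

lemma three_mul_sq_le_hexForm (q : ℤ × ℤ) : 3 * (q.2 : ℝ) ^ 2 ≤ 4 * hexForm q := by
  simp only [hexForm]
  push_cast
  nlinarith [sq_nonneg (2 * (q.1 : ℝ) + q.2)]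

lemma abs_two_mul_add_le {q : ℤ × ℤ} (hq : 3 ≤ hexForm q) {a : ℝ} (ha : 0 ≤ a)
    (ha2 : 4 / 3 ≤ a ^ 2) : |2 * (q.1 : ℝ) + q.2| ≤ a * hexForm q := by
  have hN : (3 : ℝ) ≤ hexForm q := by exact_mod_cast hq
  refine abs_le_of_sq_le_sq ?_ (mul_nonneg ha (by linarith))
  have e : (2 * (q.1 : ℝ) + q.2) ^ 2 = 4 * hexForm q - 3 * (q.2 : ℝ) ^ 2 := by
    simp only [hexForm]; push_cast; ring
  have h1 : 4 / 3 * (hexForm q : ℝ) ^ 2 ≤ a ^ 2 * (hexForm q : ℝ) ^ 2 := by gcongr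
  rw [e, mul_pow]
  nlinarith [sq_nonneg (q.2 : ℝ)]

lemma dualTerm_le_mul_exp {s y : ℝ} (hy0 : 0 < y) (hy : 3 / 4 ≤ y ^ 2) (hs : 1 ≤ s)
    (hp : 1 ≤ Real.pi * s / y) (q : ℤ × ℤ) (hq : 3 ≤ hexForm q) :
    dualTerm s y (y ^ 2 - 3 / 4) (shiftHeight y) q ≤
      4 / 3 * s * ((hexForm q : ℝ) ^ 1 * Real.exp (-(Real.pi * s / y * hexForm q))) := by
  have hN : (3 : ℝ) ≤ hexForm q := by exact_mod_cast hq
  have hl := three_mul_sq_le_hexForm q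
  have hn := abs_two_mul_add_le hq (a := 4 / 3 * y) (by positivity) (by nlinarith)
  have hl0 := sq_nonneg (q.2 : ℝ)
  have hω : 0 ≤ y ^ 2 - 3 / 4 := by linarith
  have hlω := mul_nonneg hl0 hω
  rw [dualTerm]
  set N : ℝ := (hexForm q : ℝ)
  set p := Real.pi * s / y
  have h1 : s * (N - (q.2 : ℝ) ^ 2 * (3 / 2 + (y ^ 2 - 3 / 4))) *
      Real.cos (2 * Real.pi * shiftHeight y * (q.1 + 1 / 2 * q.2) - q.2 * Real.pi) ≤
      s * (N + (q.2 : ℝ) ^ 2 * (y ^ 2 - 3 / 4)) := by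
    rw [mul_assoc]
    refine mul_le_mul_of_nonneg_left ?_ (by linarith)
    refine (le_abs_self _).trans ?_
    rw [abs_mul]
    have : |N - (q.2 : ℝ) ^ 2 * (3 / 2 + (y ^ 2 - 3 / 4))| ≤
        N + (q.2 : ℝ) ^ 2 * (y ^ 2 - 3 / 4) := by
      rw [abs_le]; constructor <;> linarith
    exact (mul_le_of_le_one_right (abs_nonneg _) (Real.abs_cos_le_one _)).trans this
  have h2 : -((2 * q.1 + q.2) / (4 * y) *
      Real.sin (2 * Real.pi * shiftHeight y * (q.1 + 1 / 2 * q.2) - q.2 * Real.pi)) ≤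
      1 / 3 * N := by
    refine (neg_le_abs _).trans ?_
    rw [abs_mul, abs_div, abs_of_pos (by positivity : 0 < 4 * y)]
    refine (mul_le_of_le_one_right (by positivity) (Real.abs_sin_le_one _)).trans ?_
    rw [div_le_iff₀ (by positivity)]
    linarith
  have h3 : N ≤ s * (N + (q.2 : ℝ) ^ 2 * (y ^ 2 - 3 / 4)) := by
    have := mul_le_mul_of_nonneg_right hs (by linarith : 0 ≤ N + (q.2 : ℝ) ^ 2 * (y ^ 2 - 3 / 4))
    linarith
  have hX := Real.exp_pos (-(p * (N + (q.2 : ℝ) ^ 2 * (y ^ 2 - 3 / 4))))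
  have h4 : (N + (q.2 : ℝ) ^ 2 * (y ^ 2 - 3 / 4)) *
      Real.exp (-(p * (N + (q.2 : ℝ) ^ 2 * (y ^ 2 - 3 / 4)))) ≤ N * Real.exp (-(p * N)) := by
    have e : Real.exp (-(p * N)) = Real.exp (p * ((q.2 : ℝ) ^ 2 * (y ^ 2 - 3 / 4))) *
        Real.exp (-(p * (N + (q.2 : ℝ) ^ 2 * (y ^ 2 - 3 / 4)))) := by
      rw [← Real.exp_add]; ring_nf
    rw [e, ← mul_assoc]
    refine mul_le_mul_of_nonneg_right ?_ hX.le
    have h5 := Real.add_one_le_exp (p * ((q.2 : ℝ) ^ 2 * (y ^ 2 - 3 / 4)))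
    have h6 := mul_le_mul_of_nonneg_right hp hlω
    have h7 := mul_le_mul_of_nonneg_left (by linarith :
      1 + (q.2 : ℝ) ^ 2 * (y ^ 2 - 3 / 4) ≤ Real.exp (p * ((q.2 : ℝ) ^ 2 * (y ^ 2 - 3 / 4))))
      (by linarith : 0 ≤ N)
    have h8 := mul_le_mul_of_nonneg_right (by linarith : 1 ≤ N) hlω
    linarith
  calc _ ≤ Real.exp (-(p * (N + (q.2 : ℝ) ^ 2 * (y ^ 2 - 3 / 4)))) *
        (4 / 3 * s * (N + (q.2 : ℝ) ^ 2 * (y ^ 2 - 3 / 4))) :=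
        mul_le_mul_of_nonneg_left (by linarith) hX.le
    _ = 4 / 3 * s * ((N + (q.2 : ℝ) ^ 2 * (y ^ 2 - 3 / 4)) *
        Real.exp (-(p * (N + (q.2 : ℝ) ^ 2 * (y ^ 2 - 3 / 4))))) := by ring
    _ ≤ _ := by rw [pow_one]; gcongr

lemma tsum_dualTerm_neg_of_one_le {s y : ℝ} (hy : 1 ≤ y) (hs : 1 ≤ s) (hys : y ≤ 1.5 * s) :
    ∑' q, dualTerm s y (y ^ 2 - 3 / 4) (shiftHeight y) q < 0 := by
  have hy0 : 0 < y := by linarith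
  have hpi := Real.pi_gt_d4
  have h3u : √3 ≤ 1.74 := by rw [Real.sqrt_le_left (by norm_num)]; norm_num
  have hp : 2.09 ≤ Real.pi * s / y := by
    rw [le_div_iff₀ hy0]; nlinarith
  have hcore := sum_hexCore_dualTerm_le (by linarith : √3 / 2 ≤ y) hs (by linarith)
  have htail := tsum_le_sum_hexCore_add (p := Real.pi * s / y) (D := 4 / 3 * s) (j := 1)
    (by norm_num) (by linarith) (by linarith) (hasDerivAt_latticeThetaHat_half (by linarith)
      (by linarith)).1 (dualTerm_le_mul_exp hy0 (by nlinarith) hs (by linarith))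
  have e : shiftHeight y - 1 / 3 = 1 / 6 - 1 / 8 * (1 / y) ^ 2 := by
    rw [shiftHeight]; field_simp; ring
  have e' : 1 / (2 * y) = 1 / 2 * (1 / y) := by field_simp
  rw [e, e'] at hcore
  have hw0 : 0 < 1 / y := by positivity
  have hE : ∀ n : ℕ, Real.exp (-(Real.pi * s / y * n)) = Real.exp (-(Real.pi * s / y)) ^ n :=
    fun n => by rw [← Real.exp_nat_mul]; ring_nf
  have hE3 := hE 3
  have hE4 := hE 4
  have hE7 := hE 7
  push_cast at hE3 hE4 hE7
  rw [hE3, hE4, hE7] at htail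
  have hX := Real.exp_pos (-(Real.pi * s / y))
  have hexp : ∀ a b : ℝ, 0 ≤ b → a ≤ Real.pi * s / y → 2 + b = a →
      Real.exp (-(Real.pi * s / y)) * (7.38 * (1 + b + b ^ 2 / 2)) ≤ 1 := by
    intro a b hb hab habb
    have h1 : Real.exp 2 * Real.exp b ≤ Real.exp (Real.pi * s / y) := by
      rw [← Real.exp_add]; exact Real.exp_le_exp.2 (by linarith)
    have h2 := Real.quadratic_le_exp_of_nonneg hb
    have h3 : 7.38 ≤ Real.exp 2 := by
      have h4 : Real.exp 2 = Real.exp 1 ^ 2 := by rw [← Real.exp_nat_mul]; norm_num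
      rw [h4]
      have := Real.exp_one_gt_d9
      calc (7.38 : ℝ) ≤ 2.7182818283 ^ 2 := by norm_num
        _ ≤ _ := by gcongr
    rw [Real.exp_neg, inv_mul_le_iff₀ (Real.exp_pos _), mul_one]
    refine le_trans ?_ h1
    gcongr
  have hfin : 4 / 3 * (18 * Real.exp (-(Real.pi * s / y)) ^ 2 +
      24 * Real.exp (-(Real.pi * s / y)) ^ 3 + 994 * Real.exp (-(Real.pi * s / y)) ^ 6) <
      10.88 * (1 / 6 - 1 / 8 * (1 / y) ^ 2) * (1 - 1 / 2 * (1 / y)) := by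
    rcases le_or_gt y 1.2 with h | h
    · have hp' : 2.5 ≤ Real.pi * s / y := by
        rw [le_div_iff₀ hy0]; nlinarith
      have h1 := hexp 2.5 0.5 (by norm_num) hp' (by norm_num)
      have hw : 1 / y ≤ 1 := by rw [div_le_iff₀ hy0]; linarith
      generalize Real.exp (-(Real.pi * s / y)) = X at *
      generalize 1 / y = w at *
      have hX1 : X ≤ 0.0835 := by linarith
      calc _ ≤ 4 / 3 * (18 * 0.0835 ^ 2 + 24 * 0.0835 ^ 3 + 994 * 0.0835 ^ 6 : ℝ) := by gcongr
        _ < 10.88 * (1 / 6 - 1 / 8 * 1 ^ 2) * (1 - 1 / 2 * 1) := by norm_num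
        _ ≤ _ := by
          have : w ^ 2 ≤ 1 := pow_le_one₀ hw0.le hw
          gcongr
          linarith
    · have h1 := hexp 2.09 0.09 (by norm_num) hp (by norm_num)
      have hw : 1 / y ≤ 0.8334 := by rw [div_le_iff₀ hy0]; linarith
      generalize Real.exp (-(Real.pi * s / y)) = X at *
      generalize 1 / y = w at *
      have hX1 : X ≤ 0.1242 := by linarith
      calc _ ≤ 4 / 3 * (18 * 0.1242 ^ 2 + 24 * 0.1242 ^ 3 + 994 * 0.1242 ^ 6 : ℝ) := by gcongr
        _ < 10.88 * (1 / 6 - 1 / 8 * 0.8334 ^ 2) * (1 - 1 / 2 * 0.8334) := by norm_num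
        _ ≤ _ := by
          have : w ^ 2 ≤ 0.8334 ^ 2 := pow_le_pow_left₀ hw0.le hw 2
          gcongr
          linarith
  have hfin2 := mul_lt_mul_of_pos_left hfin (by positivity :
    0 < s * Real.exp (-(Real.pi * s / y)))
  linarith

lemma tsum_eq_zero_of_threefold {ι : Type*} {f : ι → ℝ} (hf : Summable f) (σ : ι ≃ ι)
    (h : ∀ i, f i + f (σ i) + f (σ (σ i)) = 0) : ∑' i, f i = 0 := by
  have h1 := σ.summable_iff.2 hf
  have h2 := σ.summable_iff.2 h1
  have e1 := σ.tsum_eq f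
  have e2 := σ.tsum_eq (f ∘ σ)
  have h3 := (hf.add h1).tsum_add h2
  rw [hf.tsum_add h1] at h3
  simp only [Function.comp_def] at *
  rw [tsum_congr h, tsum_zero] at h3
  linarith

lemma abs_dualTerm_hexagonal_le {s y : ℝ} (hs : 0 ≤ s) (hy : 1 / 2 ≤ y) (q : ℤ × ℤ) :
    |dualTerm s y 0 (1 / 3) q| ≤ (4 * s + 2) * (1 + (q.1 : ℝ) ^ 2 + (q.2 : ℝ) ^ 2) *
      Real.exp (-(Real.pi * s / y) * hexForm q) := by
  rw [dualTerm, abs_mul, Real.abs_exp, mul_comm]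
  simp only [mul_zero, add_zero, neg_mul]
  refine mul_le_mul_of_nonneg_right ?_ (Real.exp_pos _).le
  have hl := three_mul_sq_le_hexForm q
  have hN := hexForm_nonneg q
  have hN2 := hexForm_le_quadratic q
  have hM : |(hexForm q : ℝ) - (q.2 : ℝ) ^ 2 * (3 / 2)| ≤ (hexForm q : ℝ) := by
    rw [abs_le]; constructor <;> linarith [sq_nonneg (q.2 : ℝ)]
  have hn : |(2 * (q.1 : ℝ) + q.2) / (4 * y)| ≤ 2 * (1 + (q.1 : ℝ) ^ 2 + (q.2 : ℝ) ^ 2) := by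
    have hy0 : 0 < 4 * y := by linarith
    rw [abs_div, abs_of_pos hy0, div_le_iff₀ hy0]
    have h1 : |2 * (q.1 : ℝ) + q.2| ≤ 2 * (1 + (q.1 : ℝ) ^ 2 + (q.2 : ℝ) ^ 2) := by
      rw [abs_le]
      constructor <;> linarith [sq_nonneg ((q.1 : ℝ) - 1), sq_nonneg ((q.1 : ℝ) + 1),
        sq_nonneg ((q.2 : ℝ) - 1), sq_nonneg ((q.2 : ℝ) + 1), sq_nonneg (q.1 : ℝ),
        sq_nonneg (q.2 : ℝ)]
    refine h1.trans (le_mul_of_one_le_right (by positivity) (by linarith))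
  refine (abs_sub _ _).trans ?_
  rw [abs_mul, abs_mul, abs_mul, abs_of_nonneg hs]
  have h1 := (mul_le_of_le_one_right (mul_nonneg hs (abs_nonneg _)) (Real.abs_cos_le_one
    (2 * Real.pi * (1 / 3) * (q.1 + 1 / 2 * q.2) - q.2 * Real.pi))).trans
    (mul_le_mul_of_nonneg_left hM hs)
  have h2 := (mul_le_of_le_one_right (abs_nonneg _) (Real.abs_sin_le_one
    (2 * Real.pi * (1 / 3) * (q.1 + 1 / 2 * q.2) - q.2 * Real.pi))).trans hn
  have h3 := mul_le_mul_of_nonneg_left hN2 hs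
  have h4 : 0 ≤ s * (1 + (q.1 : ℝ) ^ 2 + (q.2 : ℝ) ^ 2) := by positivity
  linarith

lemma summable_dualTerm_hexagonal {s y : ℝ} (hs : 0 < s) (hy : 1 / 2 ≤ y) :
    Summable (dualTerm s y 0 (1 / 3)) :=
  summable_of_abs_le_hexForm (p := Real.pi * s / y)
    (div_pos (mul_pos Real.pi_pos hs) (by linarith)) (abs_dualTerm_hexagonal_le hs.le hy)

/-- The three-fold symmetry of the hexagonal lattice. -/
lemma tsum_dualTerm_hexagonal {s y : ℝ} (hs : 0 < s) (hy : 1 / 2 ≤ y) :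
    ∑' q, dualTerm s y 0 (1 / 3) q = 0 := by
  let σ : ℤ × ℤ ≃ ℤ × ℤ :=
    { toFun := fun q => (q.2, -q.1 - q.2)
      invFun := fun q => (-q.1 - q.2, q.1)
      left_inv := fun q => Prod.ext (by simp only []; ring) rfl
      right_inv := fun q => by ext <;> simp }
  refine tsum_eq_zero_of_threefold (summable_dualTerm_hexagonal hs hy) σ fun q => ?_
  have hσ : ∀ q, hexForm (σ q) = hexForm q := fun q => by
    simp only [σ, Equiv.coe_fn_mk, hexForm]; ring
  have hψ : ∀ q : ℤ × ℤ,
      2 * Real.pi * (1 / 3) * (((σ q).1 : ℝ) + 1 / 2 * (σ q).2) - (σ q).2 * Real.pi =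
      2 * Real.pi * (1 / 3) * (q.1 + 1 / 2 * q.2) - q.2 * Real.pi +
        ((q.2 : ℤ) : ℝ) * (2 * Real.pi) := fun q => by
    simp only [σ, Equiv.coe_fn_mk]
    push_cast
    ring
  simp only [dualTerm, hψ, hσ, Real.cos_add_int_mul_two_pi, Real.sin_add_int_mul_two_pi, mul_zero,
    add_zero]
  simp only [σ, Equiv.coe_fn_mk, hexForm]
  push_cast
  ring

lemma sum_hexCore_dualTerm_hexagonal (s y : ℝ) :
    ∑ q ∈ hexCore, dualTerm s y 0 (1 / 3) q = 0 := by
  rw [sum_hexCore_dualTerm, mul_one_div, Real.cos_pi_div_three]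
  simp only [mul_zero, neg_zero, Real.exp_zero]
  ring

lemma dualTerm_sub_hexagonal_le {s y : ℝ} (hy : √3 / 2 ≤ y) (hy1 : y ≤ 1) (hs : 1 ≤ s)
    (q : ℤ × ℤ) (hq : 3 ≤ hexForm q) :
    dualTerm s y (y ^ 2 - 3 / 4) (shiftHeight y) q - dualTerm s y 0 (1 / 3) q ≤
      (shiftHeight y - 1 / 3) * s * (10.67 * (Real.pi * s / y) + 7.51) *
        ((hexForm q : ℝ) ^ 2 * Real.exp (-(Real.pi * s / y * hexForm q))) := by
  have h3 : √3 ^ 2 = 3 := Real.sq_sqrt (by norm_num)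
  have h3l : 1.732 ≤ √3 := Real.le_sqrt_of_sq_le (by norm_num)
  have hy0 : 0 < y := by linarith
  have hy2 : 3 / 4 ≤ y ^ 2 := by nlinarith
  have hγ : 0 ≤ shiftHeight y - 1 / 3 := by linarith [(shiftHeight_bounds hy0 hy2).1]
  have hω : y ^ 2 - 3 / 4 ≤ 6 * (shiftHeight y - 1 / 3) := by
    have e : y ^ 2 - 3 / 4 = y ^ 2 * (6 * (shiftHeight y - 1 / 3)) := by
      rw [shiftHeight]; field_simp; ring
    rw [e]
    exact mul_le_of_le_one_left (by linarith) (by nlinarith)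
  have hω0 : 0 ≤ y ^ 2 - 3 / 4 := by linarith
  have hN : (3 : ℝ) ≤ hexForm q := by exact_mod_cast hq
  have hl := three_mul_sq_le_hexForm q
  have hl0 := sq_nonneg (q.2 : ℝ)
  have hn := abs_two_mul_add_le hq (a := 1.1548) (by norm_num) (by norm_num)
  have hp : 0 ≤ Real.pi * s / y := by have := Real.pi_pos; positivity
  rw [dualTerm, dualTerm]
  set N : ℝ := (hexForm q : ℝ)
  set p := Real.pi * s / y
  set γ := shiftHeight y - 1 / 3
  set u := (q.2 : ℝ) ^ 2 * (y ^ 2 - 3 / 4) with hu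
  have hu0 : 0 ≤ u := mul_nonneg hl0 hω0
  have hu1 : u ≤ 8 * γ * N := by
    have h1 := mul_le_mul_of_nonneg_left hω hl0
    have h2 := mul_le_mul_of_nonneg_right hl hγ
    linarith
  have hψ := Real.abs_cos_sub_cos_le
    (2 * Real.pi * shiftHeight y * (q.1 + 1 / 2 * q.2) - q.2 * Real.pi)
    (2 * Real.pi * (1 / 3) * (q.1 + 1 / 2 * q.2) - q.2 * Real.pi)
  have hψ' := Real.abs_sin_sub_sin_le
    (2 * Real.pi * shiftHeight y * (q.1 + 1 / 2 * q.2) - q.2 * Real.pi)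
    (2 * Real.pi * (1 / 3) * (q.1 + 1 / 2 * q.2) - q.2 * Real.pi)
  have eψ : 2 * Real.pi * shiftHeight y * (q.1 + 1 / 2 * q.2) - q.2 * Real.pi -
    (2 * Real.pi * (1 / 3) * (q.1 + 1 / 2 * q.2) - q.2 * Real.pi) =
    Real.pi * γ * (2 * (q.1 : ℝ) + q.2) := by simp only [γ]; ring
  rw [eψ, abs_mul, abs_of_nonneg (mul_nonneg Real.pi_pos.le hγ)] at hψ hψ'
  have hδ : Real.pi * γ * |2 * (q.1 : ℝ) + q.2| ≤ 3.628 * γ * N := by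
    have h1 : Real.pi * γ ≤ 3.1416 * γ := by gcongr; exact Real.pi_lt_d4.le
    calc _ ≤ 3.1416 * γ * (1.1548 * N) := by gcongr
      _ ≤ _ := by nlinarith [mul_nonneg hγ (by linarith : 0 ≤ N)]
  have hm : |(2 * (q.1 : ℝ) + q.2) / (4 * y)| ≤ 0.3334 * N := by
    rw [abs_div, abs_of_pos (by positivity : 0 < 4 * y), div_le_iff₀ (by positivity)]
    have : N * 0.866 ≤ N * y := mul_le_mul_of_nonneg_left (by linarith) (by linarith)
    linarith
  have hM : |N - (q.2 : ℝ) ^ 2 * (3 / 2)| ≤ N := by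
    rw [abs_le]; constructor <;> linarith
  have e1 : N - (q.2 : ℝ) ^ 2 * (3 / 2 + (y ^ 2 - 3 / 4)) = N - (q.2 : ℝ) ^ 2 * (3 / 2) - u := by
    rw [hu]; ring
  rw [e1, mul_zero, add_zero, add_zero, mul_add, neg_add, Real.exp_add]
  have hX := Real.exp_pos (-(p * N))
  have hG0 := Real.exp_pos (-(p * u))
  have hG1 : Real.exp (-(p * u)) ≤ 1 := Real.exp_le_one_iff.2 (by
    linarith [mul_nonneg hp hu0])
  have hG2 := Real.add_one_le_exp (-(p * u))
  have c1 := Real.abs_cos_le_one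
    (2 * Real.pi * shiftHeight y * (q.1 + 1 / 2 * q.2) - q.2 * Real.pi)
  have c2 := Real.abs_cos_le_one (2 * Real.pi * (1 / 3) * (q.1 + 1 / 2 * q.2) - q.2 * Real.pi)
  have c3 := Real.abs_sin_le_one (2 * Real.pi * (1 / 3) * (q.1 + 1 / 2 * q.2) - q.2 * Real.pi)
  generalize Real.cos (2 * Real.pi * shiftHeight y * (q.1 + 1 / 2 * q.2) - q.2 * Real.pi) = a at *
  generalize Real.sin (2 * Real.pi * shiftHeight y * (q.1 + 1 / 2 * q.2) - q.2 * Real.pi) = b at *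
  generalize Real.cos (2 * Real.pi * (1 / 3) * (q.1 + 1 / 2 * q.2) - q.2 * Real.pi) = a0 at *
  generalize Real.sin (2 * Real.pi * (1 / 3) * (q.1 + 1 / 2 * q.2) - q.2 * Real.pi) = b0 at *
  generalize (2 * (q.1 : ℝ) + q.2) / (4 * y) = m at *
  generalize N - (q.2 : ℝ) ^ 2 * (3 / 2) = M at *
  generalize Real.exp (-(p * N)) = X at *
  generalize Real.exp (-(p * u)) = G at *
  have hN0 : 0 ≤ N := by linarith
  have hs0 : 0 ≤ s := by linarith
  have hγN : 0 ≤ γ * N := mul_nonneg hγ hN0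
  have t1 : -(s * u * a) ≤ s * (8 * γ * N) := by
    calc _ ≤ |s * u * a| := neg_le_abs _
      _ = s * u * |a| := by rw [abs_mul, abs_of_nonneg (mul_nonneg hs0 hu0)]
      _ ≤ s * u * 1 := by gcongr
      _ ≤ _ := by rw [mul_one]; gcongr
  have t2 : s * M * (a - a0) ≤ s * N * (3.628 * γ * N) := by
    calc _ ≤ |s * M * (a - a0)| := le_abs_self _
      _ = s * |M| * |a - a0| := by rw [abs_mul, abs_mul, abs_of_nonneg hs0]
      _ ≤ _ := by
        have := hψ.trans hδ
        gcongr
  have t3 : -(m * (b - b0)) ≤ 0.3334 * N * (3.628 * γ * N) := by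
    calc _ ≤ |m * (b - b0)| := neg_le_abs _
      _ = |m| * |b - b0| := abs_mul _ _
      _ ≤ _ := by
        have := hψ'.trans hδ
        gcongr
  have t4 : -(s * M * a0 - m * b0) ≤ s * N + 0.3334 * N := by
    calc _ ≤ |s * M * a0 - m * b0| := neg_le_abs _
      _ ≤ |s * M * a0| + |m * b0| := abs_sub _ _
      _ = s * |M| * |a0| + |m| * |b0| := by rw [abs_mul, abs_mul, abs_mul, abs_of_nonneg hs0]
      _ ≤ s * N * 1 + 0.3334 * N * 1 := by gcongr
      _ = _ := by ring
  have hsN : N ≤ s * N := le_mul_of_one_le_left hN0 hs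
  have hsγ : γ * N ^ 2 ≤ s * (γ * N ^ 2) := le_mul_of_one_le_left (by positivity) hs
  have t5 : G * (-(s * u * a) + s * M * (a - a0) - m * (b - b0)) ≤
      s * γ * N ^ 2 * 7.51 := by
    have h0 : -(s * u * a) + s * M * (a - a0) - m * (b - b0) ≤ s * γ * N ^ 2 * 7.51 := by
      have : s * γ * N * 3 ≤ s * γ * N * N :=
        mul_le_mul_of_nonneg_left hN (mul_nonneg (mul_nonneg hs0 hγ) hN0)
      have : 0 ≤ s * γ * N ^ 2 := by positivity
      linarith
    calc _ ≤ G * (s * γ * N ^ 2 * 7.51) := by gcongr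
      _ ≤ _ := mul_le_of_le_one_left (by positivity) hG1
  have t6 : (1 - G) * (-(s * M * a0 - m * b0)) ≤ s * γ * N ^ 2 * (10.67 * p) := by
    have hpu : p * u ≤ p * (8 * γ * N) := by gcongr
    calc _ ≤ (1 - G) * (s * N + 0.3334 * N) := by
          refine mul_le_mul_of_nonneg_left t4 (by linarith)
      _ ≤ (1 - G) * (1.3334 * (s * N)) := by
          refine mul_le_mul_of_nonneg_left (by linarith) (by linarith)
      _ ≤ p * (8 * γ * N) * (1.3334 * (s * N)) := by
          refine mul_le_mul_of_nonneg_right (by linarith) (by positivity)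
      _ = s * γ * N ^ 2 * (10.6672 * p) := by ring
      _ ≤ _ := by gcongr; norm_num
  calc _ = X * (G * (-(s * u * a) + s * M * (a - a0) - m * (b - b0)) +
        (1 - G) * (-(s * M * a0 - m * b0))) := by ring
    _ ≤ X * (s * γ * N ^ 2 * 7.51 + s * γ * N ^ 2 * (10.67 * p)) := by gcongr
    _ = _ := by ring

lemma exp_neg_le_of_pi_le {p : ℝ} (hp : 3.1415 ≤ p) : Real.exp (-p) ≤ 0.0433 := by
  have h1 : Real.exp 1 ^ 3 * Real.exp 0.1415 ≤ Real.exp p := by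
    rw [← Real.exp_nat_mul, ← Real.exp_add]
    exact Real.exp_le_exp.2 (by norm_num; linarith)
  have h2 := Real.quadratic_le_exp_of_nonneg (by norm_num : (0 : ℝ) ≤ 0.1415)
  have h3 : (2.7182818283 : ℝ) ^ 3 * (1 + 0.1415 + 0.1415 ^ 2 / 2) ≤
      Real.exp 1 ^ 3 * Real.exp 0.1415 := by
    have := Real.exp_one_gt_d9
    gcongr
  rw [Real.exp_neg]
  refine inv_le_of_inv_le₀ (by norm_num) (le_trans ?_ (h3.trans h1))
  norm_num

lemma tsum_dualTerm_neg_of_le_one {s y : ℝ} (hy : √3 / 2 < y) (hy1 : y ≤ 1) (hs : 1 ≤ s) :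
    ∑' q, dualTerm s y (y ^ 2 - 3 / 4) (shiftHeight y) q < 0 := by
  have h3 : √3 ^ 2 = 3 := Real.sq_sqrt (by norm_num)
  have h3l : 1.732 ≤ √3 := Real.le_sqrt_of_sq_le (by norm_num)
  have hy0 : 0 < y := by linarith
  have hy2 : 3 / 4 < y ^ 2 := by nlinarith
  have hpi := Real.pi_gt_d4
  have hγ : 0 < shiftHeight y - 1 / 3 := by
    have e : shiftHeight y - 1 / 3 = (y ^ 2 - 3 / 4) / (6 * y ^ 2) := by
      rw [shiftHeight]; field_simp; ring
    rw [e]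
    exact div_pos (by linarith) (by positivity)
  have hp : 3.1415 ≤ Real.pi * s / y := by
    rw [le_div_iff₀ hy0]; nlinarith
  have hcore := sum_hexCore_dualTerm_le hy.le hs (by linarith)
  have hs1 := (hasDerivAt_latticeThetaHat_half (by linarith : 0 < s)
    (by linarith : 1 / 2 < y)).1
  have hs2 := summable_dualTerm_hexagonal (by linarith : 0 < s) (by linarith : 1 / 2 ≤ y)
  have htail := tsum_le_sum_hexCore_add (p := Real.pi * s / y)
    (D := (shiftHeight y - 1 / 3) * s * (10.67 * (Real.pi * s / y) + 7.51)) (j := 2)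
    le_rfl (by linarith) (mul_nonneg (mul_nonneg hγ.le (by linarith)) (by linarith))
    (hs1.sub hs2) (dualTerm_sub_hexagonal_le hy.le hy1 hs)
  rw [hs1.tsum_sub hs2, Finset.sum_sub_distrib, sum_hexCore_dualTerm_hexagonal,
    tsum_dualTerm_hexagonal (by linarith) (by linarith), sub_zero, sub_zero] at htail
  have hE : ∀ n : ℕ, Real.exp (-(Real.pi * s / y * n)) = Real.exp (-(Real.pi * s / y)) ^ n :=
    fun n => by rw [← Real.exp_nat_mul]; ring_nf
  have hE3 := hE 3
  have hE4 := hE 4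
  have hE7 := hE 7
  push_cast at hE3 hE4 hE7
  rw [hE3, hE4, hE7] at htail
  have hX := Real.exp_pos (-(Real.pi * s / y))
  have hX1 := exp_neg_le_of_pi_le hp
  have hpX := mul_exp_neg_le (p := Real.pi * s / y) (by linarith)
  have hv : 1 / (2 * y) ≤ 0.57737 := by
    rw [div_le_iff₀ (by positivity)]; linarith
  generalize Real.pi * s / y = p at *
  generalize Real.exp (-p) = X at *
  generalize 1 / (2 * y) = v at *
  generalize shiftHeight y - 1 / 3 = γ at *
  have hfin : (10.67 * p + 7.51) * X * (54 * X + 96 * X ^ 2 + 6958 * X ^ 5) <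
      10.88 * (1 - v) := by
    calc _ ≤ (10.67 * 0.138 + 7.51 * 0.0433) *
          (54 * 0.0433 + 96 * 0.0433 ^ 2 + 6958 * 0.0433 ^ 5 : ℝ) := by
          refine mul_le_mul (by linarith) (by gcongr) (by positivity) (by norm_num)
      _ < 10.88 * (1 - 0.57737) := by norm_num
      _ ≤ _ := by linarith
  have hs0 : 0 < s := by linarith
  have hfin2 := mul_lt_mul_of_pos_left hfin (by positivity : 0 < γ * s * X)
  linarith

lemma strictAntiOn_latticeThetaHat_half {s : ℝ} (hs : 1 ≤ s) :
    StrictAntiOn (fun y => latticeThetaHat (1 / 2) y (bPoint (1 / 2) y) s)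
      (Set.Icc (√3 / 2) (1.5 * s)) := by
  have h3l : 1.732 ≤ √3 := Real.le_sqrt_of_sq_le (by norm_num)
  have hs0 : 0 < s := by linarith
  refine strictAntiOn_of_deriv_neg (convex_Icc _ _) (fun y hy => ?_) fun y hy => ?_
  · exact (hasDerivAt_latticeThetaHat_half hs0
      (by linarith [hy.1])).2.continuousAt.continuousWithinAt
  rw [interior_Icc] at hy
  have hy0 : 0 < y := by linarith [hy.1]
  rw [(hasDerivAt_latticeThetaHat_half hs0 (by linarith [hy.1])).2.deriv]
  refine mul_neg_of_pos_of_neg (div_pos Real.pi_pos (by positivity)) ?_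
  rcases le_total y 1 with h | h
  · exact tsum_dualTerm_neg_of_le_one hy.1 h hs
  · exact tsum_dualTerm_neg_of_one_le h hs hy.2.le

lemma le_latticeThetaHat_hexagonal {s : ℝ} (hs : 1 ≤ s) :
    0.905 ≤ latticeThetaHat (1 / 2) (√3 / 2) (bPoint (1 / 2) (√3 / 2)) s := by
  have h3 : √3 ^ 2 = 3 := Real.sq_sqrt (by norm_num)
  have h3p : 0 < √3 := by positivity
  have h3u : √3 ≤ 1.7321 := (Real.sqrt_le_left (by norm_num)).2 (by norm_num)
  have hpi := Real.pi_gt_d4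
  have hβ : shiftHeight (√3 / 2) = 1 / 3 := by
    rw [shiftHeight, div_pow, h3]; norm_num
  have hp : 3.627 ≤ Real.pi * s / (√3 / 2) := by
    rw [le_div_iff₀ (by positivity)]; nlinarith
  have hS := summable_latticeThetaHat (by positivity : 0 < √3 / 2) (by linarith : 0 < s) (1 / 2)
  have e : ∀ q : ℤ × ℤ, Real.exp (-(Real.pi * s / (√3 / 2)) * (((q.1 : ℝ) + 1 / 2 * q.2) ^ 2 +
      (√3 / 2) ^ 2 * (q.2 : ℝ) ^ 2)) *
        Real.cos (2 * Real.pi * shiftHeight (√3 / 2) * (q.1 + 1 / 2 * q.2) - q.2 * Real.pi) =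
      Real.exp (-(Real.pi * s / (√3 / 2) * hexForm q)) *
        Real.cos (2 * (Real.pi / 3) * (q.1 - q.2)) := by
    intro q
    rw [hβ, hexForm, div_pow, h3]
    push_cast
    ring_nf
  rw [latticeThetaHat_bPoint (by positivity), tsum_congr e]
  rw [summable_congr e] at hS
  generalize Real.pi * s / (√3 / 2) = p at hp hS
  have htail := tsum_le_sum_hexCore_add (p := p) (j := 0) (D := 1) (by norm_num) (by linarith)
    zero_le_one hS.neg (fun q _ => by
      rw [pow_zero, one_mul, one_mul, ← mul_neg]
      exact mul_le_of_le_one_right (Real.exp_pos _).le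
        (by linarith [Real.neg_one_le_cos (2 * (Real.pi / 3) * (q.1 - q.2))]))
  have c1 : Real.cos (2 * (Real.pi / 3)) = -1 / 2 := by
    rw [Real.cos_two_mul, Real.cos_pi_div_three]; norm_num
  have c2 : Real.cos (2 * (Real.pi / 3) * 2) = -1 / 2 := by
    rw [mul_comm _ (2 : ℝ), Real.cos_two_mul, c1]; norm_num
  have hcore : ∑ q ∈ hexCore, -(Real.exp (-(p * hexForm q)) *
      Real.cos (2 * (Real.pi / 3) * (q.1 - q.2))) = -1 + 3 * Real.exp (-p) := by
    rw [hexCore]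
    repeat rw [Finset.sum_insert (by decide)]
    rw [Finset.sum_singleton]
    have c3 : Real.cos (2 * (Real.pi / 3) * (-1 - 1)) = -1 / 2 := by
      rw [← c2, ← Real.cos_neg]; ring_nf
    have c4 : Real.cos (2 * (Real.pi / 3) * (1 + 1)) = -1 / 2 := by
      rw [← c2]; ring_nf
    simp [hexForm, c1, c3, c4]
    ring
  have hE : ∀ n : ℕ, Real.exp (-(p * n)) = Real.exp (-p) ^ n :=
    fun n => by rw [← Real.exp_nat_mul]; ring_nf
  have hE3 := hE 3
  have hE4 := hE 4
  have hE7 := hE 7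
  push_cast at hE3 hE4 hE7
  simp only [pow_zero, one_mul] at htail
  rw [tsum_neg, hcore, hE3, hE4, hE7] at htail
  have hX : Real.exp (-p) ≤ 0.03 := by
    have h1 := exp_neg_le_of_pi_le (le_refl 3.1415)
    have h2 := Real.add_one_le_exp (0.4855 : ℝ)
    have h3 : Real.exp (-p) * Real.exp 0.4855 ≤ Real.exp (-3.1415) := by
      rw [← Real.exp_add]
      exact Real.exp_le_exp.2 (by linarith)
    have h4 := mul_le_mul_of_nonneg_left h2 (Real.exp_pos (-p)).le
    linarith
  have hX0 := Real.exp_pos (-p)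
  generalize Real.exp (-p) = X at *
  have : 6 * X ^ 3 + 6 * X ^ 4 + 142 * X ^ 7 ≤ 6 * 0.03 ^ 3 + 6 * 0.03 ^ 4 + 142 * 0.03 ^ 7 := by
    gcongr
  norm_num at this
  linarith

lemma exp_neg_le_inv_add {t c : ℝ} (h : 1 + c ≤ t) (hc : 0 ≤ c) :
    Real.exp (-t) ≤ 0.3679 / (1 + c) := by
  have h1 := Real.add_one_le_exp c
  have h2 : Real.exp (-t) * Real.exp c ≤ Real.exp (-1) := by
    rw [← Real.exp_add]
    exact Real.exp_le_exp.2 (by linarith)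
  have h3 : Real.exp (-1) ≤ 0.3679 := by
    rw [Real.exp_neg]
    refine inv_le_of_inv_le₀ (by norm_num) (le_trans (by norm_num) Real.exp_one_gt_d9.le)
  have h4 := mul_le_mul_of_nonneg_left h1 (Real.exp_pos (-t)).le
  rw [le_div_iff₀ (by linarith)]
  linarith

/-- Absorbs the factor `√r` into the exponential decay. -/
lemma sqrt_mul_exp_neg_le {r a : ℝ} (hr : 1.5 ≤ r) (ha : 1 / 3 ≤ a) :
    √r * Real.exp (-(a * r)) ≤ 1.2248 * Real.exp (-(a * 1.5)) := by
  have h1 : √r ≤ 1.2248 * Real.exp ((r - 1.5) / 3) := by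
    rw [Real.sqrt_le_left (by positivity), mul_pow, ← Real.exp_nat_mul]
    have := Real.add_one_le_exp (((2 : ℕ) : ℝ) * ((r - 1.5) / 3))
    push_cast at this ⊢
    linarith
  calc _ ≤ 1.2248 * Real.exp ((r - 1.5) / 3) * Real.exp (-(a * r)) := by gcongr
    _ = 1.2248 * Real.exp ((r - 1.5) / 3 + -(a * r)) := by rw [Real.exp_add]; ring
    _ ≤ _ := by
      gcongr
      have := mul_le_mul_of_nonneg_right ha (by linarith : 0 ≤ r - 1.5)
      linarith

lemma latticeThetaHat_half_le_of_ge {s y : ℝ} (hs : 1 ≤ s) (hys : 1.5 * s ≤ y) :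
    latticeThetaHat (1 / 2) y (bPoint (1 / 2) y) s ≤ 0.9 := by
  have hpi := Real.pi_gt_d4
  have hs0 : 0 < s := by linarith
  have hy : 1.5 ≤ y := by linarith
  have hy0 : 0 < y := by linarith
  have hdual := latticeTheta_eq_inv_mul_hat hy0 (inv_pos.2 hs0) (1 / 2)
  rw [inv_inv] at hdual
  have hr : 1.5 ≤ y / s := by rwa [le_div_iff₀ hs0]
  have hβ1 : 4 / 9 ≤ shiftHeight y := by
    have : 1 / (8 * y ^ 2) ≤ 1 / (8 * 1.5 ^ 2) :=
      one_div_le_one_div_of_le (by norm_num) (by gcongr)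
    rw [shiftHeight]
    linarith
  have hβ2 := (shiftHeight_bounds hy0 (by nlinarith)).2
  have hsy : 1.5 ≤ s * y := by nlinarith
  have hrow : ∀ a : ℝ, ∑' k : ℤ, Real.exp (-(Real.pi * s⁻¹ / y) * ((k : ℝ) + a) ^ 2) ≤
      √(s * y) * 1.022 := by
    intro a
    have h := tsum_shifted_le (r := (s * y)⁻¹) (by positivity) a
    rw [Real.sqrt_inv, inv_inv, div_inv_eq_mul] at h
    have e : Real.pi * s⁻¹ / y = Real.pi * (s * y)⁻¹ := by rw [mul_inv]; ring
    rw [e]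
    refine h.trans (mul_le_mul_of_nonneg_left ?_ (Real.sqrt_nonneg _))
    refine (tsum_exp_neg_mul_sq_le (by positivity)).trans ?_
    have hE : Real.exp (-(Real.pi * (s * y))) ≤ 0.0104 := by
      have h1 : 4.71 ≤ Real.pi * (s * y) := by nlinarith
      have h2 : Real.exp (-(Real.pi * (s * y))) ≤ Real.exp (-3.1415) * Real.exp (-1.5685) := by
        rw [← Real.exp_add]
        exact Real.exp_le_exp.2 (by linarith)
      have h3 := exp_neg_le_of_pi_le (le_refl 3.1415)
      have h4 := exp_neg_le_inv_add (t := 1.5685) (c := 0.5685) (by norm_num) (by norm_num)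
      have h5 : Real.exp (-3.1415) * Real.exp (-1.5685) ≤ 0.0433 * (0.3679 / (1 + 0.5685)) := by
        gcongr
      norm_num at h5 h2 ⊢
      linarith
    have : 2 * Real.exp (-(Real.pi * (s * y))) / (1 - Real.exp (-(Real.pi * (s * y)))) ≤ 0.022 := by
      rw [div_le_iff₀ (by linarith)]; linarith
    linarith
  have hU := tsum_exp_shifted_form_le (c := Real.pi * s⁻¹ / y) (by positivity) hy0 (1 / 2) (1 / 2)
    (shiftHeight y) hrow
  rw [← latticeTheta_bPoint hy0, hdual] at hU
  have ec : Real.pi * s⁻¹ / y * y ^ 2 = Real.pi * (y / s) := by field_simp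
  have hV := tsum_exp_neg_shifted_sq_le_add (c := Real.pi * (y / s)) (by positivity)
    (by linarith) hβ2.le
  rw [ec] at hU
  have hsq : √(s * y) = s * √(y / s) := by
    rw [show s * y = s ^ 2 * (y / s) by field_simp, Real.sqrt_mul (by positivity),
      Real.sqrt_sq hs0.le]
  rw [hsq] at hU
  have hπr : 4.71 ≤ Real.pi * (y / s) := by nlinarith
  have hden : Real.exp (-(5 / 3 * (Real.pi * (y / s)))) ≤ 0.002 := by
    have h2 : Real.exp (-(5 / 3 * (Real.pi * (y / s)))) ≤
        Real.exp (-3.1415) * Real.exp (-3.1415) := by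
      rw [← Real.exp_add]
      exact Real.exp_le_exp.2 (by linarith)
    have h3 := exp_neg_le_of_pi_le (le_refl 3.1415)
    have h5 : Real.exp (-3.1415) * Real.exp (-3.1415) ≤ 0.0433 * 0.0433 := by gcongr
    linarith
  have hb : ∀ b κ : ℝ, κ ≤ Real.pi * b ^ 2 → 1 / 3 ≤ κ →
      √(y / s) * Real.exp (-(Real.pi * (y / s)) * b ^ 2) ≤ 1.2248 * Real.exp (-(κ * 1.5)) := by
    intro b κ h1 h2
    refine le_trans ?_ (sqrt_mul_exp_neg_le hr h2)
    gcongr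
    have := mul_le_mul_of_nonneg_right h1 (by linarith : 0 ≤ y / s)
    linarith
  have b1 := hb (shiftHeight y) 0.62 (by nlinarith) (by norm_num)
  have b2 := hb (1 - shiftHeight y) 0.785 (by nlinarith) (by norm_num)
  have n1 : Real.exp (-(0.62 * 1.5)) ≤ 0.396 := by
    have h1 := Real.add_one_le_exp (-0.07 : ℝ)
    have h2 := exp_neg_le_inv_add (le_refl (1 + 0 : ℝ)) le_rfl
    have h3 : Real.exp (-(0.62 * 1.5)) * Real.exp (-0.07) = Real.exp (-(1 + 0)) := by
      rw [← Real.exp_add]; norm_num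
    have h4 := mul_le_mul_of_nonneg_left h1 (Real.exp_pos (-(0.62 * 1.5))).le
    linarith
  have n2 := exp_neg_le_inv_add (t := 0.785 * 1.5) (c := 0.1775) (by norm_num) (by norm_num)
  have hr0 := Real.sqrt_nonneg (y / s)
  generalize √(y / s) = w at *
  generalize Real.exp (-(5 / 3 * (Real.pi * (y / s)))) = ρ at *
  generalize Real.exp (-(Real.pi * (y / s)) * shiftHeight y ^ 2) = A at *
  generalize Real.exp (-(Real.pi * (y / s)) * (1 - shiftHeight y) ^ 2) = B at *
  have hAB : w * ((A + B) / (1 - ρ)) ≤ 0.87 := by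
    rw [← mul_div_assoc, div_le_iff₀ (by linarith)]
    norm_num at n2
    linarith
  have hV2 := mul_le_mul_of_nonneg_left hV (mul_nonneg hs0.le hr0)
  have hAB2 := mul_le_mul_of_nonneg_left hAB hs0.le
  refine le_of_mul_le_mul_left ?_ hs0
  linarith

lemma latticeThetaHat_half_lt_hexagonal {y s : ℝ} (hy : √3 / 2 < y) (hs : 1 ≤ s) :
    latticeThetaHat (1 / 2) y (bPoint (1 / 2) y) s <
      latticeThetaHat (1 / 2) (√3 / 2) (bPoint (1 / 2) (√3 / 2)) s := by
  rcases le_total (1.5 * s) y with h | h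
  · linarith [latticeThetaHat_half_le_of_ge hs h, le_latticeThetaHat_hexagonal hs]
  · exact strictAntiOn_latticeThetaHat_half hs ⟨le_rfl, by linarith⟩ ⟨hy.le, h⟩ hy

/-- Strict maximality of the hexagonal lattice for the shifted theta function. -/
lemma latticeTheta_lt_hexagonal {x y α : ℝ} (hxy : (x, y) ∈ Dplus) (hα : 0 < α)
    (hne : (x, y) ≠ (1 / 2, √3 / 2)) :
    latticeTheta x y (bPoint x y) α <
      latticeTheta (1 / 2) (√3 / 2) (bPoint (1 / 2) (√3 / 2)) α := by
  obtain ⟨hx0, hx1, hy0, hr⟩ := hxy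
  dsimp only at hx0 hx1 hy0 hr
  have hh0 : 0 < √3 / 2 := by positivity
  have hy : 3 / 4 ≤ y ^ 2 := by nlinarith
  have hyh : √3 / 2 ≤ y := by
    rw [div_le_iff₀ two_pos, Real.sqrt_le_left (by positivity)]
    linarith
  have hvert : √3 / 2 < y → latticeTheta (1 / 2) y (bPoint (1 / 2) y) α <
      latticeTheta (1 / 2) (√3 / 2) (bPoint (1 / 2) (√3 / 2)) α := by
    intro hlt
    rcases le_total 1 α with h | h
    · exact latticeTheta_half_lt_hexagonal hlt h
    · rw [latticeTheta_eq_inv_mul_hat hy0 hα, latticeTheta_eq_inv_mul_hat hh0 hα]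
      exact mul_lt_mul_of_pos_left
        (latticeThetaHat_half_lt_hexagonal hlt ((one_le_inv₀ hα).2 h)) (inv_pos.2 hα)
  rcases hx1.lt_or_eq with hx | rfl
  · have h1 := latticeTheta_lt_half hy0 hy hx0 hx hα
    rcases hyh.lt_or_eq with h | rfl
    · exact h1.trans (hvert h)
    · exact h1
  · exact hvert (hyh.lt_of_ne fun h => hne (by rw [h]))

lemma latticeThetaHat_lt_hexagonal {x y α : ℝ} (hxy : (x, y) ∈ Dplus) (hα : 0 < α)
    (hne : (x, y) ≠ (1 / 2, √3 / 2)) :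
    latticeThetaHat x y (bPoint x y) α <
      latticeThetaHat (1 / 2) (√3 / 2) (bPoint (1 / 2) (√3 / 2)) α := by
  have h := latticeTheta_lt_hexagonal hxy (inv_pos.2 hα) hne
  rw [latticeTheta_eq_inv_mul_hat hxy.2.2.1 (inv_pos.2 hα),
    latticeTheta_eq_inv_mul_hat (by positivity) (inv_pos.2 hα), inv_inv] at h
  exact lt_of_mul_lt_mul_left h hα.le

/-- Theorem: both `θ_{x,y}(b(x,y);α)` and `θ̂_{x,y}(b(x,y);α)` are maximized over `D₊`
exactly at the hexagonal point `(1/2, √3/2)`, for every `α > 0`. -/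
theorem thm_theta (x y : ℝ) (hxy : (x, y) ∈ Dplus) (α : ℝ) (hα : 0 < α) :
    latticeTheta x y (bPoint x y) α ≤
      latticeTheta (1 / 2) (Real.sqrt 3 / 2) (bPoint (1 / 2) (Real.sqrt 3 / 2)) α ∧
    latticeThetaHat x y (bPoint x y) α ≤
      latticeThetaHat (1 / 2) (Real.sqrt 3 / 2) (bPoint (1 / 2) (Real.sqrt 3 / 2)) α ∧
    (latticeTheta x y (bPoint x y) α =
        latticeTheta (1 / 2) (Real.sqrt 3 / 2) (bPoint (1 / 2) (Real.sqrt 3 / 2)) α ↔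
      (x, y) = (1 / 2, Real.sqrt 3 / 2)) ∧
    (latticeThetaHat x y (bPoint x y) α =
        latticeThetaHat (1 / 2) (Real.sqrt 3 / 2) (bPoint (1 / 2) (Real.sqrt 3 / 2)) α ↔
      (x, y) = (1 / 2, Real.sqrt 3 / 2)) := by
  by_cases hne : (x, y) = (1 / 2, √3 / 2)
  · obtain ⟨rfl, rfl⟩ := Prod.mk.inj hne
    simp
  · have h1 := latticeTheta_lt_hexagonal hxy hα hne
    have h2 := latticeThetaHat_lt_hexagonal hxy hα hne
    exact ⟨h1.le, h2.le, iff_of_false h1.ne hne, iff_of_false h2.ne hne⟩
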